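/- There exist universal constants M > 0 and δ ∈ (0,1) such that if S is an entire maximal surface in three-dimensional Anti-de Sitter space with principal curvatures satisfying δ ≤ ‖λ‖∞ < 1 and whose asymptotic boundary is the graph of an orientation-preserving homeomorphism with convex hull of width w, then tan(w) ≥ (1/(1−‖λ‖∞))^{1/M}. -/

import Mathlib

/-!
Common framework for formalizing "Maximal surfaces in Anti-de Sitter space, width of
convex hulls and quasiconformal extensions of quasisymmetric homeomorphisms" (A. Seppi).

Anti-de Sitter space is modeled projectively: `qform` is the bilinear form of
signature (2,2) on ℝ⁴, `AdS3` is the projectivization of its negative cone,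
and spacelike surfaces are recorded through (lifts of) smooth spacelike embeddings
of ℝ² into the quadric {⟨x,x⟩ = -1} (the double cover of AdS³), together with a
future-directed unit normal field and the associated shape operator.
-/

noncomputable section

open Real Set Filter Topology

namespace AdSPaper

/-- The bilinear form of signature `(2,2)` on `ℝ⁴`. -/
def qform (x y : Fin 4 → ℝ) : ℝ :=
  x 0 * y 0 + x 1 * y 1 - x 2 * y 2 - x 3 * y 3

/-- Quotient topology on a projectivization. -/
instance (K V : Type*) [DivisionRing K] [AddCommGroup V] [Module K V] [TopologicalSpace V] :
    TopologicalSpace (Projectivization K V) := by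
  unfold Projectivization
  infer_instance

/-- Real projective 3-space. -/
abbrev RP3 := Projectivization ℝ (Fin 4 → ℝ)

/-- The real projective line. -/
abbrev RP1 := Projectivization ℝ (Fin 2 → ℝ)

/-- The point of `ℝP³` determined by a nonzero vector of `ℝ⁴`. -/
def projPt (x : Fin 4 → ℝ) (hx : x ≠ 0) : RP3 := Projectivization.mk ℝ x hx

/-- Anti-de Sitter space: the projectivization of the negative cone of `qform`.
(The sign of `qform x x` does not depend on the chosen representative.) -/
def AdS3 : Set RP3 := {P | qform P.rep P.rep < 0}

/-- The boundary at infinity of Anti-de Sitter space: the projectivization of the null cone. -/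
def bdryAdS3 : Set RP3 := {P | qform P.rep P.rep = 0}

/-- The nonzero lifts of a subset of `ℝP³`. -/
def lifts (Γ : Set RP3) : Set (Fin 4 → ℝ) :=
  {x | ∃ hx : x ≠ 0, projPt x hx ∈ Γ}

/-- The (projective) convex hull of a set `Γ ⊆ ℝP³` contained in an affine chart:
the image of the convex hull of a coherent family of lifts of `Γ`, chosen on the positive
side of a linear hyperplane avoiding all lifts of `Γ` (i.e. an affine chart containing `Γ`). -/
def projConvexHull (Γ : Set RP3) : Set RP3 :=
  {P | ∃ L : (Fin 4 → ℝ) →ₗ[ℝ] ℝ, (∀ x ∈ lifts Γ, L x ≠ 0) ∧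
      ∃ (y : Fin 4 → ℝ) (hy : y ≠ 0), projPt y hy = P ∧
        y ∈ convexHull ℝ {x | x ∈ lifts Γ ∧ 0 < L x}}

/-- The width of (the convex hull of) a set `Γ ⊆ ℝP³`: the supremum of the lengths of
timelike geodesic segments `t ↦ [cos t • a + sin t • b]` contained in the convex hull of `Γ`. -/
def width (Γ : Set RP3) : ℝ :=
  sSup {T : ℝ | 0 ≤ T ∧ T < π ∧ ∃ a b : Fin 4 → ℝ,
      qform a a = -1 ∧ qform b b = -1 ∧ qform a b = 0 ∧
      ∀ t ∈ Icc (0 : ℝ) T, ∃ h : (Real.cos t • a + Real.sin t • b) ≠ 0,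
        projPt (Real.cos t • a + Real.sin t • b) h ∈ projConvexHull Γ}

/-- Inverse hyperbolic cosine. -/
def arcosh (x : ℝ) : ℝ := Real.log (x + Real.sqrt (x ^ 2 - 1))

/-! ### The projective line, cross-ratios and quasisymmetric homeomorphisms -/

/-- Determinant of a pair of vectors of ℝ². -/
def det2 (v w : Fin 2 → ℝ) : ℝ := v 0 * w 1 - v 1 * w 0

/-- The cross-ratio of a quadruple of points of `ℝP¹`, with the convention
`cr(z₁,z₂,z₃,z₄) = (z₄−z₁)(z₃−z₂)/((z₂−z₁)(z₃−z₄))`.  (The expression below is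
invariant under rescaling of each of the four representatives.) -/
def crossRatio (z₁ z₂ z₃ z₄ : RP1) : ℝ :=
  (det2 z₄.rep z₁.rep * det2 z₃.rep z₂.rep) / (det2 z₂.rep z₁.rep * det2 z₃.rep z₄.rep)

/-- The cyclic orientation invariant of a triple of points of `ℝP¹`
(for finite points `a,b,c` it equals `(a−b)(b−c)(c−a)` and its sign is scale invariant). -/
def tripleOrient (a b c : RP1) : ℝ :=
  det2 a.rep b.rep * det2 b.rep c.rep * det2 c.rep a.rep

/-- A map of `ℝP¹` is orientation-preserving if it preserves the cyclic orientation
of triples of points. -/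
def OrientationPreserving (φ : RP1 → RP1) : Prop :=
  ∀ a b c : RP1, 0 < tripleOrient a b c → 0 < tripleOrient (φ a) (φ b) (φ c)

/-- The set of cross-ratio distortions `|ln |cr(φ(Q))||` of symmetric quadruples
(`cr(Q) = -1`) under the map `φ`. -/
def crSet (φ : RP1 → RP1) : Set ℝ :=
  {r | ∃ z₁ z₂ z₃ z₄ : RP1, crossRatio z₁ z₂ z₃ z₄ = -1 ∧
      r = |Real.log (abs (crossRatio (φ z₁) (φ z₂) (φ z₃) (φ z₄)))|}

/-- The cross-ratio norm `‖φ‖_cr` of a circle map `φ`. -/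
def crNorm (φ : RP1 → RP1) : ℝ := sSup (crSet φ)

/-- A quasisymmetric homeomorphism of `ℝP¹`: an orientation-preserving homeomorphism
with finite cross-ratio norm. -/
def Quasisymmetric (φ : RP1 ≃ₜ RP1) : Prop :=
  OrientationPreserving ⇑φ ∧ BddAbove (crSet ⇑φ)

/-- The null vector of ℝ^{2,2} corresponding to the pair of lines `([v],[w]) ∈ ℝP¹ × ℝP¹`
under the standard identification of `∂∞AdS³` with `ℝP¹ × ℝP¹` (via the rank-one
2×2 matrix `v wᵀ`, identifying ℝ^{2,2} with 2×2 matrices with minus the determinant). -/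
def toBoundary (v w : Fin 2 → ℝ) : Fin 4 → ℝ :=
  ![(v 0 * w 0 - v 1 * w 1) / 2, (v 0 * w 1 + v 1 * w 0) / 2,
    (v 0 * w 0 + v 1 * w 1) / 2, (v 0 * w 1 - v 1 * w 0) / 2]

/-- The graph `gr(φ)` of a map `φ : ℝP¹ → ℝP¹`, as a curve in `∂∞AdS³ ⊆ ℝP³`. -/
def grGraph (φ : RP1 → RP1) : Set RP3 :=
  {P | ∃ (v w : Fin 2 → ℝ) (hv : v ≠ 0) (hw : w ≠ 0) (hx : toBoundary v w ≠ 0),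
      projPt (toBoundary v w) hx = P ∧
      φ (Projectivization.mk ℝ v hv) = Projectivization.mk ℝ w hw}

/-! ### Spacelike and maximal surfaces in AdS³ -/

/-- The global timelike vector field `x ↦ (0,0,−x₄,x₃)` on the quadric, fixing the
time orientation of AdS³. -/
def timeVec (x : Fin 4 → ℝ) : Fin 4 → ℝ := ![0, 0, -(x 3), x 2]

/-- A (lifted, parametrized) smooth spacelike embedded disc in AdS³: a smooth embedding
of ℝ² into the quadric `{⟨x,x⟩ = −1} ⊆ ℝ^{2,2}` (the double cover of AdS³), with spacelike
first fundamental form, together with its future-directed unit normal field and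
the associated shape operator `B = ∇N`. -/
structure SpacelikeSurface where
  /-- the embedding of ℝ² into the quadric -/
  emb : (Fin 2 → ℝ) → (Fin 4 → ℝ)
  /-- the future-directed unit normal vector field -/
  normal : (Fin 2 → ℝ) → (Fin 4 → ℝ)
  /-- the shape operator, in the coordinates of the parametrization -/
  shape : (Fin 2 → ℝ) → ((Fin 2 → ℝ) →ₗ[ℝ] (Fin 2 → ℝ))
  smooth_emb : ContDiff ℝ (⊤ : ℕ∞) emb
  smooth_normal : ContDiff ℝ (⊤ : ℕ∞) normal
  inj : Function.Injective emb
  on_quadric : ∀ y, qform (emb y) (emb y) = -1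
  spacelike : ∀ y v, v ≠ 0 → 0 < qform (fderiv ℝ emb y v) (fderiv ℝ emb y v)
  normal_unit : ∀ y, qform (normal y) (normal y) = -1
  normal_orth_base : ∀ y, qform (normal y) (emb y) = 0
  normal_orth : ∀ y v, qform (normal y) (fderiv ℝ emb y v) = 0
  normal_future : ∀ y, qform (normal y) (timeVec (emb y)) < 0
  shape_spec : ∀ y v, fderiv ℝ normal y v = fderiv ℝ emb y (shape y v)

namespace SpacelikeSurface

variable (S : SpacelikeSurface)

/-- A spacelike surface is maximal if its shape operator is traceless. -/
def IsMaximal : Prop := ∀ y, LinearMap.trace ℝ (Fin 2 → ℝ) (S.shape y) = 0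

/-- The surface as a subset of `ℝP³` (i.e. of AdS³). -/
def proj : Set RP3 :=
  {P | ∃ (y : Fin 2 → ℝ) (h : S.emb y ≠ 0), projPt (S.emb y) h = P}

/-- The asymptotic boundary `∂∞S` of the surface: the frontier `closure S \ S`. -/
def bdryAtInfinity : Set RP3 := closure S.proj \ S.proj

/-- The surface is entire if its frontier is contained in the boundary at
infinity of AdS³. -/
def IsEntire : Prop := S.bdryAtInfinity ⊆ bdryAdS3

/-- The nonnegative principal curvature `λ` at a point: for a maximal surface the
principal curvatures are `±λ` with `λ = √(−det B)`. -/
def lambdaAt (y : Fin 2 → ℝ) : ℝ := Real.sqrt (-(LinearMap.det (S.shape y)))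

/-- The supremum `‖λ‖∞` of the principal curvatures of the surface. -/
def lambdaSup : ℝ := ⨆ y, S.lambdaAt y

/-- Nonpositive curvature: by the Gauss equation `K = −1 + λ²`, this is `λ ≤ 1`. -/
def NonpositiveCurvature : Prop := ∀ y, S.lambdaAt y ≤ 1

/-- Uniformly negative curvature: `λ ≤ 1 − ε` for some `ε > 0`. -/
def UniformlyNegativeCurvature : Prop := ∃ ε > 0, ∀ y, S.lambdaAt y ≤ 1 - ε

/-- The set of non-umbilical points of a maximal surface (where `λ ≠ 0`). -/
def nonUmbilic : Set (Fin 2 → ℝ) := {y | LinearMap.det (S.shape y) ≠ 0}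

/-- The intrinsic distance of the induced Riemannian metric on the surface. -/
def idist (y₁ y₂ : Fin 2 → ℝ) : ℝ :=
  sInf {L | ∃ c : ℝ → (Fin 2 → ℝ), ContDiff ℝ (⊤ : ℕ∞) c ∧ c 0 = y₁ ∧ c 1 = y₂ ∧
      L = ∫ t in (0:ℝ)..(1:ℝ),
        Real.sqrt (qform (deriv (fun s => S.emb (c s)) t) (deriv (fun s => S.emb (c s)) t))}

/-- `F` is the intrinsic gradient field of the function `f` on `U ⊆ S`: the vector field
which is `I`-dual to the differential of `f`. -/
def IsGradientOn (U : Set (Fin 2 → ℝ)) (f : (Fin 2 → ℝ) → ℝ)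
    (F : (Fin 2 → ℝ) → (Fin 2 → ℝ)) : Prop :=
  ∀ y ∈ U, ∀ v, qform (fderiv ℝ S.emb y (F y)) (fderiv ℝ S.emb y v) = fderiv ℝ f y v

/-- `H` is the intrinsic Hessian (as a (1,1)-tensor) of a function with gradient field `F`
on `U ⊆ S`: the tangential part of the ambient flat derivative of the ambient gradient
field (the normal part, in the ambient coordinates, lies in `span{σ(y), N(y)}`). -/
def IsHessianOn (U : Set (Fin 2 → ℝ)) (F : (Fin 2 → ℝ) → (Fin 2 → ℝ))
    (H : (Fin 2 → ℝ) → ((Fin 2 → ℝ) →ₗ[ℝ] (Fin 2 → ℝ))) : Prop :=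
  ∀ y ∈ U, ∀ v, ∃ a b : ℝ,
    fderiv ℝ (fun y' => fderiv ℝ S.emb y' (F y')) y v
      = fderiv ℝ S.emb y (H y v) + a • S.emb y + b • S.normal y

/-- The squared norm `‖grad f‖²` of a gradient field `F`, for the induced metric. -/
def gradNormSq (F : (Fin 2 → ℝ) → (Fin 2 → ℝ)) (y : Fin 2 → ℝ) : ℝ :=
  qform (fderiv ℝ S.emb y (F y)) (fderiv ℝ S.emb y (F y))

/-- `Δf` is the Laplace–Beltrami operator of the induced metric applied to `f`, on `U`:
the trace of the intrinsic Hessian. -/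
def IsLaplacianOn (U : Set (Fin 2 → ℝ)) (f Δf : (Fin 2 → ℝ) → ℝ) : Prop :=
  ∃ F H, S.IsGradientOn U f F ∧ S.IsHessianOn U F H ∧
    ∀ y ∈ U, Δf y = LinearMap.trace ℝ (Fin 2 → ℝ) (H y)

/-- `c` parametrizes an intrinsic geodesic of the surface: the ambient acceleration
is orthogonal to the surface, i.e. lies in `span{σ(c t), N(c t)}`. -/
def IsIntrinsicGeodesic (c : ℝ → (Fin 2 → ℝ)) : Prop :=
  ∀ t, ∃ a b : ℝ,
    deriv (deriv (fun s => S.emb (c s))) t = a • S.emb (c t) + b • S.normal (c t)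

/-- `E` is a system of normal coordinates for the surface centered at `y₀` (i.e. the
exponential map of the induced metric at that point, read in an orthonormal frame). -/
def IsNormalCoordsAt (y₀ : Fin 2 → ℝ) (E : (Fin 2 → ℝ) → (Fin 2 → ℝ)) : Prop :=
  E 0 = y₀ ∧ (∀ v, S.IsIntrinsicGeodesic (fun t => E (t • v))) ∧
  ∀ v w : Fin 2 → ℝ,
    qform (deriv (fun t : ℝ => S.emb (E (t • v))) 0) (deriv (fun t : ℝ => S.emb (E (t • w))) 0)
      = v 0 * w 0 + v 1 * w 1

end SpacelikeSurface

/-- The normal flow at time `ρ`: the parametrization of the surface `S_ρ` at constant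
timelike distance `ρ` from `S`. -/
def parallelEmb (S : SpacelikeSurface) (ρ : ℝ) : (Fin 2 → ℝ) → (Fin 4 → ℝ) :=
  fun y => Real.cos ρ • S.emb y + Real.sin ρ • S.normal y

/-- The pull-back to `S` of the first fundamental form of the parallel surface `S_ρ`. -/
def Irho (S : SpacelikeSurface) (ρ : ℝ) (y : Fin 2 → ℝ) (v w : Fin 2 → ℝ) : ℝ :=
  qform (fderiv ℝ (parallelEmb S ρ) y v) (fderiv ℝ (parallelEmb S ρ) y w)

/-- The second fundamental form of the parallel surface `S_ρ`, via `II_ρ = ½ dI_ρ/dρ`. -/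
def IIrho (S : SpacelikeSurface) (ρ : ℝ) (y : Fin 2 → ℝ) (v w : Fin 2 → ℝ) : ℝ :=
  (1 / 2) * deriv (fun ρ' => Irho S ρ' y v w) ρ

/-! ### Euclidean balls and `C⁰`/`C²` norms on ℝ² -/

/-- The Euclidean ball of radius `r` centered at the origin of ℝ². -/
def eball (r : ℝ) : Set (Fin 2 → ℝ) := {z | Real.sqrt ((z 0) ^ 2 + (z 1) ^ 2) < r}

/-- The `C⁰` norm of a function on the Euclidean ball of radius `r`. -/
def C0norm (u : (Fin 2 → ℝ) → ℝ) (r : ℝ) : ℝ :=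
  sSup {a | ∃ z ∈ eball r, a = |u z|}

/-- The `C²` norm of a function on the Euclidean ball of radius `r`. -/
def C2norm (u : (Fin 2 → ℝ) → ℝ) (r : ℝ) : ℝ :=
  sSup {a | ∃ z ∈ eball r, a = |u z| + ‖fderiv ℝ u z‖ + ‖fderiv ℝ (fderiv ℝ u) z‖}

end AdSPaper

namespace AdSPaper

/-! ### Algebra of the form of signature `(2,2)` -/

lemma qform_comm (a b : Fin 4 → ℝ) : qform a b = qform b a := by
  unfold qform; ring

@[simp] lemma qform_add_left (a b c : Fin 4 → ℝ) : qform (a + b) c = qform a c + qform b c := by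
  simp only [qform, Pi.add_apply]; ring

@[simp] lemma qform_add_right (a b c : Fin 4 → ℝ) : qform a (b + c) = qform a b + qform a c := by
  simp only [qform, Pi.add_apply]; ring

@[simp] lemma qform_sub_left (a b c : Fin 4 → ℝ) : qform (a - b) c = qform a c - qform b c := by
  simp only [qform, Pi.sub_apply]; ring

@[simp] lemma qform_sub_right (a b c : Fin 4 → ℝ) : qform a (b - c) = qform a b - qform a c := by
  simp only [qform, Pi.sub_apply]; ring

@[simp] lemma qform_smul_left (r : ℝ) (a c : Fin 4 → ℝ) : qform (r • a) c = r * qform a c := by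
  simp only [qform, Pi.smul_apply, smul_eq_mul]; ring

@[simp] lemma qform_smul_right (r : ℝ) (a c : Fin 4 → ℝ) : qform a (r • c) = r * qform a c := by
  simp only [qform, Pi.smul_apply, smul_eq_mul]; ring

@[simp] lemma qform_neg_left (a c : Fin 4 → ℝ) : qform (-a) c = -qform a c := by
  simp only [qform, Pi.neg_apply]; ring

@[simp] lemma qform_neg_right (a c : Fin 4 → ℝ) : qform a (-c) = -qform a c := by
  simp only [qform, Pi.neg_apply]; ring

@[simp] lemma qform_zero_left (c : Fin 4 → ℝ) : qform 0 c = 0 := by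
  simp [qform]

@[simp] lemma qform_zero_right (c : Fin 4 → ℝ) : qform c 0 = 0 := by
  simp [qform]

lemma continuous_qform {α : Type*} [TopologicalSpace α] {f g : α → Fin 4 → ℝ}
    (hf : Continuous f) (hg : Continuous g) : Continuous fun a => qform (f a) (g a) := by
  unfold qform
  fun_prop

lemma contDiff_qform {E : Type*} [NormedAddCommGroup E] [NormedSpace ℝ E] {n : WithTop ℕ∞}
    {f g : E → Fin 4 → ℝ} (hf : ContDiff ℝ n f) (hg : ContDiff ℝ n g) :
    ContDiff ℝ n fun a => qform (f a) (g a) := by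
  unfold qform
  have hf' := contDiff_pi.1 hf
  have hg' := contDiff_pi.1 hg
  exact ((((hf' 0).mul (hg' 0)).add ((hf' 1).mul (hg' 1))).sub ((hf' 2).mul (hg' 2))).sub
    ((hf' 3).mul (hg' 3))

lemma hasDerivAt_qform {f g : ℝ → Fin 4 → ℝ} {f' g' : Fin 4 → ℝ} {t : ℝ}
    (hf : HasDerivAt f f' t) (hg : HasDerivAt g g' t) :
    HasDerivAt (fun t => qform (f t) (g t)) (qform f' (g t) + qform (f t) g') t := by
  have hf' := hasDerivAt_pi.1 hf
  have hg' := hasDerivAt_pi.1 hg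
  have := ((((hf' 0).mul (hg' 0)).add ((hf' 1).mul (hg' 1))).sub ((hf' 2).mul (hg' 2))).sub
    ((hf' 3).mul (hg' 3))
  refine this.congr_deriv ?_
  unfold qform; ring

/-- A vector orthogonal to four vectors with Gram matrix `diag(1,1,-1,-1)` vanishes. -/
lemma eq_zero_of_frame_orth {a b c d r : Fin 4 → ℝ}
    (haa : qform a a = 1) (hbb : qform b b = 1) (hcc : qform c c = -1) (hdd : qform d d = -1)
    (hab : qform a b = 0) (hac : qform a c = 0) (had : qform a d = 0) (hbc : qform b c = 0)
    (hbd : qform b d = 0) (hcd : qform c d = 0)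
    (ha : qform a r = 0) (hb : qform b r = 0) (hc : qform c r = 0) (hd : qform d r = 0) :
    r = 0 := by
  let J : Fin 4 → ℝ := ![1, 1, -1, -1]
  let F : Fin 4 → (Fin 4 → ℝ) := ![a, b, c, d]
  let A : Matrix (Fin 4) (Fin 4) ℝ := Matrix.of fun i k => F i k * J k
  let A' : Matrix (Fin 4) (Fin 4) ℝ := Matrix.of fun k j => F j k * J j
  have hq : ∀ i j, (A * A') i j = qform (F i) (F j) * J j := by
    intro i j
    simp only [A, A', Matrix.mul_apply, Fin.sum_univ_four, Matrix.of_apply, qform]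
    simp [J]; ring
  have h1 : A * A' = 1 := by
    ext i j
    rw [hq]
    have hba := hab; have hca := hac; have hda := had; have hcb := hbc
    have hdb := hbd; have hdc := hcd
    rw [qform_comm] at hba hca hda hcb hdb hdc
    fin_cases i <;> fin_cases j <;> simp [F, J, *]
  have h2 : A' * A = 1 := mul_eq_one_comm.1 h1
  have hAr : A.mulVec r = 0 := by
    ext i
    have : A.mulVec r i = qform (F i) r := by
      simp only [A, Matrix.mulVec, dotProduct, Fin.sum_univ_four, Matrix.of_apply, qform]
      simp [J]; ring
    rw [this]
    fin_cases i <;> simp [F, ha, hb, hc, hd]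
  calc r = (A' * A).mulVec r := by rw [h2, Matrix.one_mulVec]
    _ = 0 := by rw [← Matrix.mulVec_mulVec, hAr, Matrix.mulVec_zero]

/-- Orthonormal frames of `ℝ^{2,2}` of the type used for surfaces. -/
structure Frame (a b c d : Fin 4 → ℝ) : Prop where
  aa : qform a a = 1
  bb : qform b b = 1
  cc : qform c c = -1
  dd : qform d d = -1
  ab : qform a b = 0
  ac : qform a c = 0
  ad : qform a d = 0
  bc : qform b c = 0
  bd : qform b d = 0
  cd : qform c d = 0

namespace Frame
variable {a b c d : Fin 4 → ℝ}

lemma ba (H : Frame a b c d) : qform b a = 0 := by rw [qform_comm]; exact H.ab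
lemma ca (H : Frame a b c d) : qform c a = 0 := by rw [qform_comm]; exact H.ac
lemma da (H : Frame a b c d) : qform d a = 0 := by rw [qform_comm]; exact H.ad
lemma cb (H : Frame a b c d) : qform c b = 0 := by rw [qform_comm]; exact H.bc
lemma db (H : Frame a b c d) : qform d b = 0 := by rw [qform_comm]; exact H.bd
lemma dc (H : Frame a b c d) : qform d c = 0 := by rw [qform_comm]; exact H.cd

lemma expand (H : Frame a b c d) (p : Fin 4 → ℝ) :
    p = qform a p • a + qform b p • b - qform c p • c - qform d p • d := by
  rw [← sub_eq_zero]
  apply eq_zero_of_frame_orth H.aa H.bb H.cc H.dd H.ab H.ac H.ad H.bc H.bd H.cd <;>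
  simp [H.aa, H.bb, H.cc, H.dd, H.ab, H.ac, H.ad, H.bc, H.bd, H.cd, H.ba, H.ca, H.da, H.cb,
    H.db, H.dc]

lemma ext (H : Frame a b c d) {p r : Fin 4 → ℝ} (h1 : qform a p = qform a r) (h2 : qform b p = qform b r)
    (h3 : qform c p = qform c r) (h4 : qform d p = qform d r) : p = r := by
  rw [H.expand p, H.expand r, h1, h2, h3, h4]

lemma inner (H : Frame a b c d) (p r : Fin 4 → ℝ) : qform p r = qform a p * qform a r + qform b p * qform b r
    - qform c p * qform c r - qform d p * qform d r := by
  conv_lhs => rw [H.expand p]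
  simp

end Frame

/-! ### Maximal surfaces without a choice of time orientation -/

/-- A maximal spacelike immersed injective disc, with one of its two unit normal fields. -/
structure MaxSurf where
  x : (Fin 2 → ℝ) → (Fin 4 → ℝ)
  n : (Fin 2 → ℝ) → (Fin 4 → ℝ)
  B : (Fin 2 → ℝ) → ((Fin 2 → ℝ) →ₗ[ℝ] (Fin 2 → ℝ))
  smooth_x : ContDiff ℝ (⊤ : ℕ∞) x
  smooth_n : ContDiff ℝ (⊤ : ℕ∞) n
  inj : Function.Injective x
  quad : ∀ y, qform (x y) (x y) = -1
  spacelike : ∀ y v, v ≠ 0 → 0 < qform (fderiv ℝ x y v) (fderiv ℝ x y v)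
  unit : ∀ y, qform (n y) (n y) = -1
  orth_base : ∀ y, qform (n y) (x y) = 0
  orth : ∀ y v, qform (n y) (fderiv ℝ x y v) = 0
  shape_spec : ∀ y v, fderiv ℝ n y v = fderiv ℝ x y (B y v)
  trace_zero : ∀ y, LinearMap.trace ℝ (Fin 2 → ℝ) (B y) = 0

lemma hasDerivAt_line {E : Type*} [NormedAddCommGroup E] [NormedSpace ℝ E]
    {f : (Fin 2 → ℝ) → E} (hf : ContDiff ℝ (⊤ : ℕ∞) f) (s u : Fin 2 → ℝ) (t : ℝ) :
    HasDerivAt (fun t : ℝ => f (s + t • u)) (fderiv ℝ f (s + t • u) u) t := by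
  have h1 : HasFDerivAt f (fderiv ℝ f (s + t • u)) (s + t • u) :=
    (hf.differentiable (by simp)).differentiableAt.hasFDerivAt
  have h2 : HasDerivAt (fun t : ℝ => s + t • u) u t := by
    simpa using ((hasDerivAt_id t).smul_const u).const_add s
  exact h1.comp_hasDerivAt t h2

lemma trace_det2 (B : (Fin 2 → ℝ) →ₗ[ℝ] (Fin 2 → ℝ)) (v w : Fin 2 → ℝ) :
    det2 (B v) w + det2 v (B w) = LinearMap.trace ℝ _ B * det2 v w := by
  have hB : ∀ v, B v = v 0 • B (Pi.single 0 1) + v 1 • B (Pi.single 1 1) := by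
    intro v
    rw [← map_smul, ← map_smul, ← map_add]
    congr 1
    ext i; fin_cases i <;> simp
  rw [LinearMap.trace_eq_matrix_trace ℝ (Pi.basisFun ℝ (Fin 2)), Matrix.trace, hB v, hB w]
  simp [det2]
  ring

lemma det_det2 (B : (Fin 2 → ℝ) →ₗ[ℝ] (Fin 2 → ℝ)) (v w : Fin 2 → ℝ) :
    det2 (B v) (B w) = LinearMap.det B * det2 v w := by
  have hB : ∀ v, B v = v 0 • B (Pi.single 0 1) + v 1 • B (Pi.single 1 1) := by
    intro v
    rw [← map_smul, ← map_smul, ← map_add]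
    congr 1
    ext i; fin_cases i <;> simp
  rw [← LinearMap.det_toMatrix (Pi.basisFun ℝ (Fin 2)), Matrix.det_fin_two, hB v, hB w]
  simp [det2]
  ring

/-- Cauchy–Binet for the pull-back of `qform` to the plane. -/
lemma qform_cauchy_binet (T : (Fin 2 → ℝ) →L[ℝ] (Fin 4 → ℝ)) (a b c d : Fin 2 → ℝ) :
    qform (T a) (T c) * qform (T b) (T d) - qform (T a) (T d) * qform (T b) (T c) =
      det2 a b * det2 c d *
        (qform (T (Pi.single 0 1)) (T (Pi.single 0 1)) *
            qform (T (Pi.single 1 1)) (T (Pi.single 1 1)) -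
          qform (T (Pi.single 0 1)) (T (Pi.single 1 1)) ^ 2) := by
  have hT : ∀ v : Fin 2 → ℝ, T v = v 0 • T (Pi.single 0 1) + v 1 • T (Pi.single 1 1) := by
    intro v
    rw [← map_smul, ← map_smul, ← map_add]
    congr 1
    ext i; fin_cases i <;> simp
  rw [hT a, hT b, hT c, hT d]
  simp only [qform_add_left, qform_add_right, qform_smul_left, qform_smul_right, det2]
  rw [qform_comm (T (Pi.single 1 1)) (T (Pi.single 0 1))]
  ring

namespace MaxSurf
variable (S : MaxSurf)

/-- The same surface with the opposite unit normal. -/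
def flip : MaxSurf where
  x := S.x
  n := fun y => -S.n y
  B := fun y => -S.B y
  smooth_x := S.smooth_x
  smooth_n := S.smooth_n.neg
  inj := S.inj
  quad := S.quad
  spacelike := S.spacelike
  unit := fun y => by simp [S.unit y]
  orth_base := fun y => by simp [S.orth_base y]
  orth := fun y v => by simp [S.orth y v]
  shape_spec := fun y v => by
    have : fderiv ℝ (fun y => -S.n y) y = -fderiv ℝ S.n y := fderiv_neg
    rw [this]; simp [S.shape_spec y v]
  trace_zero := fun y => by simp [S.trace_zero y]

/-- The differential of the immersion. -/
abbrev dx (s : Fin 2 → ℝ) : (Fin 2 → ℝ) →L[ℝ] (Fin 4 → ℝ) := fderiv ℝ S.x s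

/-- The differential of the Gauss map. -/
abbrev dn (s : Fin 2 → ℝ) : (Fin 2 → ℝ) →L[ℝ] (Fin 4 → ℝ) := fderiv ℝ S.n s

/-- The square of the principal curvature. -/
def ell (s : Fin 2 → ℝ) : ℝ := -LinearMap.det (S.B s)

lemma ell_flip (s : Fin 2 → ℝ) : S.flip.ell s = S.ell s := by
  have h : S.flip.B s = (-1 : ℝ) • S.B s := by
    ext v i; simp [flip]
  simp [ell, h, LinearMap.det_smul]

lemma x_dx (s u : Fin 2 → ℝ) : qform (S.x s) (S.dx s u) = 0 := by
  have h := hasDerivAt_line S.smooth_x s u 0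
  have h2 := hasDerivAt_qform h h
  simp only [S.quad] at h2
  have := h2.unique (hasDerivAt_const (0 : ℝ) (-1 : ℝ))
  simp only [zero_smul, add_zero] at this
  rw [qform_comm (fderiv ℝ S.x s u)] at this
  linarith

lemma x_n (s : Fin 2 → ℝ) : qform (S.x s) (S.n s) = 0 := by
  rw [qform_comm]; exact S.orth_base s

lemma x_dn (s u : Fin 2 → ℝ) : qform (S.x s) (S.dn s u) = 0 := by
  rw [dn, S.shape_spec]; exact S.x_dx _ _

lemma n_dn (s u : Fin 2 → ℝ) : qform (S.n s) (S.dn s u) = 0 := by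
  rw [dn, S.shape_spec]; exact S.orth _ _

/-- The second fundamental form is minus the normal part of the second derivative. -/
lemma dn_dx_eq (s u w : Fin 2 → ℝ) :
    qform (S.dn s u) (S.dx s w) = -qform (S.n s) (fderiv ℝ (fderiv ℝ S.x) s u w) := by
  have h1 := hasDerivAt_line S.smooth_n s u 0
  have h2 := hasDerivAt_line (S.smooth_x.fderiv_right (m := (⊤ : ℕ∞)) (by simp)) s u 0
  have h3 := h2.clm_apply (hasDerivAt_const (0 : ℝ) w)
  have h4 := hasDerivAt_qform h1 h3
  simp only [S.orth] at h4
  have := h4.unique (hasDerivAt_const (0 : ℝ) (0 : ℝ))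
  simp at this
  linarith

lemma dn_dx_symm (s u w : Fin 2 → ℝ) :
    qform (S.dn s u) (S.dx s w) = qform (S.dn s w) (S.dx s u) := by
  rw [dn_dx_eq, dn_dx_eq]
  have : IsSymmSndFDerivAt ℝ S.x s :=
    (S.smooth_x.contDiffAt).isSymmSndFDerivAt (by simp; norm_cast)
  rw [this.eq u w]

lemma gram_pos (s : Fin 2 → ℝ) : 0 <
    qform (S.dx s (Pi.single 0 1)) (S.dx s (Pi.single 0 1)) *
            qform (S.dx s (Pi.single 1 1)) (S.dx s (Pi.single 1 1)) -
          qform (S.dx s (Pi.single 0 1)) (S.dx s (Pi.single 1 1)) ^ 2 := by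
  set e : Fin 2 → ℝ := Pi.single 0 1
  set f : Fin 2 → ℝ := Pi.single 1 1
  have he : e ≠ 0 := by
    intro h; have := congrFun h 0; simp [e] at this
  have h1 := S.spacelike s e he
  have hw : qform (S.dx s e) (S.dx s e) • f - qform (S.dx s e) (S.dx s f) • e ≠ 0 := by
    intro h; have := congrFun h 1; simp [e, f] at this; exact h1.ne' this
  have h2 := S.spacelike s _ hw
  simp only [map_sub, map_smul, qform_sub_left, qform_sub_right, qform_smul_left,
    qform_smul_right] at h2
  rw [qform_comm (fderiv ℝ S.x s f) (fderiv ℝ S.x s e)] at h2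
  refine pos_of_mul_pos_right (a := qform (S.dx s e) (S.dx s e)) ?_ h1.le
  dsimp only [dx]
  linarith

/-- Vanishing of the trace of the shape operator in an arbitrary basis. -/
lemma trace_identity (s u w : Fin 2 → ℝ) :
    qform (S.dx s w) (S.dx s w) * qform (S.dn s u) (S.dx s u)
      - 2 * qform (S.dx s u) (S.dx s w) * qform (S.dn s u) (S.dx s w)
      + qform (S.dx s u) (S.dx s u) * qform (S.dn s w) (S.dx s w) = 0 := by
  have h1 := qform_cauchy_binet (S.dx s) (S.B s u) w u w
  have h2 := qform_cauchy_binet (S.dx s) u (S.B s w) u w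
  have h3 := trace_det2 (S.B s) u w
  rw [S.trace_zero s, zero_mul] at h3
  have h4 := S.dn_dx_symm s u w
  simp only [dx, dn, S.shape_spec] at *
  rw [qform_comm (fderiv ℝ S.x s w) (fderiv ℝ S.x s u)] at h1
  set G := qform (fderiv ℝ S.x s (Pi.single 0 1)) (fderiv ℝ S.x s (Pi.single 0 1)) *
            qform (fderiv ℝ S.x s (Pi.single 1 1)) (fderiv ℝ S.x s (Pi.single 1 1)) -
          qform (fderiv ℝ S.x s (Pi.single 0 1)) (fderiv ℝ S.x s (Pi.single 1 1)) ^ 2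
  linear_combination h1 + h2 + det2 u w * G * h3 - qform (fderiv ℝ S.x s u) (fderiv ℝ S.x s w) * h4

/-- The square of the principal curvature in an arbitrary basis. -/
lemma ell_identity (s u w : Fin 2 → ℝ) :
    S.ell s * (qform (S.dx s u) (S.dx s u) * qform (S.dx s w) (S.dx s w) -
        qform (S.dx s u) (S.dx s w) ^ 2) =
      qform (S.dn s u) (S.dx s w) ^ 2 -
        qform (S.dn s u) (S.dx s u) * qform (S.dn s w) (S.dx s w) := by
  have h1 := qform_cauchy_binet (S.dx s) (S.B s u) (S.B s w) u w
  have h2 := qform_cauchy_binet (S.dx s) u w u w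
  have h3 := det_det2 (S.B s) u w
  have h4 := S.dn_dx_symm s u w
  simp only [dx, dn, S.shape_spec] at *
  rw [qform_comm (fderiv ℝ S.x s w) (fderiv ℝ S.x s u)] at h2
  rw [h3] at h1
  unfold ell
  linear_combination h1 - LinearMap.det (S.B s) * h2 -
    qform (fderiv ℝ S.x s (S.B s u)) (fderiv ℝ S.x s w) * h4

lemma continuous_ell : Continuous S.ell := by
  have h := fun s => S.ell_identity s (Pi.single 0 1) (Pi.single 1 1)
  have h' : S.ell = fun s => (qform (S.dn s (Pi.single 0 1)) (S.dx s (Pi.single 1 1)) ^ 2 -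
        qform (S.dn s (Pi.single 0 1)) (S.dx s (Pi.single 0 1)) *
        qform (S.dn s (Pi.single 1 1)) (S.dx s (Pi.single 1 1))) /
        (qform (S.dx s (Pi.single 0 1)) (S.dx s (Pi.single 0 1)) *
            qform (S.dx s (Pi.single 1 1)) (S.dx s (Pi.single 1 1)) -
          qform (S.dx s (Pi.single 0 1)) (S.dx s (Pi.single 1 1)) ^ 2) := by
    ext s
    rw [eq_div_iff (S.gram_pos s).ne', h]
  rw [h']
  have c1 : ∀ v, Continuous fun s => S.dx s v := fun v =>
    (S.smooth_x.continuous_fderiv (by simp)).clm_apply continuous_const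
  have c2 : ∀ v, Continuous fun s => S.dn s v := fun v =>
    (S.smooth_n.continuous_fderiv (by simp)).clm_apply continuous_const
  refine Continuous.div ?_ ?_ fun s => (S.gram_pos s).ne'
  · exact ((continuous_qform (c2 _) (c1 _)).pow 2).sub
      ((continuous_qform (c2 _) (c1 _)).mul (continuous_qform (c2 _) (c1 _)))
  · exact ((continuous_qform (c1 _) (c1 _)).mul (continuous_qform (c1 _) (c1 _))).sub
      ((continuous_qform (c1 _) (c1 _)).pow 2)

/-- Every unit tangent vector is part of an adapted frame. -/
lemma exists_frame_of_unit (s u : Fin 2 → ℝ) (hu : qform (S.dx s u) (S.dx s u) = 1) :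
    ∃ w, Frame (S.dx s u) (S.dx s w) (S.x s) (S.n s) := by
  have hu0 : u ≠ 0 := by rintro rfl; simp at hu
  let w : Fin 2 → ℝ := ![-u 1, u 0]
  let w' := w - qform (S.dx s u) (S.dx s w) • u
  have hw' : w' ≠ 0 := by
    intro h
    have h0 := congrFun h 0
    have h1 := congrFun h 1
    simp only [w', w, Pi.sub_apply, Pi.smul_apply, smul_eq_mul, Pi.zero_apply,
      Matrix.cons_val_zero, Matrix.cons_val_one] at h0 h1
    apply hu0
    have : u 0 ^ 2 + u 1 ^ 2 = 0 := by
      linear_combination u 0 * h1 - u 1 * h0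
    have a0 : u 0 = 0 := by nlinarith [sq_nonneg (u 0), sq_nonneg (u 1)]
    have a1 : u 1 = 0 := by nlinarith [sq_nonneg (u 0), sq_nonneg (u 1)]
    ext i; fin_cases i <;> simp [a0, a1]
  have hp := S.spacelike s w' hw'
  have ho : qform (S.dx s u) (S.dx s w') = 0 := by
    simp only [w', map_sub, map_smul, qform_sub_right, qform_smul_right, hu]; ring
  refine ⟨(√(qform (S.dx s w') (S.dx s w')))⁻¹ • w', ?_⟩
  have hs := Real.mul_self_sqrt hp.le
  have hs0 := Real.sqrt_pos.2 hp
  constructor <;> try simp only [map_smul, qform_smul_right, qform_smul_left]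
  · exact hu
  · rw [← mul_assoc, ← hs]; field_simp; rw [Real.sqrt_sq hs0.le]
  · exact S.quad s
  · exact S.unit s
  · rw [ho, mul_zero]
  · rw [qform_comm]; exact S.x_dx _ _
  · rw [qform_comm]; exact S.orth _ _
  · rw [qform_comm (S.dx s w') (S.x s), S.x_dx, mul_zero]
  · rw [qform_comm (S.dx s w') (S.n s), S.orth, mul_zero]
  · exact S.x_n s

lemma exists_frame (s : Fin 2 → ℝ) :
    ∃ u w, Frame (S.dx s u) (S.dx s w) (S.x s) (S.n s) := by
  have he : (Pi.single 0 1 : Fin 2 → ℝ) ≠ 0 := by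
    intro h; have := congrFun h 0; simp at this
  have hp := S.spacelike s _ he
  have hs := Real.mul_self_sqrt hp.le
  have hs0 := Real.sqrt_pos.2 hp
  refine ⟨_, S.exists_frame_of_unit s
    ((√(qform (S.dx s (Pi.single 0 1)) (S.dx s (Pi.single 0 1))))⁻¹ • Pi.single 0 1) ?_⟩
  simp only [map_smul, qform_smul_right, qform_smul_left]
  rw [← mul_assoc, ← hs]; field_simp; rw [Real.sqrt_sq hs0.le]

lemma dn_expand {s u w : Fin 2 → ℝ} (H : Frame (S.dx s u) (S.dx s w) (S.x s) (S.n s))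
    (v : Fin 2 → ℝ) : S.dn s v = qform (S.dn s v) (S.dx s u) • S.dx s u
      + qform (S.dn s v) (S.dx s w) • S.dx s w := by
  conv_lhs => rw [H.expand (S.dn s v)]
  rw [S.x_dn, S.n_dn, qform_comm (S.dx s u), qform_comm (S.dx s w)]
  simp

lemma dx_expand {s u w : Fin 2 → ℝ} (H : Frame (S.dx s u) (S.dx s w) (S.x s) (S.n s))
    (v : Fin 2 → ℝ) : S.dx s v = qform (S.dx s u) (S.dx s v) • S.dx s u
      + qform (S.dx s w) (S.dx s v) • S.dx s w := by
  conv_lhs => rw [H.expand (S.dx s v)]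
  rw [S.x_dx, S.orth]
  simp

/-- Principal frames. -/
structure Principal (s u w : Fin 2 → ℝ) (μ : ℝ) : Prop where
  frame : Frame (S.dx s u) (S.dx s w) (S.x s) (S.n s)
  dn_u : S.dn s u = μ • S.dx s u
  dn_w : S.dn s w = -(μ • S.dx s w)
  nonneg : 0 ≤ μ
  sq : μ ^ 2 = S.ell s

lemma exists_principal (s : Fin 2 → ℝ) : ∃ u w μ, S.Principal s u w μ := by
  obtain ⟨u, w, H⟩ := S.exists_frame s
  have h1 := S.trace_identity s u w
  have h2 := S.ell_identity s u w
  have h3 := S.dn_dx_symm s u w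
  have hu := S.dn_expand H u
  have hw := S.dn_expand H w
  rw [H.aa, H.bb, H.ab] at h1 h2
  rw [← h3] at hw
  set a := qform (S.dn s u) (S.dx s u)
  set b := qform (S.dn s u) (S.dx s w)
  have hd : qform (S.dn s w) (S.dx s w) = -a := by linarith
  rw [hd] at h1 h2 hw
  let z : ℂ := ⟨a, b⟩
  set μ := ‖z‖
  set θ := Complex.arg z / 2
  have ha : a = μ * (cos θ ^ 2 - sin θ ^ 2) := by
    rw [← Real.cos_two_mul', show 2 * θ = Complex.arg z by simp [θ]; ring]
    exact (Complex.norm_mul_cos_arg z).symm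
  have hb : b = μ * (2 * sin θ * cos θ) := by
    rw [← Real.sin_two_mul, show 2 * θ = Complex.arg z by simp [θ]; ring]
    exact (Complex.norm_mul_sin_arg z).symm
  have hcs := Real.sin_sq_add_cos_sq θ
  have hl : μ ^ 2 = S.ell s := by
    have : μ ^ 2 = a * a + b * b := by
      rw [← Complex.normSq_eq_norm_sq, Complex.normSq_apply]
    rw [this]; linarith
  set c := cos θ
  set d := sin θ
  refine ⟨c • u + d • w, c • w - d • u, μ, ?_, ?_, ?_, norm_nonneg _, hl⟩
  · constructor <;> simp only [map_add, map_sub, map_smul, qform_add_left, qform_add_right,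
      qform_smul_left, qform_smul_right, qform_sub_left, qform_sub_right, H.aa, H.bb, H.cc, H.dd,
      H.ab, H.ba, H.ac, H.bc, H.ad, H.bd, H.cd] <;> linarith
  · simp only [map_add, map_smul, hu, hw]
    rw [ha, hb]
    ext i
    simp only [Pi.add_apply, Pi.smul_apply, smul_eq_mul]
    linear_combination (μ * c * (S.dx s u i) + μ * d * S.dx s w i) * hcs
  · simp only [map_sub, map_smul, hu, hw]
    rw [ha, hb]
    ext i
    simp only [Pi.add_apply, Pi.smul_apply, Pi.sub_apply, Pi.neg_apply, smul_eq_mul]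
    linear_combination (μ * d * (S.dx s u i) - μ * c * S.dx s w i) * hcs

end MaxSurf

/-! ### Local inverses -/

/-- A smooth map of the plane with injective differential at `s` has a globally defined smooth
local inverse near `Y s`. -/
lemma exists_smooth_local_inverse {Y : (Fin 2 → ℝ) → (Fin 2 → ℝ)}
    (hY : ContDiff ℝ (⊤ : ℕ∞) Y) {s : Fin 2 → ℝ}
    (hs : Function.Injective (fderiv ℝ Y s)) :
    ∃ σ : (Fin 2 → ℝ) → (Fin 2 → ℝ), ContDiff ℝ (⊤ : ℕ∞) σ ∧ σ (Y s) = s ∧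
      (∀ᶠ y in 𝓝 (Y s), Y (σ y) = y) ∧ ∀ᶠ s' in 𝓝 s, σ (Y s') = s' := by
  have hd : ∀ z, HasFDerivAt Y (fderiv ℝ Y z) z := fun z =>
    (hY.differentiable (by simp)).differentiableAt.hasFDerivAt
  let e : (Fin 2 → ℝ) ≃L[ℝ] (Fin 2 → ℝ) :=
    (LinearEquiv.ofInjectiveEndo (fderiv ℝ Y s).toLinearMap hs).toContinuousLinearEquiv
  have he : (e : (Fin 2 → ℝ) →L[ℝ] (Fin 2 → ℝ)) = fderiv ℝ Y s := by
    ext v : 1; rfl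
  have hd' : HasFDerivAt Y (e : (Fin 2 → ℝ) →L[ℝ] (Fin 2 → ℝ)) s := by rw [he]; exact hd s
  have hn : ((⊤ : ℕ∞) : WithTop ℕ∞) ≠ 0 := by simp
  let P := hY.contDiffAt.toOpenPartialHomeomorph Y hd' hn
  have hPs : s ∈ P.source := hY.contDiffAt.mem_toOpenPartialHomeomorph_source hd' hn
  have hPt : Y s ∈ P.target := hY.contDiffAt.image_mem_toOpenPartialHomeomorph_target hd' hn
  have hPY : ∀ z, P z = Y z := fun z => rfl
  have hPsymm : P.symm (Y s) = s := P.left_inv hPs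
  have hinv : ∀ᶠ z in 𝓝 s, fderiv ℝ Y z ∈
      range ((↑) : ((Fin 2 → ℝ) ≃L[ℝ] (Fin 2 → ℝ)) → (Fin 2 → ℝ) →L[ℝ] (Fin 2 → ℝ)) := by
    have hc : ContinuousAt (fderiv ℝ Y) s := (hY.continuous_fderiv (by simp)).continuousAt
    apply hc
    rw [← he]
    exact e.nhds
  have hcd : ∀ᶠ y in 𝓝 (Y s), ContDiffAt ℝ (⊤ : ℕ∞) P.symm y := by
    have h1 : Tendsto P.symm (𝓝 (Y s)) (𝓝 s) := by
      have := P.continuousAt_symm hPt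
      rwa [ContinuousAt, hPsymm] at this
    filter_upwards [h1 hinv, P.open_target.mem_nhds hPt] with y hy hyt
    obtain ⟨e', he'⟩ := hy
    refine P.contDiffAt_symm hyt (f₀' := e') ?_ hY.contDiffAt
    rw [he']; exact hd _
  have hall := hcd.and (P.open_target.mem_nhds hPt)
  obtain ⟨r, hr, hball⟩ := Metric.eventually_nhds_iff_ball.1 hall
  let χ : ContDiffBump (Y s) := ⟨r / 4, r / 2, by positivity, by linarith⟩
  let σ : (Fin 2 → ℝ) → (Fin 2 → ℝ) := fun y => s + χ y • (P.symm y - s)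
  have hσ1 : ∀ᶠ y in 𝓝 (Y s), σ y = P.symm y := by
    filter_upwards [χ.eventuallyEq_one] with y hy
    simp [σ, hy]
  refine ⟨σ, ?_, ?_, ?_, ?_⟩
  · rw [contDiff_iff_contDiffAt]
    intro y
    by_cases hy : dist y (Y s) < r
    · exact contDiffAt_const.add (χ.contDiffAt.smul
        ((hball y hy).1.sub contDiffAt_const))
    · have : σ =ᶠ[𝓝 y] fun _ => s := by
        have hopen : IsOpen {z | r / 2 < dist z (Y s)} :=
          isOpen_lt continuous_const (continuous_id.dist continuous_const)
        filter_upwards [hopen.mem_nhds (show r / 2 < dist y (Y s) by push Not at hy; linarith)]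
          with z hz
        have : χ z = 0 := χ.zero_of_le_dist (le_of_lt hz)
        simp [σ, this]
      exact contDiffAt_const.congr_of_eventuallyEq this
  · rw [hσ1.self_of_nhds, hPsymm]
  · filter_upwards [hσ1, P.open_target.mem_nhds hPt] with y h1 h2
    rw [h1, ← hPY]; exact P.right_inv h2
  · have hc : Tendsto Y (𝓝 s) (𝓝 (Y s)) := hY.continuous.continuousAt
    filter_upwards [hc hσ1, P.open_source.mem_nhds hPs] with z h1 h2
    have h1' : σ (Y z) = P.symm (Y z) := h1
    rw [h1', ← hPY]; exact P.left_inv h2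

/-! ### Second order jets of curves -/

/-- `Jet f a b c` says that `f` is twice differentiable at `0` with value `a` and first and
second derivatives `b` and `c`. -/
def Jet {E : Type*} [NormedAddCommGroup E] [NormedSpace ℝ E] (f : ℝ → E) (a b c : E) : Prop :=
  ∃ f' : ℝ → E, (∀ᶠ t in 𝓝 0, HasDerivAt f (f' t) t) ∧ HasDerivAt f' c 0 ∧ f 0 = a ∧ f' 0 = b

namespace Jet
variable {E : Type*} [NormedAddCommGroup E] [NormedSpace ℝ E] {f g : ℝ → E} {a b c a' b' c' : E}

lemma value (h : Jet f a b c) : f 0 = a := by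
  obtain ⟨f', _, _, h, _⟩ := h; exact h

lemma hasDerivAt (h : Jet f a b c) : HasDerivAt f b 0 := by
  obtain ⟨f', h1, _, _, h⟩ := h
  rw [← h]; exact h1.self_of_nhds

lemma continuousAt (h : Jet f a b c) : ContinuousAt f 0 := h.hasDerivAt.continuousAt

lemma unique (h : Jet f a b c) (h' : Jet f a' b' c') : a = a' ∧ b = b' ∧ c = c' := by
  refine ⟨h.value.symm.trans h'.value, h.hasDerivAt.unique h'.hasDerivAt, ?_⟩
  obtain ⟨f', h1, h2, _, _⟩ := h
  obtain ⟨g', h1', h2', _, _⟩ := h'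
  have : f' =ᶠ[𝓝 0] g' := by
    filter_upwards [h1, h1'] with t ht ht'
    exact ht.unique ht'
  exact h2.unique (h2'.congr_of_eventuallyEq this)

lemma congr (h : Jet f a b c) (hfg : g =ᶠ[𝓝 0] f) : Jet g a b c := by
  obtain ⟨f', h1, h2, h3, h4⟩ := h
  refine ⟨f', ?_, h2, hfg.self_of_nhds.trans h3, h4⟩
  filter_upwards [h1, hfg.eventuallyEq_nhds] with t ht ht'
  exact ht.congr_of_eventuallyEq ht'

lemma congr_coeff (h : Jet f a b c) (h1 : a = a') (h2 : b = b') (h3 : c = c') :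
    Jet f a' b' c' := by
  subst h1 h2 h3; exact h

lemma const (a : E) : Jet (fun _ => a) a 0 0 :=
  ⟨fun _ => 0, Eventually.of_forall fun t => hasDerivAt_const t a, hasDerivAt_const _ _, rfl, rfl⟩

lemma add (h : Jet f a b c) (h' : Jet g a' b' c') :
    Jet (fun t => f t + g t) (a + a') (b + b') (c + c') := by
  obtain ⟨f', h1, h2, h3, h4⟩ := h
  obtain ⟨g', h1', h2', h3', h4'⟩ := h'
  refine ⟨fun t => f' t + g' t, ?_, h2.add h2', by simp only [h3, h3'], by simp only [h4, h4']⟩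
  filter_upwards [h1, h1'] with t ht ht'
  exact ht.add ht'

lemma sub (h : Jet f a b c) (h' : Jet g a' b' c') :
    Jet (fun t => f t - g t) (a - a') (b - b') (c - c') := by
  obtain ⟨f', h1, h2, h3, h4⟩ := h
  obtain ⟨g', h1', h2', h3', h4'⟩ := h'
  refine ⟨fun t => f' t - g' t, ?_, h2.sub h2', by simp only [h3, h3'], by simp only [h4, h4']⟩
  filter_upwards [h1, h1'] with t ht ht'
  exact ht.sub ht'

lemma mul {f g : ℝ → ℝ} {a b c a' b' c' : ℝ} (h : Jet f a b c) (h' : Jet g a' b' c') :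
    Jet (fun t => f t * g t) (a * a') (b * a' + a * b') (c * a' + 2 * b * b' + a * c') := by
  have e1 := h.hasDerivAt
  have e2 := h'.hasDerivAt
  obtain ⟨f', h1, h2, h3, h4⟩ := h
  obtain ⟨g', h1', h2', h3', h4'⟩ := h'
  refine ⟨fun t => f' t * g t + f t * g' t, ?_, ?_, by simp only [h3, h3'], by simp only [h3, h3', h4, h4']⟩
  · filter_upwards [h1, h1'] with t ht ht'
    exact ht.mul ht'
  · refine ((h2.mul e2).add (e1.mul h2')).congr_deriv ?_
    rw [h3, h3', h4, h4']; ring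

lemma const_mul {f : ℝ → ℝ} {a b c : ℝ} (r : ℝ) (h : Jet f a b c) :
    Jet (fun t => r * f t) (r * a) (r * b) (r * c) :=
  ((const r).mul h).congr_coeff rfl (by ring) (by ring)

lemma neg {f : ℝ → ℝ} {a b c : ℝ} (h : Jet f a b c) :
    Jet (fun t => -f t) (-a) (-b) (-c) :=
  ((const_mul (-1) h).congr (Eventually.of_forall fun t => by simp)).congr_coeff
    (by ring) (by ring) (by ring)

lemma qform {f g : ℝ → Fin 4 → ℝ} {a b c a' b' c' : Fin 4 → ℝ}
    (h : Jet f a b c) (h' : Jet g a' b' c') :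
    Jet (fun t => qform (f t) (g t)) (qform a a') (qform b a' + qform a b')
      (qform c a' + 2 * qform b b' + qform a c') := by
  have e1 := h.hasDerivAt
  have e2 := h'.hasDerivAt
  obtain ⟨f', h1, h2, h3, h4⟩ := h
  obtain ⟨g', h1', h2', h3', h4'⟩ := h'
  refine ⟨fun t => AdSPaper.qform (f' t) (g t) + AdSPaper.qform (f t) (g' t), ?_, ?_,
    by simp only [h3, h3'], by simp only [h3, h3', h4, h4']⟩
  · filter_upwards [h1, h1'] with t ht ht'
    exact hasDerivAt_qform ht ht'
  · refine ((hasDerivAt_qform h2 e2).add (hasDerivAt_qform e1 h2')).congr_deriv ?_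
    rw [h3, h3', h4, h4']; ring

/-- Composition with a twice differentiable function. -/
lemma comp {f : ℝ → ℝ} {a b c : ℝ} (h : Jet f a b c) {φ φ' : ℝ → ℝ} {φ'' : ℝ}
    (h1 : ∀ᶠ z in 𝓝 a, HasDerivAt φ (φ' z) z) (h2 : HasDerivAt φ' φ'' a) :
    Jet (fun t => φ (f t)) (φ a) (φ' a * b) (φ'' * b ^ 2 + φ' a * c) := by
  have e1 := h.hasDerivAt
  have hc : Tendsto f (𝓝 0) (𝓝 a) := by
    have := h.continuousAt; rwa [ContinuousAt, h.value] at this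
  obtain ⟨f', k1, k2, k3, k4⟩ := h
  refine ⟨fun t => φ' (f t) * f' t, ?_, ?_, by simp only [k3], by simp only [k3, k4]⟩
  · filter_upwards [k1, hc h1] with t ht ht'
    exact ht'.comp t ht
  · have h3 : HasDerivAt (fun t => φ' (f t)) (φ'' * b) 0 := by
      have h2' : HasDerivAt φ' φ'' (f 0) := by rw [k3]; exact h2
      exact h2'.comp (0 : ℝ) e1
    refine (h3.mul k2).congr_deriv ?_
    rw [k3, k4]; ring

lemma log {f : ℝ → ℝ} {a b c : ℝ} (h : Jet f a b c) (ha : 0 < a) :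
    Jet (fun t => Real.log (f t)) (Real.log a) (b / a) (c / a - (b / a) ^ 2) := by
  refine (h.comp (φ := Real.log) (φ' := fun z => z⁻¹) (φ'' := -(a ^ 2)⁻¹) ?_ ?_).congr_coeff
    rfl ?_ ?_
  · filter_upwards [lt_mem_nhds ha] with z hz
    exact Real.hasDerivAt_log hz.ne'
  · exact hasDerivAt_inv ha.ne'
  · field_simp
  · field_simp; ring

lemma exp {f : ℝ → ℝ} {a b c : ℝ} (h : Jet f a b c) :
    Jet (fun t => Real.exp (f t)) (Real.exp a) (Real.exp a * b) (Real.exp a * (b ^ 2 + c)) :=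
  (h.comp (φ := Real.exp) (φ' := Real.exp) (φ'' := Real.exp a)
    (Eventually.of_forall fun z => Real.hasDerivAt_exp z) (Real.hasDerivAt_exp a)).congr_coeff
    rfl rfl (by ring)

/-- First and second derivative tests at a local minimum. -/
lemma of_isLocalMin {f : ℝ → ℝ} {a b c : ℝ} (h : Jet f a b c) (hm : IsLocalMin f 0) :
    b = 0 ∧ 0 ≤ c := by
  have hb : b = 0 := hm.hasDerivAt_eq_zero h.hasDerivAt
  refine ⟨hb, ?_⟩
  by_contra hc
  push Not at hc
  have hcont := h.continuousAt
  obtain ⟨f', h1, h2, h3, h4⟩ := h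
  have hd : deriv f =ᶠ[𝓝 0] f' := by
    filter_upwards [h1] with t ht using ht.deriv
  have h2' : HasDerivAt (deriv f) c 0 := h2.congr_of_eventuallyEq hd
  have hmax : IsLocalMax f 0 :=
    isLocalMax_of_deriv_deriv_neg (by rw [h2'.deriv]; exact hc)
      (by rw [hd.self_of_nhds, h4, hb]) hcont
  have hconst : f =ᶠ[𝓝 0] fun _ => f 0 := by
    filter_upwards [hm, hmax] with t ht ht' using le_antisymm ht' ht
  have hz : deriv f =ᶠ[𝓝 0] fun _ => 0 := by
    filter_upwards [hconst.eventuallyEq_nhds] with t ht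
    rw [ht.deriv_eq]; simp
  have := h2'.unique ((hasDerivAt_const (0 : ℝ) (0 : ℝ)).congr_of_eventuallyEq hz)
  linarith

lemma of_isLocalMax {f : ℝ → ℝ} {a b c : ℝ} (h : Jet f a b c) (hm : IsLocalMax f 0) :
    b = 0 ∧ c ≤ 0 := by
  have := h.neg.of_isLocalMin hm.neg
  constructor <;> linarith [this.1, this.2]

end Jet

/-! ### Partial derivatives in the plane -/

/-- The `i`-th partial derivative of a function on the plane. -/
def pd {E : Type*} [NormedAddCommGroup E] [NormedSpace ℝ E] (i : Fin 2)
    (F : (Fin 2 → ℝ) → E) : (Fin 2 → ℝ) → E := fun y => fderiv ℝ F y (Pi.single i 1)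

section
variable {E : Type*} [NormedAddCommGroup E] [NormedSpace ℝ E] {F : (Fin 2 → ℝ) → E}

lemma contDiff_pd (hF : ContDiff ℝ (⊤ : ℕ∞) F) (i : Fin 2) : ContDiff ℝ (⊤ : ℕ∞) (pd i F) :=
  (hF.fderiv_right (m := (⊤ : ℕ∞)) (by simp)).clm_apply contDiff_const

lemma hasDerivAt_pd (hF : ContDiff ℝ (⊤ : ℕ∞) F) (i : Fin 2) (t : ℝ) :
    HasDerivAt (fun t : ℝ => F (t • Pi.single i 1)) (pd i F (t • Pi.single i 1)) t := by
  simpa [pd] using hasDerivAt_line hF 0 (Pi.single i 1) t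

lemma jet_pd (hF : ContDiff ℝ (⊤ : ℕ∞) F) (i : Fin 2) :
    Jet (fun t : ℝ => F (t • Pi.single i 1)) (F 0) (pd i F 0) (pd i (pd i F) 0) := by
  refine ⟨fun t => pd i F (t • Pi.single i 1), Eventually.of_forall fun t => hasDerivAt_pd hF i t,
    ?_, by simp, by simp⟩
  have := hasDerivAt_pd (contDiff_pd hF i) i 0
  simpa using this

lemma pd_comm (hF : ContDiff ℝ (⊤ : ℕ∞) F) (i j : Fin 2) : pd i (pd j F) = pd j (pd i F) := by
  ext y
  have hsymm : IsSymmSndFDerivAt ℝ F y :=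
    (hF.contDiffAt).isSymmSndFDerivAt (by simp; norm_cast)
  have key : ∀ i j, pd i (pd j F) y = fderiv ℝ (fderiv ℝ F) y (Pi.single i 1) (Pi.single j 1) := by
    intro i j
    have hd : DifferentiableAt ℝ (fderiv ℝ F) y :=
      ((hF.fderiv_right (m := (⊤ : ℕ∞)) (by simp)).differentiable (by simp)).differentiableAt
    have := hd.hasFDerivAt.clm_apply (hasFDerivAt_const (Pi.single j 1 : Fin 2 → ℝ) y)
    show fderiv ℝ (fun y => fderiv ℝ F y (Pi.single j 1)) y (Pi.single i 1) = _
    rw [this.fderiv]; simp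
  rw [key, key, hsymm.eq]

end

lemma Jet.inv {f : ℝ → ℝ} {a b c : ℝ} (h : Jet f a b c) (ha : a ≠ 0) :
    Jet (fun t => (f t)⁻¹) a⁻¹ (-b / a ^ 2) (2 * b ^ 2 / a ^ 3 - c / a ^ 2) := by
  refine (h.comp (φ := fun z => z⁻¹) (φ' := fun z => -(z ^ 2)⁻¹) (φ'' := 2 / a ^ 3)
    ?_ ?_).congr_coeff rfl ?_ ?_
  · filter_upwards [isOpen_ne.mem_nhds ha] with z hz
    exact hasDerivAt_inv hz
  · refine (((hasDerivAt_pow 2 a).inv (pow_ne_zero 2 ha)).neg).congr_deriv ?_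
    simp; field_simp
  · field_simp
  · field_simp; ring

lemma pd_qform_const {F : (Fin 2 → ℝ) → (Fin 4 → ℝ)} (hF : ContDiff ℝ (⊤ : ℕ∞) F)
    {p : Fin 4 → ℝ} {r : ℝ} {y₀ : Fin 2 → ℝ} (h : ∀ᶠ y in 𝓝 y₀, qform (F y) p = r) (i : Fin 2) :
    ∀ᶠ y in 𝓝 y₀, qform (pd i F y) p = 0 := by
  filter_upwards [eventually_eventually_nhds.2 h] with y hy
  have h1 := hasDerivAt_line hF y (Pi.single i 1) 0
  have h2 := hasDerivAt_qform h1 (hasDerivAt_const (0 : ℝ) p)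
  have hc : Tendsto (fun t : ℝ => y + t • (Pi.single i 1 : Fin 2 → ℝ)) (𝓝 0) (𝓝 y) := by
    have : Continuous fun t : ℝ => y + t • (Pi.single i 1 : Fin 2 → ℝ) := by fun_prop
    simpa using this.tendsto 0
  have h3 := (hasDerivAt_const (0 : ℝ) r).congr_of_eventuallyEq (hc hy)
  have := h2.unique h3
  simpa [pd] using this

lemma pd_comp {F : (Fin 2 → ℝ) → (Fin 4 → ℝ)} (hF : ContDiff ℝ (⊤ : ℕ∞) F)
    {σ : (Fin 2 → ℝ) → (Fin 2 → ℝ)} (hσ : ContDiff ℝ (⊤ : ℕ∞) σ) (y : Fin 2 → ℝ) (i : Fin 2) :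
    pd i (fun y => F (σ y)) y = fderiv ℝ F (σ y) (fderiv ℝ σ y (Pi.single i 1)) := by
  have h1 : HasFDerivAt σ (fderiv ℝ σ y) y :=
    (hσ.differentiable (by simp)).differentiableAt.hasFDerivAt
  have h2 : HasFDerivAt F (fderiv ℝ F (σ y)) (σ y) :=
    (hF.differentiable (by simp)).differentiableAt.hasFDerivAt
  have := (h2.comp y h1).fderiv
  simp only [Function.comp_def] at this
  rw [pd, this]; rfl

namespace MaxSurf
variable (S : MaxSurf)

/-- Coordinates on the surface given by orthogonal projection to a tangent plane. -/
lemma exists_chart {s u w : Fin 2 → ℝ} (H : Frame (S.dx s u) (S.dx s w) (S.x s) (S.n s)) :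
    ∃ σ : (Fin 2 → ℝ) → (Fin 2 → ℝ), ContDiff ℝ (⊤ : ℕ∞) σ ∧ σ 0 = s ∧
      fderiv ℝ σ 0 (Pi.single 0 1) = u ∧ fderiv ℝ σ 0 (Pi.single 1 1) = w ∧
      (∀ᶠ y in 𝓝 (0 : Fin 2 → ℝ), qform (S.x (σ y)) (S.dx s u) = y 0) ∧
      (∀ᶠ y in 𝓝 (0 : Fin 2 → ℝ), qform (S.x (σ y)) (S.dx s w) = y 1) := by
  let Y : (Fin 2 → ℝ) → (Fin 2 → ℝ) :=
    fun z => ![qform (S.x z) (S.dx s u), qform (S.x z) (S.dx s w)]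
  have hY : ContDiff ℝ (⊤ : ℕ∞) Y := by
    rw [contDiff_pi]
    intro i
    fin_cases i
    · exact contDiff_qform S.smooth_x contDiff_const
    · exact contDiff_qform S.smooth_x contDiff_const
  have hYd : ∀ v, fderiv ℝ Y s v =
      ![qform (S.dx s v) (S.dx s u), qform (S.dx s v) (S.dx s w)] := by
    intro v
    have h1 := hasDerivAt_line hY s v 0
    have h2 := hasDerivAt_line S.smooth_x s v 0
    simp only [zero_smul, add_zero] at h1 h2
    refine h1.unique ?_
    rw [hasDerivAt_pi]
    intro i
    fin_cases i
    · simpa [Y] using hasDerivAt_qform h2 (hasDerivAt_const (0 : ℝ) (S.dx s u))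
    · simpa [Y] using hasDerivAt_qform h2 (hasDerivAt_const (0 : ℝ) (S.dx s w))
  have hker : ∀ v, fderiv ℝ Y s v = 0 → v = 0 := by
    intro v hv
    rw [hYd] at hv
    have h0 := congrFun hv 0
    have h1 := congrFun hv 1
    simp at h0 h1
    by_contra hne
    have := S.spacelike s v hne
    have he := S.dx_expand H v
    rw [qform_comm, h0, qform_comm (S.dx s w), h1] at he
    simp only [dx] at he
    rw [he] at this
    simp at this
  have hinj : Function.Injective (fderiv ℝ Y s) := by
    intro a b hab
    have := hker (a - b) (by rw [map_sub, hab, sub_self])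
    exact sub_eq_zero.1 this
  obtain ⟨σ, hσ, hσ0, hσ1, -⟩ := exists_smooth_local_inverse hY hinj
  have hYs : Y s = 0 := by
    ext i; fin_cases i <;> simp [Y, S.x_dx]
  rw [hYs] at hσ0 hσ1
  have hder : ∀ v, fderiv ℝ Y s (fderiv ℝ σ 0 v) = v := by
    intro v
    have h1 : HasFDerivAt σ (fderiv ℝ σ 0) 0 :=
      (hσ.differentiable (by simp)).differentiableAt.hasFDerivAt
    have h2 : HasFDerivAt Y (fderiv ℝ Y s) (σ 0) := by
      rw [hσ0]; exact (hY.differentiable (by simp)).differentiableAt.hasFDerivAt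
    have h3 := h2.comp (0 : Fin 2 → ℝ) h1
    have h4 : HasFDerivAt (Y ∘ σ) (ContinuousLinearMap.id ℝ (Fin 2 → ℝ)) 0 :=
      (hasFDerivAt_id 0).congr_of_eventuallyEq hσ1
    have := h3.unique h4
    simpa using congrArg (fun T => T v) this
  refine ⟨σ, hσ, hσ0, ?_, ?_, ?_, ?_⟩
  · apply hinj; rw [hder, hYd]
    ext i; fin_cases i <;> simp [H.aa, H.ab]
  · apply hinj; rw [hder, hYd]
    ext i; fin_cases i <;> simp [H.bb, H.ba]
  · filter_upwards [hσ1] with y hy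
    simpa [Y] using congrFun hy 0
  · filter_upwards [hσ1] with y hy
    simpa [Y] using congrFun hy 1

/-- Through every point, in every unit direction, there is a curve with acceleration
normal to the surface. -/
lemma exists_curve {s u : Fin 2 → ℝ} (hu : qform (S.dx s u) (S.dx s u) = 1) :
    ∃ c : ℝ → (Fin 2 → ℝ), Continuous c ∧ c 0 = s ∧
      Jet (fun t => S.x (c t)) (S.x s) (S.dx s u)
        (S.x s + qform (S.dn s u) (S.dx s u) • S.n s) := by
  obtain ⟨w, H⟩ := S.exists_frame_of_unit s u hu
  obtain ⟨σ, hσ, hσ0, hu', hw', e0, e1⟩ := S.exists_chart H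
  have hX : ContDiff ℝ (⊤ : ℕ∞) fun y => S.x (σ y) := S.smooth_x.comp hσ
  have hpd : ∀ y i, pd i (fun y => S.x (σ y)) y = S.dx (σ y) (fderiv ℝ σ y (Pi.single i 1)) :=
    fun y i => pd_comp S.smooth_x hσ y i
  have hE : pd 0 (fun y => S.x (σ y)) 0 = S.dx s u := by rw [hpd, hσ0, hu']
  have J := jet_pd hX 0
  rw [hE] at J
  simp only [hσ0] at J
  refine ⟨fun t => σ (t • Pi.single 0 1), ?_, by simp [hσ0], J.congr_coeff rfl rfl ?_⟩
  · exact hσ.continuous.comp (by fun_prop)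
  have hcur : Tendsto (fun t : ℝ => t • (Pi.single 0 1 : Fin 2 → ℝ)) (𝓝 0) (𝓝 0) := by
    have : Continuous fun t : ℝ => t • (Pi.single 0 1 : Fin 2 → ℝ) := by fun_prop
    simpa using this.tendsto 0
  have Jt : Jet (fun t : ℝ => t) 0 1 0 :=
    ⟨fun _ => 1, Eventually.of_forall fun t => hasDerivAt_id t, hasDerivAt_const _ _, rfl, rfl⟩
  set A := pd 0 (pd 0 fun y => S.x (σ y)) 0
  have q0 := ((J.qform (Jet.const (S.dx s u))).congr (g := fun t : ℝ => t) (by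
    filter_upwards [hcur e0] with t ht
    have : AdSPaper.qform (S.x (σ (t • Pi.single 0 1))) (S.dx s u) = _ := ht
    simpa using this.symm)).unique Jt
  have q1 := ((J.qform (Jet.const (S.dx s w))).congr (g := fun _ : ℝ => (0 : ℝ)) (by
    filter_upwards [hcur e1] with t ht
    have : AdSPaper.qform (S.x (σ (t • Pi.single 0 1))) (S.dx s w) = _ := ht
    simpa using this.symm)).unique (Jet.const 0)
  have q2 := ((J.qform J).congr (g := fun _ : ℝ => (-1 : ℝ))
    (Eventually.of_forall fun t => (S.quad _).symm)).unique (Jet.const (-1))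
  have hn : ContDiff ℝ (⊤ : ℕ∞) fun y => S.n (σ y) := S.smooth_n.comp hσ
  have hpn : pd 0 (fun y => S.n (σ y)) 0 = S.dn s u := by
    rw [pd_comp S.smooth_n hσ, hu', hσ0]
  have q3 : qform (S.dn s u) (S.dx s u) + qform (S.n s) A = 0 := by
    have h1 := hasDerivAt_pd hn 0 0
    have h2 := hasDerivAt_pd (contDiff_pd hX 0) 0 0
    have h3 := hasDerivAt_qform h1 h2
    have h4 : (fun t : ℝ => qform (S.n (σ (t • Pi.single 0 1)))
        (pd 0 (fun y => S.x (σ y)) (t • Pi.single 0 1))) = fun _ => 0 := by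
      ext t; rw [hpd]; exact S.orth _ _
    rw [h4] at h3
    have := h3.unique (hasDerivAt_const _ _)
    simpa [hpn, hE, hσ0] using this
  apply H.ext
  · have := q0.2.2
    simp only [qform_zero_right] at this
    simp only [qform_add_right, qform_smul_right, H.ac, H.ad]
    rw [qform_comm]; linarith
  · have := q1.2.2
    simp only [qform_zero_right] at this
    simp only [qform_add_right, qform_smul_right, H.bc, H.bd]
    rw [qform_comm]; linarith
  · have := q2.2.2
    rw [hu, qform_comm A] at this
    simp only [qform_add_right, qform_smul_right, H.cc, H.cd]
    linarith
  · simp only [qform_add_right, qform_smul_right, H.dc, H.dd]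
    linarith

end MaxSurf

namespace MaxSurf
variable (S : MaxSurf)

/-- Second order expansion of position, normal and curvature along two curves in the principal
directions. -/
structure PrincipalJets (s : Fin 2 → ℝ) (e₁ e₂ : Fin 4 → ℝ) (μ : ℝ)
    (c₁ c₂ : ℝ → (Fin 2 → ℝ)) (τ : Fin 4 → ℝ) (d₁ d₂ k₁ k₂ : ℝ) : Prop where
  cont₁ : Continuous c₁
  cont₂ : Continuous c₂
  start₁ : c₁ 0 = s
  start₂ : c₂ 0 = s
  x₁ : Jet (fun t => S.x (c₁ t)) (S.x s) e₁ (S.x s + μ • S.n s)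
  x₂ : Jet (fun t => S.x (c₂ t)) (S.x s) e₂ (S.x s - μ • S.n s)
  n₁ : Jet (fun t => S.n (c₁ t)) (S.n s) (μ • e₁) (μ • S.x s + μ ^ 2 • S.n s + τ)
  n₂ : Jet (fun t => S.n (c₂ t)) (S.n s) (-(μ • e₂)) (-(μ • S.x s) + μ ^ 2 • S.n s - τ)
  ell₁ : Jet (fun t => S.ell (c₁ t)) (S.ell s) d₁ k₁
  ell₂ : Jet (fun t => S.ell (c₂ t)) (S.ell s) d₂ k₂
  bochner : S.ell s * (k₁ + k₂) = d₁ ^ 2 + d₂ ^ 2 - 4 * S.ell s ^ 2 * (1 - S.ell s)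

lemma exists_principalJets {s u w : Fin 2 → ℝ} {μ : ℝ} (P : S.Principal s u w μ) :
    ∃ c₁ c₂ τ d₁ d₂ k₁ k₂,
      S.PrincipalJets s (S.dx s u) (S.dx s w) μ c₁ c₂ τ d₁ d₂ k₁ k₂ := by
  have H := P.frame
  obtain ⟨σ, hσ, hσ0, hu', hw', e0, e1⟩ := S.exists_chart H
  set X : (Fin 2 → ℝ) → (Fin 4 → ℝ) := fun y => S.x (σ y) with hXdef
  set N : (Fin 2 → ℝ) → (Fin 4 → ℝ) := fun y => S.n (σ y) with hNdef
  set x0 := S.x s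
  set n0 := S.n s
  have hX : ContDiff ℝ (⊤ : ℕ∞) X := S.smooth_x.comp hσ
  have hN : ContDiff ℝ (⊤ : ℕ∞) N := S.smooth_n.comp hσ
  have hX1 := fun k => contDiff_pd hX k
  have hX2 := fun k l => contDiff_pd (hX1 l) k
  have hpX : ∀ y i, pd i X y = S.dx (σ y) (fderiv ℝ σ y (Pi.single i 1)) :=
    fun y i => pd_comp S.smooth_x hσ y i
  have hpN : ∀ y i, pd i N y = S.dn (σ y) (fderiv ℝ σ y (Pi.single i 1)) :=
    fun y i => pd_comp S.smooth_n hσ y i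
  set E1 := S.dx s u
  set E2 := S.dx s w
  have hE1 : pd 0 X 0 = E1 := by rw [hpX, hσ0, hu']
  have hE2 : pd 1 X 0 = E2 := by rw [hpX, hσ0, hw']
  have hN1 : pd 0 N 0 = μ • E1 := by rw [hpN, hσ0, hu', P.dn_u]
  have hN2 : pd 1 N 0 = -(μ • E2) := by rw [hpN, hσ0, hw', P.dn_w]
  have hX0 : X 0 = x0 := by simp [X, hσ0, x0]
  have hN0 : N 0 = n0 := by simp [N, hσ0, n0]
  -- the second derivatives of the position are normal to the initial tangent plane
  have lin : ∀ (k j : Fin 2) (p : Fin 4 → ℝ), (∀ᶠ y in 𝓝 (0 : Fin 2 → ℝ), qform (X y) p = y j) →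
      ∃ r, ∀ᶠ y in 𝓝 (0 : Fin 2 → ℝ), qform (pd k X y) p = r := by
    intro k j p hp
    refine ⟨(Pi.single k 1 : Fin 2 → ℝ) j, ?_⟩
    filter_upwards [eventually_eventually_nhds.2 hp] with y hy
    have h1 := hasDerivAt_line hX y (Pi.single k 1) 0
    have h2 := hasDerivAt_qform h1 (hasDerivAt_const (0 : ℝ) p)
    have hc : Tendsto (fun t : ℝ => y + t • (Pi.single k 1 : Fin 2 → ℝ)) (𝓝 0) (𝓝 y) := by
      have : Continuous fun t : ℝ => y + t • (Pi.single k 1 : Fin 2 → ℝ) := by fun_prop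
      simpa using this.tendsto 0
    have h3 : HasDerivAt (fun t : ℝ => (y + t • (Pi.single k 1 : Fin 2 → ℝ)) j)
        ((Pi.single k 1 : Fin 2 → ℝ) j) 0 := by
      have := ((hasDerivAt_id (0 : ℝ)).mul_const ((Pi.single k 1 : Fin 2 → ℝ) j)).const_add (y j)
      simpa using this
    have := h2.unique (h3.congr_of_eventuallyEq (hc hy))
    simpa [pd] using this
  have orth2 : ∀ (k l : Fin 2), (∀ᶠ y in 𝓝 (0 : Fin 2 → ℝ), qform (pd k (pd l X) y) E1 = 0) ∧
      (∀ᶠ y in 𝓝 (0 : Fin 2 → ℝ), qform (pd k (pd l X) y) E2 = 0) := by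
    intro k l
    obtain ⟨r1, hr1⟩ := lin l 0 E1 e0
    obtain ⟨r2, hr2⟩ := lin l 1 E2 e1
    exact ⟨pd_qform_const (hX1 l) hr1 k, pd_qform_const (hX1 l) hr2 k⟩
  have orth3 : ∀ (i k l : Fin 2), qform (pd i (pd k (pd l X)) 0) E1 = 0 ∧
      qform (pd i (pd k (pd l X)) 0) E2 = 0 := by
    intro i k l
    exact ⟨(pd_qform_const (hX2 k l) (orth2 k l).1 i).self_of_nhds,
      (pd_qform_const (hX2 k l) (orth2 k l).2 i).self_of_nhds⟩
  have orth2' : ∀ (k l : Fin 2), qform (pd k (pd l X) 0) E1 = 0 ∧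
      qform (pd k (pd l X) 0) E2 = 0 := fun k l =>
    ⟨(orth2 k l).1.self_of_nhds, (orth2 k l).2.self_of_nhds⟩
  -- identities along the surface
  have iXX : ∀ y k, qform (X y) (pd k X y) = 0 := fun y k => by
    rw [hpX]; exact S.x_dx _ _
  have iNX : ∀ y k, qform (N y) (pd k X y) = 0 := fun y k => by
    rw [hpX]; exact S.orth _ _
  have iM : ∀ y k l, qform (pd k N y) (pd l X y) = -qform (N y) (pd k (pd l X) y) := by
    intro y k l
    have h1 := hasDerivAt_line hN y (Pi.single k 1) 0
    have h2 := hasDerivAt_line (hX1 l) y (Pi.single k 1) 0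
    have h3 := hasDerivAt_qform h1 h2
    simp only [iNX] at h3
    have := h3.unique (hasDerivAt_const _ _)
    simp only [zero_smul, add_zero] at this
    simp only [pd] at this ⊢
    linarith
  have A_x : ∀ k l, qform (pd k (pd l X) 0) x0 = - qform (pd k X 0) (pd l X 0) := by
    intro k l
    have h1 := hasDerivAt_line hX 0 (Pi.single k 1) 0
    have h2 := hasDerivAt_line (hX1 l) 0 (Pi.single k 1) 0
    have h3 := hasDerivAt_qform h1 h2
    simp only [iXX] at h3
    have := h3.unique (hasDerivAt_const _ _)
    simp only [zero_smul, add_zero, hX0] at this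
    rw [qform_comm x0] at this
    simp only [pd] at this ⊢
    linarith
  have A_n : ∀ k l, qform (pd k (pd l X) 0) n0 = - qform (pd k N 0) (pd l X 0) := by
    intro k l; rw [iM, hN0, qform_comm]; ring
  have A11 : pd 0 (pd 0 X) 0 = x0 + μ • n0 := by
    have a1 := A_x 0 0
    have a2 := A_n 0 0
    rw [hE1] at a1 a2
    rw [hN1] at a2
    apply H.ext <;> rw [qform_comm] <;>
      simp [orth2', a1, a2, H.aa, H.ac, H.ad, H.bc, H.bd, H.cc, H.cd, H.dc, H.dd]
  have A12 : pd 0 (pd 1 X) 0 = 0 := by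
    have a1 := A_x 0 1
    have a2 := A_n 0 1
    rw [hE2] at a1 a2
    rw [hE1] at a1
    rw [hN1] at a2
    apply H.ext <;> rw [qform_comm] <;> simp [orth2', a1, a2, H.ab]
  have A22 : pd 1 (pd 1 X) 0 = x0 - μ • n0 := by
    have a1 := A_x 1 1
    have a2 := A_n 1 1
    rw [hE2] at a1 a2
    rw [hN2] at a2
    apply H.ext <;> rw [qform_comm] <;>
      simp [orth2', a1, a2, H.bb, H.ac, H.ad, H.bc, H.bd, H.cc, H.cd, H.dc, H.dd]
  have A21 : pd 1 (pd 0 X) 0 = 0 := by rw [pd_comm hX, A12]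
  have hE12 := H.ab
  -- jets along the coordinate lines
  have JX := fun i => jet_pd hX i
  have JX1 := fun i k => jet_pd (hX1 k) i
  have JX2 := fun i k l => jet_pd (hX2 k l) i
  have JN := fun i => jet_pd hN i
  have iNN : ∀ y, qform (N y) (N y) = -1 := fun y => S.unit _
  have iXN : ∀ y, qform (N y) (X y) = 0 := fun y => S.orth_base _
  have jn := fun i => (((JN i).qform (JN i)).congr (g := fun _ => (-1 : ℝ))
    (Eventually.of_forall fun t => (iNN _).symm)).unique (Jet.const (-1))
  have jx := fun i => (((JN i).qform (JX i)).congr (g := fun _ => (0 : ℝ))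
    (Eventually.of_forall fun t => (iXN _).symm)).unique (Jet.const 0)
  have je := fun i k => (((JN i).qform (JX1 i k)).congr (g := fun _ => (0 : ℝ))
    (Eventually.of_forall fun t => (iNX _ _).symm)).unique (Jet.const 0)
  have comm3 : ∀ i k l, pd i (pd k (pd l X)) 0 = pd k (pd i (pd l X)) 0 := fun i k l => by
    rw [pd_comm (hX1 l)]
  have comm3' : ∀ i k l, pd i (pd k (pd l X)) 0 = pd i (pd l (pd k X)) 0 := fun i k l => by
    rw [pd_comm hX]
  have comm4 : pd 0 (pd 0 (pd 1 (pd 1 X))) 0 = pd 1 (pd 1 (pd 0 (pd 0 X))) 0 := by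
    rw [pd_comm (hX1 1) 0 1, pd_comm hX 0 1, pd_comm (hX2 1 0) 0 1, pd_comm (hX1 0) 0 1]
  set p111 := qform n0 (pd 0 (pd 0 (pd 0 X)) 0) with hp111
  set p112 := qform n0 (pd 1 (pd 0 (pd 0 X)) 0) with hp112
  set p122 := qform n0 (pd 0 (pd 1 (pd 1 X)) 0) with hp122
  set p222 := qform n0 (pd 1 (pd 1 (pd 1 X)) 0) with hp222
  set r1 := qform n0 (pd 0 (pd 0 (pd 0 (pd 0 X))) 0)
  set r2 := qform n0 (pd 1 (pd 1 (pd 0 (pd 0 X))) 0) with hr2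
  set r3 := qform n0 (pd 1 (pd 1 (pd 1 (pd 1 X))) 0)
  -- components of the second derivatives of the normal
  set n11 := pd 0 (pd 0 N) 0
  set n22 := pd 1 (pd 1 N) 0
  have orth3' : ∀ (i k l : Fin 2), qform E1 (pd i (pd k (pd l X)) 0) = 0 ∧
      qform E2 (pd i (pd k (pd l X)) 0) = 0 := fun i k l => by
    rw [qform_comm E1, qform_comm E2]; exact orth3 i k l
  have c1 : pd 0 (pd 0 (pd 1 X)) 0 = pd 1 (pd 0 (pd 0 X)) 0 := by
    rw [comm3' 0 0 1, comm3 0 1 0]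
  have c2 : pd 1 (pd 1 (pd 0 X)) 0 = pd 0 (pd 1 (pd 1 X)) 0 := by
    rw [comm3' 1 1 0, comm3 1 0 1]
  have c3 : pd 1 (pd 0 (pd 1 X)) 0 = pd 0 (pd 1 (pd 1 X)) 0 := by rw [comm3 1 0 1]
  have g11_0 : Jet (fun t : ℝ => qform (pd 0 X (t • Pi.single 0 1)) (pd 0 X (t • Pi.single 0 1)))
      1 0 (-2 * (1 + μ ^ 2)) := by
    refine ((JX1 0 0).qform (JX1 0 0)).congr_coeff ?_ ?_ ?_ <;>
      simp [hE1, A11, orth3, orth3', H.aa, H.ac, H.ad, H.ca, H.da, H.cc, H.dd, H.cd, H.dc]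
    ring
  have g12_0 : Jet (fun t : ℝ => qform (pd 0 X (t • Pi.single 0 1)) (pd 1 X (t • Pi.single 0 1)))
      0 0 0 := by
    refine ((JX1 0 0).qform (JX1 0 1)).congr_coeff ?_ ?_ ?_ <;>
      simp [hE1, hE2, A11, A12, orth3, orth3', H.ab, H.cb, H.db]
  have g22_0 : Jet (fun t : ℝ => qform (pd 1 X (t • Pi.single 0 1)) (pd 1 X (t • Pi.single 0 1)))
      1 0 0 := by
    refine ((JX1 0 1).qform (JX1 0 1)).congr_coeff ?_ ?_ ?_ <;>
      simp [hE2, A12, orth3, orth3', H.bb]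
  have g11_1 : Jet (fun t : ℝ => qform (pd 0 X (t • Pi.single 1 1)) (pd 0 X (t • Pi.single 1 1)))
      1 0 0 := by
    refine ((JX1 1 0).qform (JX1 1 0)).congr_coeff ?_ ?_ ?_ <;>
      simp [hE1, A21, orth3, orth3', H.aa]
  have g12_1 : Jet (fun t : ℝ => qform (pd 0 X (t • Pi.single 1 1)) (pd 1 X (t • Pi.single 1 1)))
      0 0 0 := by
    refine ((JX1 1 0).qform (JX1 1 1)).congr_coeff ?_ ?_ ?_ <;>
      simp [hE1, hE2, A21, A22, orth3, orth3', H.ab, H.ac, H.ad]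
  have g22_1 : Jet (fun t : ℝ => qform (pd 1 X (t • Pi.single 1 1)) (pd 1 X (t • Pi.single 1 1)))
      1 0 (-2 * (1 + μ ^ 2)) := by
    refine ((JX1 1 1).qform (JX1 1 1)).congr_coeff ?_ ?_ ?_ <;>
      simp [hE2, A22, orth3, orth3', H.bb, H.bc, H.bd, H.cb, H.db, H.cc, H.dd, H.cd, H.dc]
    ring
  have nx1 : qform n11 x0 = -μ := by
    have := (jx 0).2.2
    rw [hX0, hN0, hN1, hE1, A11] at this
    simp [H.aa, H.dc, H.dd] at this
    linarith
  have nx2 : qform n22 x0 = μ := by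
    have := (jx 1).2.2
    rw [hX0, hN0, hN2, hE2, A22] at this
    simp [H.bb, H.dc, H.dd] at this
    linarith
  have nn1 : qform n11 n0 = -μ ^ 2 := by
    have := (jn 0).2.2
    rw [hN0, hN1, qform_comm n0] at this
    simp [H.aa] at this
    linarith
  have nn2 : qform n22 n0 = -μ ^ 2 := by
    have := (jn 1).2.2
    rw [hN0, hN2, qform_comm n0] at this
    simp [H.bb] at this
    linarith
  have ne11 : qform n11 E1 = -p111 := by
    have := (je 0 0).2.2
    rw [hN0, hN1, hE1, A11] at this
    simp [H.ac, H.ad] at this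
    linarith
  have ne12 : qform n11 E2 = -p112 := by
    have := (je 0 1).2.2
    rw [hN0, hN1, hE2, A12, c1] at this
    simp at this
    linarith
  have ne21 : qform n22 E1 = -p122 := by
    have := (je 1 0).2.2
    rw [hN0, hN2, hE1, A21, c2] at this
    simp at this
    linarith
  have ne22 : qform n22 E2 = -p222 := by
    have := (je 1 1).2.2
    rw [hN0, hN2, hE2, A22] at this
    simp [H.bc, H.bd] at this
    linarith
  -- the second fundamental form along the coordinate lines
  have M11_0 : Jet (fun t : ℝ => -qform (N (t • Pi.single 0 1)) (pd 0 (pd 0 X) (t • Pi.single 0 1)))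
      μ (-p111) (μ + μ ^ 3 - r1) := by
    refine ((JN 0).qform (JX2 0 0 0)).neg.congr_coeff ?_ ?_ ?_ <;>
      simp [hN0, hN1, A11, orth3', H.dc, H.dd, H.ac, H.ad, nx1, nn1, r1, p111, n11] <;> ring
  have M12_0 : Jet (fun t : ℝ => -qform (N (t • Pi.single 0 1)) (pd 0 (pd 1 X) (t • Pi.single 0 1)))
      0 (-p112) (-qform n0 (pd 0 (pd 0 (pd 0 (pd 1 X))) 0)) := by
    refine ((JN 0).qform (JX2 0 0 1)).neg.congr_coeff ?_ ?_ ?_ <;>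
      simp [hN0, hN1, A12, orth3', c1, p112]
  have M22_0 : Jet (fun t : ℝ => -qform (N (t • Pi.single 0 1)) (pd 1 (pd 1 X) (t • Pi.single 0 1)))
      (-μ) (-p122) (μ - μ ^ 3 - r2) := by
    refine ((JN 0).qform (JX2 0 1 1)).neg.congr_coeff ?_ ?_ ?_ <;>
      simp [hN0, hN1, A22, orth3', H.dc, H.dd, H.ac, H.ad, nx1, nn1, comm4, r2, p122, n11] <;> ring
  have M11_1 : Jet (fun t : ℝ => -qform (N (t • Pi.single 1 1)) (pd 0 (pd 0 X) (t • Pi.single 1 1)))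
      μ (-p112) (-μ + μ ^ 3 - r2) := by
    refine ((JN 1).qform (JX2 1 0 0)).neg.congr_coeff ?_ ?_ ?_ <;>
      simp [hN0, hN2, A11, orth3', H.dc, H.dd, H.bc, H.bd, nx2, nn2, r2, p112, n22] <;> ring
  have M12_1 : Jet (fun t : ℝ => -qform (N (t • Pi.single 1 1)) (pd 0 (pd 1 X) (t • Pi.single 1 1)))
      0 (-p122) (-qform n0 (pd 1 (pd 1 (pd 0 (pd 1 X))) 0)) := by
    refine ((JN 1).qform (JX2 1 0 1)).neg.congr_coeff ?_ ?_ ?_ <;>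
      simp [hN0, hN2, A12, orth3', c3, p122]
  have M22_1 : Jet (fun t : ℝ => -qform (N (t • Pi.single 1 1)) (pd 1 (pd 1 X) (t • Pi.single 1 1)))
      (-μ) (-p222) (-μ - μ ^ 3 - r3) := by
    refine ((JN 1).qform (JX2 1 1 1)).neg.congr_coeff ?_ ?_ ?_ <;>
      simp [hN0, hN2, A22, orth3', H.dc, H.dd, H.bc, H.bd, nx2, nn2, r3, p222, n22] <;> ring
  -- the equation of maximal surfaces
  have pde : ∀ y, qform (pd 1 X y) (pd 1 X y) * -qform (N y) (pd 0 (pd 0 X) y)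
      - 2 * qform (pd 0 X y) (pd 1 X y) * -qform (N y) (pd 0 (pd 1 X) y)
      + qform (pd 0 X y) (pd 0 X y) * -qform (N y) (pd 1 (pd 1 X) y) = 0 := by
    intro y
    rw [← iM, ← iM, ← iM]
    simp only [hpX, hpN]
    exact S.trace_identity _ _ _
  have ellid : ∀ y, S.ell (σ y) * (qform (pd 0 X y) (pd 0 X y) * qform (pd 1 X y) (pd 1 X y)
      - qform (pd 0 X y) (pd 1 X y) * qform (pd 0 X y) (pd 1 X y)) =
      qform (N y) (pd 0 (pd 1 X) y) * qform (N y) (pd 0 (pd 1 X) y) -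
      -qform (N y) (pd 0 (pd 0 X) y) * -qform (N y) (pd 1 (pd 1 X) y) := by
    intro y
    have h1 := S.ell_identity (σ y) (fderiv ℝ σ y (Pi.single 0 1)) (fderiv ℝ σ y (Pi.single 1 1))
    rw [← hpX, ← hpX, ← hpN, ← hpN, iM, iM, iM] at h1
    linear_combination h1
  have pde0 := ((((g22_0.mul M11_0).sub ((g12_0.const_mul 2).mul M12_0)).add
    (g11_0.mul M22_0)).congr (g := fun _ => (0 : ℝ))
    (Eventually.of_forall fun t => (pde _).symm)).unique (Jet.const 0)
  have pde1 := ((((g22_1.mul M11_1).sub ((g12_1.const_mul 2).mul M12_1)).add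
    (g11_1.mul M22_1)).congr (g := fun _ => (0 : ℝ))
    (Eventually.of_forall fun t => (pde _).symm)).unique (Jet.const 0)
  have q1 : p111 + p122 = 0 := by linarith [pde0.2.1]
  have q2 : p112 + p222 = 0 := by linarith [pde1.2.1]
  have q3 : r1 + r2 = 4 * μ + 2 * μ ^ 3 := by linarith [pde0.2.2]
  have q4 : r2 + r3 = -(4 * μ + 2 * μ ^ 3) := by linarith [pde1.2.2]
  have det_0 := (g11_0.mul g22_0).sub (g12_0.mul g12_0)
  have det_1 := (g11_1.mul g22_1).sub (g12_1.mul g12_1)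
  have rhs_0 := (M12_0.mul M12_0).sub (M11_0.mul M22_0)
  have rhs_1 := (M12_1.mul M12_1).sub (M11_1.mul M22_1)
  have hdet : ∀ (i : Fin 2) {a b c : ℝ}, Jet (fun t : ℝ =>
      qform (pd 0 X (t • Pi.single i 1)) (pd 0 X (t • Pi.single i 1)) *
      qform (pd 1 X (t • Pi.single i 1)) (pd 1 X (t • Pi.single i 1)) -
      qform (pd 0 X (t • Pi.single i 1)) (pd 1 X (t • Pi.single i 1)) *
      qform (pd 0 X (t • Pi.single i 1)) (pd 1 X (t • Pi.single i 1))) a b c → a ≠ 0 →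
      (fun t : ℝ => S.ell (σ (t • Pi.single i 1))) =ᶠ[𝓝 0] fun t : ℝ =>
      (-qform (N (t • Pi.single i 1)) (pd 0 (pd 1 X) (t • Pi.single i 1)) *
        -qform (N (t • Pi.single i 1)) (pd 0 (pd 1 X) (t • Pi.single i 1)) -
      -qform (N (t • Pi.single i 1)) (pd 0 (pd 0 X) (t • Pi.single i 1)) *
        -qform (N (t • Pi.single i 1)) (pd 1 (pd 1 X) (t • Pi.single i 1))) *
      (qform (pd 0 X (t • Pi.single i 1)) (pd 0 X (t • Pi.single i 1)) *
      qform (pd 1 X (t • Pi.single i 1)) (pd 1 X (t • Pi.single i 1)) -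
      qform (pd 0 X (t • Pi.single i 1)) (pd 1 X (t • Pi.single i 1)) *
      qform (pd 0 X (t • Pi.single i 1)) (pd 1 X (t • Pi.single i 1)))⁻¹ := by
    intro i a b c hJ ha
    have hne := hJ.continuousAt.eventually_ne (by rw [hJ.value]; exact ha)
    filter_upwards [hne] with t ht
    rw [← div_eq_mul_inv, eq_div_iff ht, ellid]
    ring
  have ell_0 := (rhs_0.mul (det_0.inv (by norm_num))).congr (hdet 0 det_0 (by norm_num))
  have ell_1 := (rhs_1.mul (det_1.inv (by norm_num))).congr (hdet 1 det_1 (by norm_num))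
  have hx : ∀ i : Fin 2, σ ((0 : ℝ) • Pi.single i 1) = s := fun i => by simp [hσ0]
  have hP := P.sq
  have contc : ∀ i : Fin 2, Continuous fun t : ℝ => σ (t • (Pi.single i 1 : Fin 2 → ℝ)) := fun i =>
    hσ.continuous.comp (by fun_prop)
  refine ⟨fun t => σ (t • Pi.single 0 1), fun t => σ (t • Pi.single 1 1),
    n11 - μ • x0 - μ ^ 2 • n0, -2 * μ * p111, -2 * μ * p112, _, _, contc 0, contc 1, hx 0, hx 1,
    ?_, ?_, ?_, ?_, ell_0.congr_coeff ?_ ?_ rfl, ell_1.congr_coeff ?_ ?_ rfl, ?_⟩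
  · exact (JX 0).congr_coeff hX0 hE1 A11
  · exact (JX 1).congr_coeff hX0 hE2 A22
  · exact (JN 0).congr_coeff hN0 hN1 (by
      change n11 = μ • x0 + μ ^ 2 • n0 + (n11 - μ • x0 - μ ^ 2 • n0)
      abel)
  · refine (JN 1).congr_coeff hN0 hN2 ?_
    change n22 = -(μ • x0) + μ ^ 2 • n0 - (n11 - μ • x0 - μ ^ 2 • n0)
    apply H.ext <;> rw [qform_comm _ n22] <;>
      simp only [qform_add_right, qform_sub_right, qform_neg_right, qform_smul_right,
        qform_comm E1 n11, qform_comm E2 n11, qform_comm x0 n11, qform_comm n0 n11, H.ac, H.ad,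
        H.bc, H.bd, H.cc, H.cd, H.dc, H.dd, ne11, ne12, ne21, ne22, nx1, nx2, nn1, nn2] <;>
      linarith
  · rw [← hP]; ring
  · have : p122 = -p111 := by linarith
    rw [this]; ring
  · rw [← hP]; ring
  · have : p222 = -p112 := by linarith
    rw [this]; ring
  · have e1 : p122 = -p111 := by linarith
    have e2 : p222 = -p112 := by linarith
    have e3 : r1 = 4 * μ + 2 * μ ^ 3 - r2 := by linarith
    have e4 : r3 = -(4 * μ + 2 * μ ^ 3) - r2 := by linarith
    rw [← hP, e1, e2, e3, e4]
    ring
end MaxSurf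

/-- Two orthonormal negative vectors and a unit positive vector complete to a frame. -/
lemma Frame.exists_completion {a c d : Fin 4 → ℝ} (aa : qform a a = 1) (cc : qform c c = -1)
    (dd : qform d d = -1) (ac : qform a c = 0) (ad : qform a d = 0) (cd : qform c d = 0) :
    ∃ b, Frame a b c d := by
  let m : Fin 4 → Fin 4 → Fin 4 → ℝ := fun i j k =>
    a i * (c j * d k - c k * d j) - a j * (c i * d k - c k * d i) + a k * (c i * d j - c j * d i)
  let b : Fin 4 → ℝ := ![m 1 2 3, -m 0 2 3, -m 0 1 3, m 0 1 2]
  have key : qform b b = qform a a * (qform c c * qform d d - qform c d * qform c d)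
      - qform a c * (qform a c * qform d d - qform c d * qform a d)
      + qform a d * (qform a c * qform c d - qform c c * qform a d) := by
    simp only [b, m, qform]
    simp
    ring
  refine ⟨b, aa, ?_, cc, dd, ?_, ac, ad, ?_, ?_, cd⟩
  · rw [key, aa, cc, dd, ac, ad, cd]; norm_num
  all_goals
    simp only [b, m, qform]
    simp
    ring

lemma Frame.norm_le {a b c d : Fin 4 → ℝ} (H : Frame a b c d) {p : Fin 4 → ℝ} {R : ℝ}
    (ha : |qform a p| ≤ R) (hb : |qform b p| ≤ R) (hc : |qform c p| ≤ R) (hd : |qform d p| ≤ R) :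
    ‖p‖ ≤ R * (‖a‖ + ‖b‖ + ‖c‖ + ‖d‖) := by
  have h1 := norm_sub_le (qform a p • a + qform b p • b - qform c p • c) (qform d p • d)
  have h2 := norm_sub_le (qform a p • a + qform b p • b) (qform c p • c)
  have h3 := norm_add_le (qform a p • a) (qform b p • b)
  rw [← H.expand p] at h1
  rw [norm_smul, Real.norm_eq_abs] at h1 h2 h3
  rw [norm_smul, Real.norm_eq_abs] at h3
  have := mul_le_mul_of_nonneg_right ha (norm_nonneg a)
  have := mul_le_mul_of_nonneg_right hb (norm_nonneg b)
  have := mul_le_mul_of_nonneg_right hc (norm_nonneg c)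
  have := mul_le_mul_of_nonneg_right hd (norm_nonneg d)
  linarith

namespace MaxSurf

/-- A curve in the surface on which one linear function is constant and another one is
the parameter. -/
lemma exists_level_curve (S : MaxSurf) {s : Fin 2 → ℝ} {p r : Fin 4 → ℝ}
    (h : ∀ v, qform (S.dx s v) p = 0 → qform (S.dx s v) r = 0 → v = 0) :
    ∃ c : ℝ → (Fin 2 → ℝ), c 0 = s ∧ Continuous c ∧
      (∀ᶠ t in 𝓝 (0 : ℝ), qform (S.x (c t)) p = qform (S.x s) p ∧
        qform (S.x (c t)) r = qform (S.x s) r + t) ∧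
      ∃ v, HasDerivAt (fun t => S.x (c t)) (S.dx s v) 0 := by
  let Y : (Fin 2 → ℝ) → (Fin 2 → ℝ) := fun y => ![qform (S.x y) p, qform (S.x y) r]
  have hY : ContDiff ℝ (⊤ : ℕ∞) Y := by
    rw [contDiff_pi]
    intro i
    fin_cases i
    · exact contDiff_qform S.smooth_x contDiff_const
    · exact contDiff_qform S.smooth_x contDiff_const
  have hd : ∀ v, fderiv ℝ Y s v = ![qform (S.dx s v) p, qform (S.dx s v) r] := by
    intro v
    have h1 := hasDerivAt_line hY s v 0
    have h2 := hasDerivAt_line S.smooth_x s v 0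
    simp only [zero_smul, add_zero] at h1 h2
    refine h1.unique ?_
    rw [hasDerivAt_pi]
    intro i
    fin_cases i
    · simpa [Y] using hasDerivAt_qform h2 (hasDerivAt_const (0 : ℝ) p)
    · simpa [Y] using hasDerivAt_qform h2 (hasDerivAt_const (0 : ℝ) r)
  have hinj : Function.Injective (fderiv ℝ Y s) := by
    rw [injective_iff_map_eq_zero]
    intro v hv
    rw [hd] at hv
    exact h v (by simpa using congrFun hv 0) (by simpa using congrFun hv 1)
  obtain ⟨σ, hσ, hσs, hσY, -⟩ := exists_smooth_local_inverse hY hinj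
  have hc : Continuous fun t : ℝ => Y s + t • (Pi.single 1 1 : Fin 2 → ℝ) := by fun_prop
  refine ⟨fun t => σ (Y s + t • Pi.single 1 1), by simpa using hσs, hσ.continuous.comp hc, ?_,
    fderiv ℝ σ (Y s) (Pi.single 1 1), ?_⟩
  · have : Tendsto (fun t : ℝ => Y s + t • (Pi.single 1 1 : Fin 2 → ℝ)) (𝓝 0) (𝓝 (Y s)) := by
      simpa using hc.tendsto 0
    filter_upwards [this.eventually hσY] with t ht
    have h0 := congrFun ht 0
    have h1 := congrFun ht 1
    constructor
    · calc _ = Y s 0 + (t • (Pi.single 1 1 : Fin 2 → ℝ)) 0 := h0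
        _ = _ := by simp [Y]
    · calc _ = Y s 1 + (t • (Pi.single 1 1 : Fin 2 → ℝ)) 1 := h1
        _ = _ := by simp [Y]
  · have h1 := hasDerivAt_line hσ (Y s) (Pi.single 1 1) 0
    simp only [zero_smul, add_zero] at h1
    have h2 : HasFDerivAt S.x (fderiv ℝ S.x s) (σ (Y s + (0 : ℝ) • Pi.single 1 1)) := by
      simp only [zero_smul, add_zero, hσs]
      exact (S.smooth_x.differentiable (by simp) s).hasFDerivAt
    exact h2.comp_hasDerivAt (0 : ℝ) h1

end MaxSurf

/-- `G` is one of the two coherent families of lifts of an acausal curve in the boundary at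
infinity, and this curve is the asymptotic boundary of the surface. -/
structure Asymptotic (S : MaxSurf) (G : Set (Fin 4 → ℝ)) : Prop where
  null : ∀ γ ∈ G, qform γ γ = 0
  smul_mem : ∀ γ ∈ G, ∀ c : ℝ, 0 < c → c • γ ∈ G
  nonpos : ∀ γ ∈ G, ∀ γ' ∈ G, qform γ γ' ≤ 0
  proportional : ∀ γ ∈ G, ∀ γ' ∈ G, qform γ γ' = 0 → ∃ c : ℝ, 0 < c ∧ γ' = c • γ
  exists_pair : ∃ γ ∈ G, ∃ γ' ∈ G, qform γ γ' < 0
  limit : ∀ (c : ℕ → ℝ) (s : ℕ → Fin 2 → ℝ) (ν : Fin 4 → ℝ), ν ≠ 0 →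
    Tendsto (fun k => c k • S.x (s k)) atTop (𝓝 ν) → ν ∈ G ∨ -ν ∈ G ∨ ∃ (s : Fin 2 → ℝ) (r : ℝ), ν = r • S.x s
  closed : ∀ (γ : ℕ → Fin 4 → ℝ) (ν : Fin 4 → ℝ), (∀ k, γ k ∈ G) → ν ≠ 0 →
    Tendsto γ atTop (𝓝 ν) → ν ∈ G

namespace Asymptotic
variable {S : MaxSurf} {G : Set (Fin 4 → ℝ)}

lemma add_pair (A : Asymptotic S G) {γ₁ γ₂ γ : Fin 4 → ℝ} (h₁ : γ₁ ∈ G) (h₂ : γ₂ ∈ G) (h : γ ∈ G)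
    (hneg : qform γ₁ γ₂ < 0) : qform γ (γ₁ + γ₂) < 0 := by
  have a1 := A.nonpos γ h γ₁ h₁
  have a2 := A.nonpos γ h γ₂ h₂
  rw [qform_add_right]
  rcases a1.lt_or_eq with b1 | b1
  · linarith
  rcases a2.lt_or_eq with b2 | b2
  · linarith
  obtain ⟨c, -, rfl⟩ := A.proportional γ h γ₁ h₁ b1
  obtain ⟨c', -, rfl⟩ := A.proportional γ h γ₂ h₂ b2
  simp [A.null γ h] at hneg

lemma ne_zero (A : Asymptotic S G) {γ : Fin 4 → ℝ} (h : γ ∈ G) : γ ≠ 0 := by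
  rintro rfl
  obtain ⟨γ₁, h₁, γ₂, h₂, hneg⟩ := A.exists_pair
  simpa using A.add_pair h₁ h₂ h hneg

lemma limit_null (A : Asymptotic S G) {c : ℕ → ℝ} {s : ℕ → Fin 2 → ℝ} {ν : Fin 4 → ℝ} (hν : ν ≠ 0)
    (hc : Tendsto c atTop (𝓝 0)) (h : Tendsto (fun k => c k • S.x (s k)) atTop (𝓝 ν)) :
    ν ∈ G ∨ -ν ∈ G := by
  rcases A.limit c s ν hν h with h1 | h1 | ⟨s', r, rfl⟩
  · exact Or.inl h1
  · exact Or.inr h1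
  · exfalso
    have q : Continuous fun z : Fin 4 → ℝ => qform z z := continuous_qform continuous_id continuous_id
    have h2 := (q.tendsto _).comp h
    have h3 : Tendsto (fun k => -(c k * c k)) atTop (𝓝 (-(0 * 0))) := (hc.mul hc).neg
    have h4 : (fun z : Fin 4 → ℝ => qform z z) ∘ (fun k => c k • S.x (s k)) =
        fun k => -(c k * c k) := by
      ext k; simp [S.quad]
    rw [h4] at h2
    have h5 := tendsto_nhds_unique h2 h3
    simp [S.quad] at h5
    exact hν (by simp [h5])

lemma isClosed_cover (A : Asymptotic S G) : IsClosed {ζ | ∃ s, ζ = S.x s ∨ ζ = -S.x s} := by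
  apply IsSeqClosed.isClosed
  intro ζ ν h hlim
  choose s hs using h
  have q : Continuous fun z : Fin 4 → ℝ => qform z z := continuous_qform continuous_id continuous_id
  have h2 := (q.tendsto _).comp hlim
  have h4 : (fun z : Fin 4 → ℝ => qform z z) ∘ ζ = fun _ => -1 := by
    ext k
    rcases hs k with h | h <;> simp [h, S.quad]
  rw [h4] at h2
  have hq : qform ν ν = -1 := tendsto_nhds_unique h2 tendsto_const_nhds
  have hν : ν ≠ 0 := by rintro rfl; simp at hq
  have : ∀ k, ∃ c : ℝ, ζ k = c • S.x (s k) := fun k => by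
    rcases hs k with h | h
    · exact ⟨1, by simp [h]⟩
    · exact ⟨-1, by simp [h]⟩
  choose c hc using this
  have hlim' : Tendsto (fun k => c k • S.x (s k)) atTop (𝓝 ν) := hlim.congr hc
  rcases A.limit c s ν hν hlim' with h1 | h1 | ⟨s', r, rfl⟩
  · have := A.null _ h1
    linarith
  · have := A.null _ h1
    simp at this
    linarith
  · simp [S.quad] at hq
    have : (r - 1) * (r + 1) = 0 := by linarith
    rcases mul_eq_zero.1 this with h | h
    · exact ⟨s', Or.inl (by rw [show r = 1 by linarith]; simp)⟩
    · exact ⟨s', Or.inr (by rw [show r = -1 by linarith]; simp)⟩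

lemma neg (A : Asymptotic S G) : Asymptotic S {γ | -γ ∈ G} where
  null γ h := by simpa using A.null _ h
  smul_mem γ h c hc := by simpa using A.smul_mem _ h c hc
  nonpos γ h γ' h' := by simpa using A.nonpos _ h _ h'
  proportional γ h γ' h' hz := by
    obtain ⟨c, hc, e⟩ := A.proportional _ h _ h' (by simpa using hz)
    exact ⟨c, hc, by simpa using e⟩
  exists_pair := by
    obtain ⟨γ, h, γ', h', e⟩ := A.exists_pair
    exact ⟨-γ, by simpa using h, -γ', by simpa using h', by simpa using e⟩
  limit c s ν hν h := by
    rcases A.limit c s ν hν h with h | h | h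
    · exact Or.inr (Or.inl (by simpa using h))
    · exact Or.inl h
    · exact Or.inr (Or.inr h)
  closed γ ν h hν hl := A.closed (fun k => -γ k) (-ν) h (by simpa using hν) hl.neg

lemma flip (A : Asymptotic S G) : Asymptotic S.flip G where
  null := A.null
  smul_mem := A.smul_mem
  nonpos := A.nonpos
  proportional := A.proportional
  exists_pair := A.exists_pair
  limit := A.limit
  closed := A.closed

set_option maxHeartbeats 2000000 in
/-- The points of the surface are not separated in the boundary from their dual planes. -/
lemma not_separated (A : Asymptotic S G) {s₀ : Fin 2 → ℝ} {γ₁ γ₂ : Fin 4 → ℝ} (hγ₁ : γ₁ ∈ G)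
    (hγ₂ : γ₂ ∈ G) (h₁ : qform (S.x s₀) γ₁ < 0) (h₂ : 0 < qform (S.x s₀) γ₂) : False := by
  set z := S.x s₀ with hz
  have zz : qform z z = -1 := S.quad s₀
  obtain ⟨k, hk⟩ : ∃ k, k = qform z γ₂ := ⟨_, rfl⟩
  obtain ⟨h, hh⟩ : ∃ h, h = -qform z γ₁ := ⟨_, rfl⟩
  have kpos : 0 < k := by rw [hk]; exact h₂
  have hpos : 0 < h := by rw [hh]; linarith
  have hg : qform γ₁ γ₂ < 0 := by
    refine (A.nonpos _ hγ₁ _ hγ₂).lt_of_ne fun e => ?_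
    obtain ⟨c, hc, rfl⟩ := A.proportional _ hγ₁ _ hγ₂ e
    simp at h₂
    nlinarith
  obtain ⟨g, hgd⟩ : ∃ g, g = -qform γ₁ γ₂ := ⟨_, rfl⟩
  have gpos : 0 < g := by rw [hgd]; linarith
  set E : Fin 4 → ℝ := k⁻¹ • γ₂ + z with hE
  have e1 : qform γ₂ z = k := by rw [hk, qform_comm]
  have e2 : qform z γ₁ = -h := by linarith
  have e2' : qform γ₁ z = -h := by rw [qform_comm, e2]
  have e3 : qform γ₁ γ₂ = -g := by linarith
  have EE : qform E E = 1 := by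
    simp [hE, A.null _ hγ₂, e1, ← hk, zz]
    field_simp
    norm_num
  have Ez : qform E z = 0 := by
    simp [hE, e1, zz]
    field_simp
    norm_num
  set L := h + g / k with hL
  have Lh : h < L := by have := div_pos gpos kpos; linarith
  have γE : qform γ₁ E = -L := by
    simp [hE, e3, e2']
    field_simp
    simp [hL]
    field_simp
    ring
  have Eγ : qform E γ₁ = -L := by rw [qform_comm, γE]
  have zE : qform z E = 0 := by rw [qform_comm, Ez]
  set r := Real.sqrt (L ^ 2 - h ^ 2) with hr
  have rsq : r ^ 2 = L ^ 2 - h ^ 2 := Real.sq_sqrt (by nlinarith)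
  have rpos : 0 < r := Real.sqrt_pos.2 (by nlinarith)
  set F : Fin 4 → ℝ := r⁻¹ • (γ₁ - h • z + L • E) with hF
  have FF : qform F F = -1 := by
    simp [hF, A.null _ hγ₁, e2, e2', γE, Eγ, EE, zE, Ez, zz]
    field_simp
    rw [rsq]; ring
  have Fz : qform F z = 0 := by simp [hF, e2', zz, Ez]
  have FE : qform F E = 0 := by simp [hF, γE, zE, EE]
  have γ₁e : γ₁ = h • z - L • E + r • F := by
    rw [hF, smul_smul, mul_inv_cancel₀ rpos.ne', one_smul]
    abel
  have γ₂e : γ₂ = k • E - k • z := by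
    rw [hE, smul_add, smul_smul, mul_inv_cancel₀ kpos.ne', one_smul]
    abel
  obtain ⟨W, H⟩ := Frame.exists_completion EE zz FF Ez (by rw [qform_comm, FE])
    (by rw [qform_comm, Fz])
  let Ω : Set (Fin 4 → ℝ) := {ζ | (∃ s, ζ = S.x s ∨ ζ = -S.x s) ∧ qform ζ W = 0 ∧
    |qform ζ F| ≤ qform ζ E ∧ qform ζ z ≤ 0}
  have hquad : ∀ ζ ∈ Ω, qform E ζ ^ 2 - qform z ζ ^ 2 - qform F ζ ^ 2 = -1 := by
    rintro ζ ⟨⟨s, hs⟩, hW, -, -⟩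
    have h1 : qform ζ ζ = -1 := by rcases hs with rfl | rfl <;> simp [S.quad]
    rw [H.inner, qform_comm W, hW] at h1
    linarith
  have grow : ∀ ζ ∈ Ω, ∃ ζ' ∈ Ω, qform ζ E < qform ζ' E := by
    rintro ζ hζ
    obtain ⟨⟨s, hs⟩, hW, hFE, hzz⟩ := id hζ
    obtain ⟨ε, hε, hζε⟩ : ∃ ε : ℝ, ε * ε = 1 ∧ ζ = ε • S.x s := by
      rcases hs with h | h
      · exact ⟨1, by norm_num, by simp [h]⟩
      · exact ⟨-1, by norm_num, by simp [h]⟩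
    have hε0 : ε ≠ 0 := by rintro rfl; simp at hε
    have hinj : ∀ v, qform (S.dx s v) W = 0 → qform (S.dx s v) (ε • E) = 0 → v = 0 := by
      intro v h1 h2
      by_contra hv
      have h3 := S.spacelike s v hv
      rw [qform_smul_right] at h2
      have h4 := (mul_eq_zero.1 h2).resolve_left hε0
      rw [H.inner, qform_comm E, qform_comm W, h1, h4] at h3
      nlinarith
    obtain ⟨c, hc0, hcc, hlev, v, hv⟩ := S.exists_level_curve hinj
    have hv0 : qform (S.dx s v) W = 0 ∧ qform (S.dx s v) (ε • E) = 1 := by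
      constructor
      · refine ((hasDerivAt_qform hv (hasDerivAt_const (0 : ℝ) W)).congr_deriv (by simp)).unique ?_
        refine (hasDerivAt_const (0 : ℝ) (qform (S.x s) W)).congr_of_eventuallyEq ?_
        filter_upwards [hlev] with t ht using ht.1
      · refine ((hasDerivAt_qform hv (hasDerivAt_const (0 : ℝ) (ε • E))).congr_deriv
          (g' := qform (S.dx s v) (ε • E)) (by simp)).unique ?_
        refine ((hasDerivAt_id (0 : ℝ)).const_add
          (qform (S.x s) (ε • E))).congr_of_eventuallyEq ?_
        filter_upwards [hlev] with t ht using ht.2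
    have hvne : v ≠ 0 := by rintro rfl; simp at hv0
    have hsp := S.spacelike s v hvne
    rw [H.inner, qform_comm E, qform_comm W, hv0.1] at hsp
    have hE1 : qform (S.dx s v) E ^ 2 = 1 := by
      have := hv0.2
      rw [qform_smul_right] at this
      nlinarith
    have hf1 : |qform (S.dx s v) (ε • F)| < 1 := by
      rw [← sq_lt_one_iff_abs_lt_one, sq, qform_smul_right, qform_comm _ F]
      have : ε * qform F (S.dx s v) * (ε * qform F (S.dx s v)) = qform F (S.dx s v) ^ 2 := by
        linear_combination qform F (S.dx s v) ^ 2 * hε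
      nlinarith [sq_nonneg (qform z (S.dx s v))]
    have hderF := (hasDerivAt_qform hv (hasDerivAt_const (0 : ℝ) (ε • F)))
    simp only [qform_zero_right, add_zero, hc0] at hderF
    have hFE' : |qform (S.x s) (ε • F)| ≤ qform (S.x s) (ε • E) := by
      rw [hζε] at hFE
      simpa using hFE
    -- the component along `F` grows slower than the one along `E`
    have slow : ∀ᶠ t in 𝓝[>] (0 : ℝ), |qform (S.x (c t)) (ε • F)| ≤
        qform (S.x s) (ε • E) + t := by
      rw [hasDerivAt_iff_tendsto_slope] at hderF
      have h1 : ∀ᶠ t in 𝓝[>] (0 : ℝ), |slope (fun t => qform (S.x (c t)) (ε • F)) 0 t| < 1 := by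
        have := (hderF.mono_left (nhdsWithin_mono (0 : ℝ)
          (fun t (ht : 0 < t) => (ht.ne' : t ≠ 0)))).abs
        exact this.eventually (gt_mem_nhds hf1)
      filter_upwards [h1, self_mem_nhdsWithin] with t ht ht0
      have ht0 : 0 < t := ht0
      simp only [slope_def_field, hc0, sub_zero, abs_div, abs_of_pos ht0] at ht
      rw [div_lt_one ht0] at ht
      have := abs_sub_abs_le_abs_sub (qform (S.x (c t)) (ε • F)) (qform (S.x s) (ε • F))
      linarith
    have hz1 : qform ζ z < 0 := by
      refine hzz.lt_of_ne fun h0 => ?_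
      have h1 := hquad ζ hζ
      rw [qform_comm z, h0, qform_comm E, qform_comm F] at h1
      have := sq_le_sq' (by linarith [abs_nonneg (qform ζ F), neg_abs_le (qform ζ F)])
        (le_of_abs_le hFE)
      linarith
    have hcz : Continuous fun t => qform (ε • S.x (c t)) z :=
      continuous_qform ((S.smooth_x.continuous.comp hcc).const_smul ε) continuous_const
    have hz2 : ∀ᶠ t in 𝓝 (0 : ℝ), qform (ε • S.x (c t)) z < 0 := by
      refine (hcz.tendsto 0).eventually (gt_mem_nhds ?_)
      rw [hc0, ← hζε]; exact hz1
    obtain ⟨t, ⟨⟨t1, t2⟩, t3⟩, t4, t5⟩ := (((hlev.and hz2).filter_mono nhdsWithin_le_nhds).and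
      (slow.and self_mem_nhdsWithin)).exists
    have t5 : 0 < t := t5
    refine ⟨ε • S.x (c t), ⟨⟨c t, ?_⟩, ?_, ?_, t3.le⟩, ?_⟩
    · have : (ε - 1) * (ε + 1) = 0 := by linarith
      rcases mul_eq_zero.1 this with h | h
      · exact Or.inl (by rw [show ε = 1 by linarith]; simp)
      · exact Or.inr (by rw [show ε = -1 by linarith]; simp)
    · rw [hζε, qform_smul_left] at hW
      rw [qform_smul_left, t1]
      exact hW
    · rw [qform_smul_left, qform_smul_left, ← qform_smul_right, ← qform_smul_right, t2]
      exact t4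
    · rw [hζε, qform_smul_left, qform_smul_left, ← qform_smul_right, ← qform_smul_right, t2]
      linarith
  have cq : ∀ p : Fin 4 → ℝ, Continuous fun ζ : Fin 4 → ℝ => qform ζ p := fun p =>
    continuous_qform continuous_id continuous_const
  have hΩc : IsClosed Ω := by
    refine A.isClosed_cover.inter ((isClosed_eq (cq W) continuous_const).inter
      ((isClosed_le (cq F).abs (cq E)).inter (isClosed_le (cq z) continuous_const)))
  have hΩb : ∀ ζ ∈ Ω, ∀ R, 0 ≤ R → qform ζ E ≤ R → ‖ζ‖ ≤ (R + 1) * (‖E‖ + ‖W‖ + ‖z‖ + ‖F‖) := by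
    intro ζ hζ R hR hle
    have h1 := hquad ζ hζ
    obtain ⟨-, hW, hFE, -⟩ := hζ
    have h0 : 0 ≤ qform ζ E := (abs_nonneg _).trans hFE
    apply H.norm_le
    · rw [qform_comm, abs_of_nonneg h0]; linarith
    · rw [qform_comm, hW]; simp; linarith
    · apply abs_le_of_sq_le_sq _ (by linarith)
      rw [qform_comm E] at h1
      nlinarith [sq_nonneg (qform F ζ)]
    · rw [qform_comm]; linarith
  have hz0 : z ∈ Ω := ⟨⟨s₀, Or.inl hz⟩, by rw [qform_comm, H.bc], by
    rw [qform_comm, Fz, zE]; simp, by linarith⟩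
  have unbdd : ∀ R : ℝ, ∃ ζ ∈ Ω, R < qform ζ E := by
    by_contra hcon
    push Not at hcon
    obtain ⟨R, hR⟩ := hcon
    have hR0 : 0 ≤ R := by have := hR z hz0; rwa [zE] at this
    have hcpt : IsCompact Ω := by
      refine Metric.isCompact_of_isClosed_isBounded hΩc (isBounded_iff_forall_norm_le.2
        ⟨_, fun ζ hζ => hΩb ζ hζ R hR0 (hR ζ hζ)⟩)
    obtain ⟨ζ, hζ, hmax⟩ := hcpt.exists_isMaxOn ⟨z, hz0⟩ (cq E).continuousOn
    obtain ⟨ζ', hζ', hlt⟩ := grow ζ hζ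
    exact absurd (hmax hζ') (not_le.2 hlt)
  choose ζ hζ hζR using fun k : ℕ => unbdd (k + 1)
  have lpos : ∀ k, 0 < qform (ζ k) E := fun k => by
    have := hζR k
    have : (0 : ℝ) ≤ k := Nat.cast_nonneg k
    linarith
  have hl1 : ∀ k, (1 : ℝ) ≤ qform (ζ k) E := fun k => by
    have := hζR k
    have : (0 : ℝ) ≤ k := Nat.cast_nonneg k
    linarith
  let l : ℕ → ℝ := fun k => (qform (ζ k) E)⁻¹
  have hl0 : Tendsto l atTop (𝓝 0) := by
    apply tendsto_inv_atTop_zero.comp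
    refine tendsto_atTop_mono (fun k => ?_) tendsto_natCast_atTop_atTop
    have := hζR k
    linarith
  let ν : ℕ → Fin 4 → ℝ := fun k => l k • ζ k
  have hνb : ∀ k, ν k ∈ Metric.closedBall (0 : Fin 4 → ℝ) (2 * (‖E‖ + ‖W‖ + ‖z‖ + ‖F‖)) := by
    intro k
    have h1 := hΩb (ζ k) (hζ k) (qform (ζ k) E) (lpos k).le le_rfl
    rw [mem_closedBall_zero_iff]
    simp only [ν, l]
    rw [norm_smul, norm_inv, Real.norm_eq_abs, abs_of_pos (lpos k), inv_mul_le_iff₀ (lpos k)]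
    refine h1.trans ?_
    have h2 := hl1 k
    have h3 : 0 ≤ ‖E‖ + ‖W‖ + ‖z‖ + ‖F‖ := by positivity
    nlinarith
  obtain ⟨ν', -, ψ, hψ, hlim⟩ := (isCompact_closedBall _ _).tendsto_subseq hνb
  have f1 : ∀ k, qform (ν k) E = 1 := fun k => by
    simp [ν, l, inv_mul_cancel₀ (lpos k).ne']
  have lp : ∀ k, 0 < l k := fun k => inv_pos.2 (lpos k)
  have f2 : ∀ k, qform (ν k) z ≤ 0 := fun k => by
    simp only [ν, qform_smul_left]
    exact mul_nonpos_of_nonneg_of_nonpos (lp k).le (hζ k).2.2.2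
  have f3 : ∀ k, |qform (ν k) F| ≤ 1 := fun k => by
    rw [← f1 k]
    simp only [ν, qform_smul_left, abs_mul, abs_of_pos (lp k)]
    exact mul_le_mul_of_nonneg_left (hζ k).2.2.1 (lp k).le
  have lim := fun p => ((cq p).tendsto ν').comp hlim
  have g1 : qform ν' E = 1 :=
    tendsto_nhds_unique (lim E) (tendsto_const_nhds.congr fun k => (f1 (ψ k)).symm)
  have g2 : qform ν' z ≤ 0 := le_of_tendsto' (lim z) fun k => f2 (ψ k)
  have g3 : |qform ν' F| ≤ 1 := le_of_tendsto' (lim F).abs fun k => f3 (ψ k)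
  have hν' : ν' ≠ 0 := by rintro rfl; simp at g1
  have hcs : ∀ k, ∃ c s, |c| = l k ∧ ν k = c • S.x s := fun k => by
    obtain ⟨s, h | h⟩ := (hζ k).1
    · exact ⟨l k, s, abs_of_pos (lp k), by simp only [ν, h]⟩
    · exact ⟨-l k, s, by rw [abs_neg, abs_of_pos (lp k)], by simp only [ν]; rw [h]; simp⟩
  choose c s hcl hcs using hcs
  have hc0 : Tendsto c atTop (𝓝 0) := by
    rw [tendsto_zero_iff_abs_tendsto_zero]
    exact hl0.congr fun k => (hcl k).symm
  rcases A.limit_null (c := c ∘ ψ) (s := s ∘ ψ) hν' (hc0.comp hψ.tendsto_atTop)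
    (hlim.congr fun k => hcs (ψ k)) with hm | hm
  · have := A.nonpos _ hm _ hγ₂
    rw [γ₂e] at this
    simp [g1] at this
    nlinarith
  · have := A.nonpos _ hm _ hγ₁
    rw [γ₁e] at this
    simp [g1] at this
    have hrL : r < L := by nlinarith
    have h1 := mul_le_mul_of_nonneg_left (abs_le.1 g3).2 rpos.le
    have h2 := mul_nonneg hpos.le (neg_nonneg.2 g2)
    linarith

end Asymptotic

namespace Asymptotic
variable {S : MaxSurf} {G : Set (Fin 4 → ℝ)}

lemma inner_ne_zero (A : Asymptotic S G) (s : Fin 2 → ℝ) {γ : Fin 4 → ℝ} (hγ : γ ∈ G) :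
    qform (S.x s) γ ≠ 0 := by
  intro h0
  obtain ⟨u, w, H⟩ := S.exists_frame s
  have der : ∀ (δ : Fin 4 → ℝ) (v : Fin 2 → ℝ),
      HasDerivAt (fun t : ℝ => qform (S.x (s + t • v)) δ) (qform (S.dx s v) δ) 0 := by
    intro δ v
    have h1 := hasDerivAt_qform (hasDerivAt_line S.smooth_x s v 0) (hasDerivAt_const (0 : ℝ) δ)
    simpa using h1
  have cont : ∀ (δ : Fin 4 → ℝ) (v : Fin 2 → ℝ),
      Continuous fun t : ℝ => qform (S.x (s + t • v)) δ := fun δ v =>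
    continuous_qform (S.smooth_x.continuous.comp (by fun_prop)) continuous_const
  -- a function vanishing at a point with positive derivative is positive afterwards
  have pos : ∀ (δ : Fin 4 → ℝ) (v : Fin 2 → ℝ), qform (S.x s) δ = 0 → 0 < qform (S.dx s v) δ →
      ∀ᶠ t in 𝓝[>] (0 : ℝ), 0 < qform (S.x (s + t • v)) δ := by
    intro δ v hδ hv
    have h1 := hasDerivAt_iff_tendsto_slope.1 (der δ v)
    have h2 := (h1.mono_left (nhdsWithin_mono (0 : ℝ)
      (fun t (ht : 0 < t) => (ht.ne' : t ≠ 0)))).eventually (lt_mem_nhds hv)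
    filter_upwards [h2, self_mem_nhdsWithin] with t ht ht0
    have ht0 : 0 < t := ht0
    simp only [slope_def_field, zero_smul, add_zero, hδ, sub_zero] at ht
    exact (div_pos_iff_of_pos_right ht0).1 ht
  have neg : ∀ (δ : Fin 4 → ℝ) (v : Fin 2 → ℝ), qform (S.x s) δ = 0 → qform (S.dx s v) δ < 0 →
      ∀ᶠ t in 𝓝[>] (0 : ℝ), qform (S.x (s + t • v)) δ < 0 := by
    intro δ v hδ hv
    have := pos (-δ) v (by simpa using hδ) (by simpa using hv)
    simpa using this
  have expand : ∀ δ ∈ G, qform (S.x s) δ = 0 → qform (S.dx s u) δ ^ 2 + qform (S.dx s w) δ ^ 2 =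
      qform (S.n s) δ ^ 2 := by
    intro δ hδ h
    have := A.null δ hδ
    rw [H.inner, h] at this
    linarith
  by_cases hall : ∀ δ ∈ G, qform (S.x s) δ = 0
  · obtain ⟨γ₁, h₁, γ₂, h₂, hneg⟩ := A.exists_pair
    have e1 := expand _ h₁ (hall _ h₁)
    have e2 := expand _ h₂ (hall _ h₂)
    rw [H.inner, hall _ h₁, hall _ h₂] at hneg
    set a₁ := qform (S.dx s u) γ₁
    set a₂ := qform (S.dx s u) γ₂
    set b₁ := qform (S.dx s w) γ₁
    set b₂ := qform (S.dx s w) γ₂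
    set v₁ := qform (S.n s) γ₁
    set v₂ := qform (S.n s) γ₂
    have nz : ∀ δ ∈ G, qform (S.n s) δ ≠ 0 := by
      intro δ hδ h0
      have h1 := expand δ hδ (hall δ hδ)
      rw [h0] at h1
      have h2 : qform (S.dx s u) δ = 0 := by nlinarith [sq_nonneg (qform (S.dx s w) δ)]
      have h3 : qform (S.dx s w) δ = 0 := by nlinarith [sq_nonneg (qform (S.dx s u) δ)]
      exact A.ne_zero hδ (H.ext (by simp [h2]) (by simp [h3]) (by simp [hall δ hδ]) (by simp [h0]))
    have p1 : 0 < |v₁| := abs_pos.2 (nz _ h₁)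
    have p2 : 0 < |v₂| := abs_pos.2 (nz _ h₂)
    have hlt : a₁ * a₂ + b₁ * b₂ < |v₁| * |v₂| := by
      rw [← abs_mul]
      have := le_abs_self (v₁ * v₂)
      linarith
    set v : Fin 2 → ℝ := (|v₂| * a₁ - |v₁| * a₂) • u + (|v₂| * b₁ - |v₁| * b₂) • w
    have hv : ∀ δ, qform (S.dx s v) δ = (|v₂| * a₁ - |v₁| * a₂) * qform (S.dx s u) δ +
        (|v₂| * b₁ - |v₁| * b₂) * qform (S.dx s w) δ := by
      intro δ
      simp [v]
    have d1 : 0 < qform (S.dx s v) γ₁ := by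
      rw [hv]
      have : (|v₂| * a₁ - |v₁| * a₂) * a₁ + (|v₂| * b₁ - |v₁| * b₂) * b₁ =
          |v₁| * (|v₁| * |v₂| - (a₁ * a₂ + b₁ * b₂)) := by
        have := sq_abs v₁
        linear_combination |v₂| * e1 - |v₂| * this
      rw [this]
      exact mul_pos p1 (by linarith)
    have d2 : qform (S.dx s v) γ₂ < 0 := by
      rw [hv]
      have : (|v₂| * a₁ - |v₁| * a₂) * a₂ + (|v₂| * b₁ - |v₁| * b₂) * b₂ =
          -(|v₂| * (|v₁| * |v₂| - (a₁ * a₂ + b₁ * b₂))) := by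
        have := sq_abs v₂
        linear_combination -|v₁| * e2 + |v₁| * this
      rw [this]
      exact neg_lt_zero.2 (mul_pos p2 (by linarith))
    obtain ⟨t, t1, t2⟩ := ((pos _ _ (hall _ h₁) d1).and (neg _ _ (hall _ h₂) d2)).exists
    exact A.not_separated h₂ h₁ t2 t1
  · push Not at hall
    obtain ⟨δ, hδ, hne⟩ := hall
    have e := expand γ hγ h0
    obtain ⟨v, hv⟩ : ∃ v, 0 < qform (S.dx s v) γ := by
      by_contra hcon
      push Not at hcon
      have z : ∀ v, qform (S.dx s v) γ = 0 := by
        intro v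
        have h1 := hcon v
        have h2 := hcon (-v)
        simp at h2
        linarith
      rw [z, z] at e
      have : qform (S.n s) γ = 0 := by nlinarith
      exact A.ne_zero hγ (H.ext (by simp [z]) (by simp [z]) (by simp [h0]) (by simp [this]))
    rcases lt_or_gt_of_ne hne with hlt | hgt
    · have h1 : ∀ᶠ t in 𝓝[>] (0 : ℝ), qform (S.x (s + t • v)) δ < 0 :=
        nhdsWithin_le_nhds (((cont δ v).tendsto 0).eventually (gt_mem_nhds (by simpa using hlt)))
      obtain ⟨t, t1, t2⟩ := ((pos _ _ h0 hv).and h1).exists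
      exact A.not_separated hδ hγ t2 t1
    · have h1 : ∀ᶠ t in 𝓝[>] (0 : ℝ), 0 < qform (S.x (s + t • -v)) δ :=
        nhdsWithin_le_nhds (((cont δ (-v)).tendsto 0).eventually
          (lt_mem_nhds (by simpa using hgt)))
      obtain ⟨t, t1, t2⟩ := ((neg γ (-v) h0 (by simpa using hv)).and h1).exists
      exact A.not_separated hγ hδ t1 t2

end Asymptotic

/-- The family of lifts lies on the same side as the surface. -/
structure Positive (S : MaxSurf) (G : Set (Fin 4 → ℝ)) : Prop extends Asymptotic S G where
  neg_inner : ∀ s, ∀ γ ∈ G, qform (S.x s) γ < 0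

lemma Asymptotic.positive_or {S : MaxSurf} {G : Set (Fin 4 → ℝ)} (A : Asymptotic S G) :
    Positive S G ∨ Positive S {γ | -γ ∈ G} := by
  obtain ⟨γ₀, h₀, -⟩ := A.exists_pair
  have hc : Continuous fun s => qform (S.x s) γ₀ :=
    continuous_qform S.smooth_x.continuous continuous_const
  have hconst : (∀ s, qform (S.x s) γ₀ < 0) ∨ ∀ s, 0 < qform (S.x s) γ₀ := by
    by_contra hcon
    push Not at hcon
    obtain ⟨⟨s, hs⟩, s', hs'⟩ := hcon
    obtain ⟨r, hr⟩ := mem_range_of_exists_le_of_exists_ge hc ⟨s', hs'⟩ ⟨s, hs⟩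
    exact A.inner_ne_zero r h₀ hr
  rcases hconst with h | h
  · refine Or.inl ⟨A, fun s γ hγ => (A.inner_ne_zero s hγ).lt_of_le ?_⟩
    by_contra hcon
    push Not at hcon
    exact A.not_separated h₀ hγ (h s) hcon
  · refine Or.inr ⟨A.neg, fun s γ hγ => ?_⟩
    have hγ' : -γ ∈ G := hγ
    have h1 := A.inner_ne_zero s hγ'
    rw [qform_neg_right] at h1
    by_contra hcon
    refine A.not_separated hγ' h₀ ?_ (h s)
    rw [qform_neg_right]
    push Not at hcon
    exact (neg_nonpos.2 hcon).lt_of_ne h1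

namespace Positive
variable {S : MaxSurf} {G : Set (Fin 4 → ℝ)}

lemma flip (A : Positive S G) : Positive S.flip G := ⟨A.toAsymptotic.flip, A.neg_inner⟩

/-- There is a timelike vector in the interior of the dual cone. -/
lemma exists_base (A : Positive S G) : ∃ y, qform y y = -1 ∧ (∀ γ ∈ G, qform y γ < 0) ∧
    ∀ s, qform (S.x s) y < 0 := by
  obtain ⟨γ₁, h₁, γ₂, h₂, hneg⟩ := A.exists_pair
  have hp : 0 < -2 * qform γ₁ γ₂ := by linarith
  set r := Real.sqrt (-2 * qform γ₁ γ₂) with hr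
  have hr0 : 0 < r := Real.sqrt_pos.2 hp
  have hrr : r ^ 2 = -2 * qform γ₁ γ₂ := Real.sq_sqrt hp.le
  refine ⟨r⁻¹ • (γ₁ + γ₂), ?_, ?_, ?_⟩
  · simp [A.null _ h₁, A.null _ h₂, qform_comm γ₂ γ₁]
    field_simp
    linarith
  · intro γ hγ
    have := A.add_pair h₁ h₂ hγ hneg
    rw [qform_comm, qform_smul_right]
    exact mul_neg_of_pos_of_neg (inv_pos.2 hr0) this
  · intro s
    rw [qform_smul_right, qform_add_right]
    exact mul_neg_of_pos_of_neg (inv_pos.2 hr0)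
      (by linarith [A.neg_inner s _ h₁, A.neg_inner s _ h₂])

lemma isClosed_range (A : Positive S G) : IsClosed (range S.x) := by
  obtain ⟨y, -, -, hy⟩ := A.exists_base
  have : range S.x = {ζ | ∃ s, ζ = S.x s ∨ ζ = -S.x s} ∩ {ζ | qform ζ y ≤ 0} := by
    ext ζ
    constructor
    · rintro ⟨s, rfl⟩
      exact ⟨⟨s, Or.inl rfl⟩, (hy s).le⟩
    · rintro ⟨⟨s, rfl | rfl⟩, h⟩
      · exact ⟨s, rfl⟩
      · have := hy s
        simp at h
        linarith
  rw [this]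
  exact A.isClosed_cover.inter
    (isClosed_le (continuous_qform continuous_id continuous_const) continuous_const)

lemma isCompact_image_sublevel (A : Positive S G) {p : Fin 4 → ℝ} (hp : ∀ γ ∈ G, qform p γ < 0)
    (c : ℝ) : IsCompact (range S.x ∩ {z | -qform z p ≤ c}) := by
  have cq : ∀ p : Fin 4 → ℝ, Continuous fun ζ : Fin 4 → ℝ => qform ζ p := fun p =>
    continuous_qform continuous_id continuous_const
  refine Metric.isCompact_of_isClosed_isBounded
    (A.isClosed_range.inter (isClosed_le (cq p).neg continuous_const)) ?_
  by_contra hcon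
  rw [isBounded_iff_forall_norm_le] at hcon
  push Not at hcon
  choose z hz hzn using fun k : ℕ => hcon (k + 1)
  choose s hs using fun k => (hz k).1
  have npos : ∀ k, 0 < ‖z k‖ := fun k => by
    have := hzn k
    have : (0 : ℝ) ≤ k := Nat.cast_nonneg k
    linarith
  have hl0 : Tendsto (fun k => ‖z k‖⁻¹) atTop (𝓝 0) := by
    apply tendsto_inv_atTop_zero.comp
    refine tendsto_atTop_mono (fun k => ?_) tendsto_natCast_atTop_atTop
    have := hzn k
    linarith
  obtain ⟨ν, hν, ψ, hψ, hlim⟩ := (isCompact_sphere (0 : Fin 4 → ℝ) 1).tendsto_subseq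
    (x := fun k => ‖z k‖⁻¹ • z k) (fun k => by
      rw [mem_sphere_zero_iff_norm, norm_smul, norm_inv, norm_norm, inv_mul_cancel₀ (npos k).ne'])
  have hν0 : ν ≠ 0 := by rintro rfl; simp at hν
  obtain ⟨y, -, hyG, hy⟩ := A.exists_base
  have hl' := hl0.comp hψ.tendsto_atTop
  have lim := fun p => ((cq p).tendsto ν).comp hlim
  have h1 : qform ν y ≤ 0 := by
    refine le_of_tendsto' (lim y) fun k => ?_
    simp only [Function.comp, qform_smul_left]
    have h0 := hy (s (ψ k))
    rw [hs] at h0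
    exact mul_nonpos_of_nonneg_of_nonpos (inv_pos.2 (npos _)).le h0.le
  have h2 : ν ∈ G := by
    rcases A.limit_null (c := fun k => ‖z (ψ k)‖⁻¹) (s := fun k => s (ψ k)) hν0 hl'
      (hlim.congr fun k => by simp only [Function.comp, hs]) with h | h
    · exact h
    · have := hyG _ h
      rw [qform_comm] at this
      simp at this
      linarith
  have h3 : -qform ν p ≤ 0 := by
    have h4 := hl'.mul_const c
    rw [zero_mul] at h4
    refine le_of_tendsto_of_tendsto' (lim p).neg h4 fun k => ?_
    have h5 : -qform (z (ψ k)) p ≤ c := (hz (ψ k)).2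
    simp only [Function.comp, qform_smul_left]
    rw [← mul_neg]
    exact mul_le_mul_of_nonneg_left h5 (inv_pos.2 (npos _)).le
  have := hp ν h2
  rw [qform_comm] at this
  linarith

end Positive

lemma MaxSurf.inner_nonpos_of_isMax (S : MaxSurf) {p : Fin 4 → ℝ} {s : Fin 2 → ℝ}
    (h : ∀ s', qform (S.x s') p ≤ qform (S.x s) p) : qform (S.x s) p ≤ 0 := by
  obtain ⟨u, w, μ, P⟩ := S.exists_principal s
  obtain ⟨c₁, c₂, τ, d₁, d₂, k₁, k₂, J⟩ := S.exists_principalJets P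
  have h1 := (J.x₁.qform (Jet.const p)).of_isLocalMax
    (Eventually.of_forall fun t => by simpa only [J.start₁] using h (c₁ t))
  have h2 := (J.x₂.qform (Jet.const p)).of_isLocalMax
    (Eventually.of_forall fun t => by simpa only [J.start₂] using h (c₂ t))
  have h3 := h1.2
  have h4 := h2.2
  simp at h3 h4
  linarith

namespace Positive
variable {S : MaxSurf} {G : Set (Fin 4 → ℝ)}

/-- The surface is contained in the bidual cone of the boundary curve. -/
lemma inner_nonpos (A : Positive S G) {p : Fin 4 → ℝ} (hp : ∀ γ ∈ G, qform p γ ≤ 0)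
    (s : Fin 2 → ℝ) : qform (S.x s) p ≤ 0 := by
  by_contra hcon
  push Not at hcon
  obtain ⟨y, -, hyG, hy⟩ := A.exists_base
  obtain ⟨δ, hδ0, hδ⟩ : ∃ δ : ℝ, 0 < δ ∧ 0 < qform (S.x s) (p + δ • y) := by
    refine ⟨qform (S.x s) p / (2 * -qform (S.x s) y), ?_, ?_⟩
    · have := hy s
      exact div_pos hcon (by linarith)
    · simp
      have := hy s
      have h2 : qform (S.x s) p / (2 * qform (S.x s) y) * qform (S.x s) y = qform (S.x s) p / 2 := by
        field_simp [this.ne]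
      rw [div_neg, neg_mul, h2]
      linarith
  set p' := p + δ • y
  have hp' : ∀ γ ∈ G, qform p' γ < 0 := by
    intro γ hγ
    simp only [p', qform_add_left, qform_smul_left]
    have := mul_neg_of_pos_of_neg hδ0 (hyG γ hγ)
    linarith [hp γ hγ]
  obtain ⟨z, ⟨⟨s', rfl⟩, hz⟩, hmin⟩ := (A.isCompact_image_sublevel hp' 0).exists_isMinOn
    (f := fun z => -qform z p') ⟨S.x s, ⟨s, rfl⟩, by simpa using hδ.le⟩
    (continuous_qform continuous_id continuous_const).neg.continuousOn
  have hle : -qform (S.x s') p' ≤ -qform (S.x s) p' := hmin ⟨⟨s, rfl⟩, by simpa using hδ.le⟩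
  have := S.inner_nonpos_of_isMax (p := p') (s := s') (by
    intro t
    by_cases ht : -qform (S.x t) p' ≤ 0
    · have : -qform (S.x s') p' ≤ -qform (S.x t) p' := hmin ⟨⟨t, rfl⟩, ht⟩
      linarith
    · have : -qform (S.x s') p' ≤ 0 := hz
      linarith)
  linarith

end Positive

/-- A real `2 × 2` matrix can be multiplied by an orthogonal matrix so that its trace is the sum of
its singular values. -/
lemma exists_rotation {a b c d : ℝ} (h : 4 ≤ a ^ 2 + b ^ 2 + c ^ 2 + d ^ 2 + 2 * |a * d - b * c|) :
    ∃ α β ε : ℝ, α ^ 2 + β ^ 2 = 1 ∧ ε ^ 2 = 1 ∧ 2 ≤ α * a + β * b + ε * (-β * c + α * d) := by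
  obtain ⟨ε, hε, he⟩ : ∃ ε : ℝ, ε ^ 2 = 1 ∧ |a * d - b * c| = ε * (a * d - b * c) := by
    rcases abs_choice (a * d - b * c) with h | h
    · exact ⟨1, by norm_num, by rw [h, one_mul]⟩
    · exact ⟨-1, by norm_num, by rw [h]; ring⟩
  set P := a + ε * d
  set Q := b - ε * c
  have hPQ : 4 ≤ P ^ 2 + Q ^ 2 := by
    have : P ^ 2 + Q ^ 2 = a ^ 2 + b ^ 2 + c ^ 2 + d ^ 2 + 2 * |a * d - b * c| := by
      simp only [P, Q]
      rw [he]
      linear_combination (c ^ 2 + d ^ 2) * hε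
    linarith
  set r := Real.sqrt (P ^ 2 + Q ^ 2) with hr
  have hr2 : r ^ 2 = P ^ 2 + Q ^ 2 := Real.sq_sqrt (by positivity)
  have hr' : 2 ≤ r := Real.le_sqrt_of_sq_le (by linarith)
  have hr0 : 0 < r := by linarith
  refine ⟨P / r, Q / r, ε, ?_, hε, ?_⟩
  · field_simp
    linarith
  · have : P / r * a + Q / r * b + ε * (-(Q / r) * c + P / r * d) = r := by
      field_simp
      rw [hr2]
      simp only [P, Q]
      ring
    linarith

namespace MaxSurf
variable (S : MaxSurf)

/-- Orthonormal bases of two tangent planes can be chosen so that the sum of the products of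
corresponding vectors is at least `2`. -/
lemma exists_adapted_bases (s s' : Fin 2 → ℝ) : ∃ u w u' w',
    Frame (S.dx s u) (S.dx s w) (S.x s) (S.n s) ∧
    Frame (S.dx s' u') (S.dx s' w') (S.x s') (S.n s') ∧
    2 ≤ qform (S.dx s u) (S.dx s' u') + qform (S.dx s w) (S.dx s' w') := by
  obtain ⟨u, w, H⟩ := S.exists_frame s
  obtain ⟨u', w', H'⟩ := S.exists_frame s'
  have h1 := H.inner (S.dx s' u') (S.dx s' u')
  have h2 := H.inner (S.dx s' w') (S.dx s' w')
  have h3 := H.inner (S.dx s' u') (S.dx s' w')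
  rw [H'.aa] at h1
  rw [H'.bb] at h2
  rw [H'.ab] at h3
  set a := qform (S.dx s u) (S.dx s' u')
  set b := qform (S.dx s u) (S.dx s' w')
  set c := qform (S.dx s w) (S.dx s' u')
  set d := qform (S.dx s w) (S.dx s' w')
  set r₁ := qform (S.x s) (S.dx s' u')
  set r₂ := qform (S.x s) (S.dx s' w')
  set t₁ := qform (S.n s) (S.dx s' u')
  set t₂ := qform (S.n s) (S.dx s' w')
  have hdet : 1 ≤ (a * d - b * c) ^ 2 := by
    have e1 : a ^ 2 + c ^ 2 = 1 + r₁ ^ 2 + t₁ ^ 2 := by linarith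
    have e2 : b ^ 2 + d ^ 2 = 1 + r₂ ^ 2 + t₂ ^ 2 := by linarith
    have e3 : a * b + c * d = r₁ * r₂ + t₁ * t₂ := by linarith
    have : (a * d - b * c) ^ 2 = (a ^ 2 + c ^ 2) * (b ^ 2 + d ^ 2) - (a * b + c * d) ^ 2 := by ring
    rw [this, e1, e2, e3]
    nlinarith [sq_nonneg (r₁ * t₂ - r₂ * t₁), sq_nonneg r₁, sq_nonneg r₂, sq_nonneg t₁,
      sq_nonneg t₂]
  have habs : 1 ≤ |a * d - b * c| := by
    rw [← one_le_sq_iff_one_le_abs]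
    exact hdet
  obtain ⟨α, β, ε, hαβ, hε, hle⟩ := exists_rotation (a := a) (b := b) (c := c) (d := d)
    (by nlinarith [sq_nonneg r₁, sq_nonneg r₂, sq_nonneg t₁, sq_nonneg t₂])
  refine ⟨u, w, α • u' + β • w', ε • (-β • u' + α • w'), H, ?_, ?_⟩
  · constructor <;>
      simp only [map_add, map_smul, qform_add_left, qform_add_right, qform_smul_left,
        qform_smul_right, H'.aa, H'.bb, H'.cc, H'.dd, H'.ab, H'.ac, H'.ad, H'.bc, H'.bd, H'.cd,
        H'.ba] <;> first | ring1 | linear_combination hαβ | linear_combination (α ^ 2 + β ^ 2) * hε + hαβ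
  · simp only [map_add, map_smul, qform_add_right, qform_smul_right]
    linarith

lemma trace_frame {s u w : Fin 2 → ℝ} (H : Frame (S.dx s u) (S.dx s w) (S.x s) (S.n s)) :
    qform (S.dn s u) (S.dx s u) + qform (S.dn s w) (S.dx s w) = 0 := by
  have := S.trace_identity s u w
  rw [H.aa, H.bb, H.ab] at this
  linarith

end MaxSurf

namespace Positive
variable {S : MaxSurf} {G : Set (Fin 4 → ℝ)}

/-- Distinct points of the surface are not timelike related. -/
lemma inner_le_neg_one (A : Positive S G) (s s' : Fin 2 → ℝ) : qform (S.x s) (S.x s') ≤ -1 := by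
  by_contra hcon
  push Not at hcon
  obtain ⟨y, -, hyG, hy⟩ := A.exists_base
  have nonpos : ∀ r r', qform (S.x r) (S.x r') ≤ 0 := fun r r' =>
    A.inner_nonpos (fun γ hγ => (A.neg_inner r' γ hγ).le) r
  obtain ⟨ρ, hρ0, hρ⟩ : ∃ ρ : ℝ, 0 < ρ ∧
      -qform (S.x s) (S.x s') + ρ * (-qform (S.x s) y + -qform (S.x s') y) < 1 := by
    have h1 := hy s
    have h2 := hy s'
    have h3 : 0 < -qform (S.x s) y + -qform (S.x s') y := by linarith
    refine ⟨(1 + qform (S.x s) (S.x s')) / (2 * (-qform (S.x s) y + -qform (S.x s') y)),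
      div_pos (by linarith) (by linarith), ?_⟩
    have : (1 + qform (S.x s) (S.x s')) / (2 * (-qform (S.x s) y + -qform (S.x s') y)) *
        (-qform (S.x s) y + -qform (S.x s') y) = (1 + qform (S.x s) (S.x s')) / 2 := by
      field_simp
    rw [this]
    linarith
  set F : (Fin 4 → ℝ) × (Fin 4 → ℝ) → ℝ := fun z =>
    -qform z.1 z.2 + ρ * (-qform z.1 y + -qform z.2 y) with hF
  have hFc : Continuous F := by
    have a1 : Continuous fun z : (Fin 4 → ℝ) × (Fin 4 → ℝ) => qform z.1 z.2 :=
      continuous_qform continuous_fst continuous_snd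
    have a2 : Continuous fun z : (Fin 4 → ℝ) × (Fin 4 → ℝ) => qform z.1 y :=
      continuous_qform continuous_fst continuous_const
    have a3 : Continuous fun z : (Fin 4 → ℝ) × (Fin 4 → ℝ) => qform z.2 y :=
      continuous_qform continuous_snd continuous_const
    exact a1.neg.add (continuous_const.mul (a2.neg.add a3.neg))
  have hK := A.isCompact_image_sublevel hyG (1 / ρ)
  have sub : ∀ r r', F (S.x r, S.x r') ≤ 1 → (S.x r, S.x r') ∈
      (range S.x ∩ {z | -qform z y ≤ 1 / ρ}) ×ˢ (range S.x ∩ {z | -qform z y ≤ 1 / ρ}) := by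
    intro r r' h
    have h1 := nonpos r r'
    have h2 := hy r
    have h3 := hy r'
    simp only [hF] at h
    have h4 : (-qform (S.x r) y + -qform (S.x r') y) ≤ 1 / ρ := by
      rw [le_div_iff₀ hρ0]; linarith
    refine ⟨⟨⟨r, rfl⟩, ?_⟩, ⟨⟨r', rfl⟩, ?_⟩⟩ <;> simp only [mem_ofPred_eq] <;> linarith
  obtain ⟨z, ⟨⟨⟨r, hr⟩, -⟩, ⟨⟨r', hr'⟩, -⟩⟩, hmin⟩ := (hK.prod hK).exists_isMinOn
    ⟨_, sub s s' hρ.le⟩ hFc.continuousOn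
  have hz : z = (S.x r, S.x r') := by rw [hr, hr']
  have hlt : F (S.x r, S.x r') < 1 := by
    rw [← hz]
    exact lt_of_le_of_lt (hmin (sub s s' hρ.le)) hρ
  have glob : ∀ t t', F (S.x r, S.x r') ≤ F (S.x t, S.x t') := by
    intro t t'
    by_cases ht : F (S.x t, S.x t') ≤ 1
    · rw [← hz]; exact hmin (sub t t' ht)
    · linarith
  obtain ⟨u, w, u', w', H, H', hsum⟩ := S.exists_adapted_bases r r'
  obtain ⟨c₁, -, h₁, J₁⟩ := S.exists_curve H.aa
  obtain ⟨c₂, -, h₂, J₂⟩ := S.exists_curve H.bb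
  obtain ⟨c₁', -, h₁', J₁'⟩ := S.exists_curve H'.aa
  obtain ⟨c₂', -, h₂', J₂'⟩ := S.exists_curve H'.bb
  have m₁ := ((J₁.qform J₁').neg.add (((J₁.qform (Jet.const y)).neg.add
    (J₁'.qform (Jet.const y)).neg).const_mul ρ)).of_isLocalMin
    (Eventually.of_forall fun t => by
      have := glob (c₁ t) (c₁' t)
      simpa only [hF, h₁, h₁'] using this)
  have m₂ := ((J₂.qform J₂').neg.add (((J₂.qform (Jet.const y)).neg.add
    (J₂'.qform (Jet.const y)).neg).const_mul ρ)).of_isLocalMin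
    (Eventually.of_forall fun t => by
      have := glob (c₂ t) (c₂' t)
      simpa only [hF, h₂, h₂'] using this)
  have n₁ := m₁.2
  have n₂ := m₂.2
  have tr := S.trace_frame H
  have tr' := S.trace_frame H'
  have e : qform (S.dn r w) (S.dx r w) = -qform (S.dn r u) (S.dx r u) := by linarith
  have e' : qform (S.dn r' w') (S.dx r' w') = -qform (S.dn r' u') (S.dx r' u') := by linarith
  rw [e, e'] at n₂
  simp at n₁ n₂
  simp only [hF] at hlt
  have h5 := mul_pos hρ0 (neg_pos.2 (hy r))
  have h6 := mul_pos hρ0 (neg_pos.2 (hy r'))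
  linarith

/-- The surface is properly embedded. -/
lemma isCompact_sublevel (A : Positive S G) {p : Fin 4 → ℝ} (hp : ∀ γ ∈ G, qform p γ < 0) (c : ℝ) :
    IsCompact {s | -qform (S.x s) p ≤ c} := by
  apply IsSeqCompact.isCompact
  intro s hs
  obtain ⟨z, ⟨⟨r, rfl⟩, hz⟩, ψ, hψ, hlim⟩ := (A.isCompact_image_sublevel hp c).tendsto_subseq
    (x := fun k => S.x (s k)) (fun k => ⟨⟨s k, rfl⟩, hs k⟩)
  refine ⟨r, hz, ψ, hψ, ?_⟩
  let Y : (Fin 2 → ℝ) → (Fin 2 → ℝ) := fun y => ![S.x y 0, S.x y 1]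
  have hx := contDiff_pi.1 S.smooth_x
  have hY : ContDiff ℝ (⊤ : ℕ∞) Y := by
    rw [contDiff_pi]
    intro i
    fin_cases i
    · exact hx 0
    · exact hx 1
  have hd : ∀ v, fderiv ℝ Y r v = ![S.dx r v 0, S.dx r v 1] := by
    intro v
    have h1 := hasDerivAt_line hY r v 0
    have h2 := hasDerivAt_pi.1 (hasDerivAt_line S.smooth_x r v 0)
    simp only [zero_smul, add_zero] at h1 h2
    refine h1.unique ?_
    rw [hasDerivAt_pi]
    intro i
    fin_cases i
    · exact h2 0
    · exact h2 1
  have hinj : Function.Injective (fderiv ℝ Y r) := by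
    rw [injective_iff_map_eq_zero]
    intro v hv
    rw [hd] at hv
    by_contra hne
    have h0 : S.dx r v 0 = 0 := congrFun hv 0
    have h1 : S.dx r v 1 = 0 := congrFun hv 1
    have := S.spacelike r v hne
    change 0 < qform (S.dx r v) (S.dx r v) at this
    unfold qform at this
    rw [h0, h1] at this
    nlinarith [mul_self_nonneg (S.dx r v 2), mul_self_nonneg (S.dx r v 3)]
  have Yinj : Function.Injective Y := by
    intro a b hab
    have h0 : S.x a 0 = S.x b 0 := congrFun hab 0
    have h1 : S.x a 1 = S.x b 1 := congrFun hab 1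
    apply S.inj
    have h2 := A.inner_le_neg_one a b
    have h3 := S.quad a
    have h4 := S.quad b
    unfold qform at h2 h3 h4
    rw [h0, h1] at h2 h3
    have h5 : (S.x a 2 - S.x b 2) ^ 2 + (S.x a 3 - S.x b 3) ^ 2 ≤ 0 := by nlinarith
    have h6 : S.x a 2 - S.x b 2 = 0 := by
      nlinarith [sq_nonneg (S.x a 2 - S.x b 2), sq_nonneg (S.x a 3 - S.x b 3)]
    have h7 : S.x a 3 - S.x b 3 = 0 := by
      nlinarith [sq_nonneg (S.x a 2 - S.x b 2), sq_nonneg (S.x a 3 - S.x b 3)]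
    ext i
    fin_cases i
    · exact h0
    · exact h1
    · exact sub_eq_zero.1 h6
    · exact sub_eq_zero.1 h7
  obtain ⟨σ, hσ, hσr, hσY, -⟩ := exists_smooth_local_inverse hY hinj
  have limY : Tendsto (fun k => Y (s (ψ k))) atTop (𝓝 (Y r)) := by
    have h := tendsto_pi_nhds.1 hlim
    rw [tendsto_pi_nhds]
    intro i
    fin_cases i
    · exact h 0
    · exact h 1
  have h1 := (hσ.continuous.tendsto (Y r)).comp limY
  rw [hσr] at h1
  refine h1.congr' ?_
  filter_upwards [limY.eventually hσY] with k hk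
  exact Yinj hk

end Positive

lemma eventually_lt_of_hasDerivAt_pos {f : ℝ → ℝ} {f' : ℝ} (h : HasDerivAt f f' 0) (hf : 0 < f') :
    ∀ᶠ t in 𝓝[>] (0 : ℝ), f 0 < f t := by
  have h1 := (hasDerivAt_iff_tendsto_slope.1 h).eventually (lt_mem_nhds hf)
  have h2 : 𝓝[>] (0 : ℝ) ≤ 𝓝[≠] 0 := nhdsWithin_mono _ fun t ht => ne_of_gt ht
  filter_upwards [h2 h1, self_mem_nhdsWithin] with t ht ht0
  have ht0 : 0 < t := ht0
  rw [slope_def_field, sub_zero, div_pos_iff_of_pos_right ht0] at ht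
  linarith

namespace MaxSurf
variable (S : MaxSurf)

/-- The derivatives of `⟨x, p⟩` and `⟨N, p⟩` in the direction of the tangential part of `p`. -/
lemma hasDerivAt_gradient (s : Fin 2 → ℝ) (p : Fin 4 → ℝ) : ∃ (u : Fin 2 → ℝ) (D E : ℝ),
    HasDerivAt (fun t : ℝ => qform (S.x (s + t • u)) p) D 0 ∧
    HasDerivAt (fun t : ℝ => qform (S.n (s + t • u)) p) E 0 ∧
    D = qform p p + qform (S.x s) p ^ 2 + qform (S.n s) p ^ 2 ∧ 0 ≤ D ∧
    -(Real.sqrt (S.ell s) * D) ≤ E ∧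
    ∀ y : Fin 4 → ℝ, ∃ D',
      HasDerivAt (fun t : ℝ => qform (S.x (s + t • u)) y) D' 0 ∧
      D' ^ 2 ≤ D * (qform y y + qform (S.x s) y ^ 2 + qform (S.n s) y ^ 2) := by
  obtain ⟨u, w, μ, P⟩ := S.exists_principal s
  have hμ : Real.sqrt (S.ell s) = μ := by rw [← P.sq]; exact Real.sqrt_sq P.nonneg
  set a := qform (S.dx s u) p
  set b := qform (S.dx s w) p
  have hx : ∀ y : Fin 4 → ℝ, HasDerivAt (fun t : ℝ => qform (S.x (s + t • (a • u + b • w))) y)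
      (a * qform (S.dx s u) y + b * qform (S.dx s w) y) 0 := by
    intro y
    have h := hasDerivAt_qform (hasDerivAt_line S.smooth_x s (a • u + b • w) 0)
      (hasDerivAt_const (0 : ℝ) y)
    refine h.congr_deriv ?_
    simp
  have hn : HasDerivAt (fun t : ℝ => qform (S.n (s + t • (a • u + b • w))) p)
      (μ * (a ^ 2 - b ^ 2)) 0 := by
    have h := hasDerivAt_qform (hasDerivAt_line S.smooth_n s (a • u + b • w) 0)
      (hasDerivAt_const (0 : ℝ) p)
    refine h.congr_deriv ?_
    have h1 := P.dn_u
    have h2 := P.dn_w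
    simp [h1, h2]
    ring
  have hp := P.frame.inner p p
  refine ⟨a • u + b • w, _, _, hx p, hn, ?_, ?_, ?_, fun y => ⟨_, hx y, ?_⟩⟩
  · change a * a + b * b = _
    linarith
  · exact add_nonneg (mul_self_nonneg a) (mul_self_nonneg b)
  · rw [hμ]
    change -(μ * (a * a + b * b)) ≤ _
    nlinarith [mul_nonneg P.nonneg (sq_nonneg a)]
  · have hy := P.frame.inner y y
    change (a * _ + b * _) ^ 2 ≤ (a * a + b * b) * _
    nlinarith [sq_nonneg (a * qform (S.dx s w) y - b * qform (S.dx s u) y)]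

end MaxSurf

namespace Positive
variable {S : MaxSurf} {G : Set (Fin 4 → ℝ)}

/-- The function `⟨x, p⟩` attains its maximum. -/
lemma exists_max (A : Positive S G) {p : Fin 4 → ℝ} (hp : ∀ γ ∈ G, qform p γ < 0) :
    ∃ s, ∀ s', qform (S.x s') p ≤ qform (S.x s) p := by
  have hc : Continuous fun s => qform (S.x s) p :=
    continuous_qform S.smooth_x.continuous continuous_const
  obtain ⟨s, hs, hmax⟩ := (A.isCompact_sublevel hp (-qform (S.x 0) p)).exists_isMaxOn
    ⟨0, le_refl (-qform (S.x 0) p)⟩ hc.continuousOn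
  refine ⟨s, fun s' => ?_⟩
  by_cases h : -qform (S.x s') p ≤ -qform (S.x 0) p
  · exact hmax h
  · have := isMaxOn_iff.1 hmax 0 (le_refl (-qform (S.x 0) p))
    linarith

lemma tangent_zero_of_max {p : Fin 4 → ℝ} {s : Fin 2 → ℝ}
    (h : ∀ s', qform (S.x s') p ≤ qform (S.x s) p) (v : Fin 2 → ℝ) : qform (S.dx s v) p = 0 := by
  have hd := hasDerivAt_qform (hasDerivAt_line S.smooth_x s v 0) (hasDerivAt_const (0 : ℝ) p)
  have hm : IsLocalMax (fun t : ℝ => qform (S.x (s + t • v)) p) 0 :=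
    Eventually.of_forall fun t => by simpa using h (s + t • v)
  have := hm.hasDerivAt_eq_zero hd
  simpa using this

/-- A timelike vector in the interior of the dual cone makes a bounded angle with the normals. -/
lemma exists_normal_bound (A : Positive S G) {Λ : ℝ} (hΛ : ∀ s, Real.sqrt (S.ell s) ≤ Λ)
    {y : Fin 4 → ℝ} (hy : qform y y = -1) (hyG : ∀ γ ∈ G, qform y γ < 0)
    (hyx : ∀ s, qform (S.x s) y < 0) :
    ∃ Q, 0 ≤ Q ∧ ∀ s, qform (S.n s) y ≤ Q * -qform (S.x s) y := by
  obtain ⟨s₀, hs₀⟩ := A.exists_max hyG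
  have cx : Continuous fun s => qform (S.x s) y :=
    continuous_qform S.smooth_x.continuous continuous_const
  have cn : Continuous fun s => qform (S.n s) y :=
    continuous_qform S.smooth_n.continuous continuous_const
  set m := -qform (S.x s₀) y
  have hm : 0 < m := neg_pos.2 (hyx s₀)
  have hmle : ∀ s, m ≤ -qform (S.x s) y := fun s => neg_le_neg (hs₀ s)
  have hΛ0 : 0 ≤ Λ := (Real.sqrt_nonneg _).trans (hΛ 0)
  refine ⟨Λ + 1 / m, by positivity, fun s => ?_⟩
  have key : qform (S.n s) y / -qform (S.x s) y ≤ Λ + 1 / m := by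
    have hcont : Continuous fun s => qform (S.n s) y / -qform (S.x s) y :=
      cn.div cx.neg fun s => (neg_pos.2 (hyx s)).ne'
    obtain ⟨r, hr, hmax⟩ := (A.isCompact_sublevel hyG (-qform (S.x s) y)).exists_isMaxOn
      ⟨s, le_refl (-qform (S.x s) y)⟩ hcont.continuousOn
    refine (hmax (le_refl (-qform (S.x s) y))).trans ?_
    by_contra hcon
    simp only [not_le] at hcon
    set q := qform (S.n r) y / -qform (S.x r) y with hq
    have hh : 0 < -qform (S.x r) y := neg_pos.2 (hyx r)
    have hv : qform (S.n r) y = q * -qform (S.x r) y := by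
      rw [hq, div_mul_cancel₀ _ hh.ne']
    obtain ⟨u, D, E, dD, dE, hD, hD0, hE, -⟩ := S.hasDerivAt_gradient r y
    rcases hD0.eq_or_lt with h0 | hpos
    · rw [← h0, hy] at hD
      have h1 : qform (S.n r) y ≤ 1 := by nlinarith [sq_nonneg (qform (S.x r) y)]
      have h2 : q ≤ 1 / m := by
        rw [hq, div_le_div_iff₀ hh hm]
        have := hmle r
        by_cases h3 : 0 ≤ qform (S.n r) y
        · nlinarith
        · nlinarith
      linarith
    · have d1 : HasDerivAt (fun t : ℝ => qform (S.n (r + t • u)) y / -qform (S.x (r + t • u)) y)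
          ((E * -qform (S.x r) y - qform (S.n r) y * -D) / (-qform (S.x r) y) ^ 2) 0 := by
        have := dE.div dD.neg (by simpa using hh.ne')
        simp only [zero_smul, add_zero, Pi.neg_apply] at this
        exact this
      have e1 := eventually_lt_of_hasDerivAt_pos d1 (by
        apply div_pos _ (by positivity)
        rw [hv]
        have h1 := hΛ r
        have h2 : 0 < 1 / m := by positivity
        have h3 : 0 < E + q * D := by nlinarith
        nlinarith [mul_pos h3 hh])
      have e2 := eventually_lt_of_hasDerivAt_pos dD hpos
      obtain ⟨t, h1, h2⟩ := (e1.and e2).exists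
      simp only [zero_smul, add_zero] at h1 h2
      have h3 := isMaxOn_iff.1 hmax (r + t • u) (by
        have : -qform (S.x r) y ≤ -qform (S.x s) y := hr
        change -qform (S.x (r + t • u)) y ≤ -qform (S.x s) y
        linarith)
      linarith
  rwa [div_le_iff₀ (neg_pos.2 (hyx s))] at key

set_option maxHeartbeats 2000000 in
/-- The ratio `⟨N, γ⟩ / ⟨x, γ⟩` is bounded by the principal curvatures, for `γ` at infinity. -/
lemma normal_le_null (A : Positive S G) {Λ : ℝ} (hΛ : ∀ s, Real.sqrt (S.ell s) ≤ Λ)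
    {γ : Fin 4 → ℝ} (hγ : γ ∈ G) (s : Fin 2 → ℝ) :
    qform (S.n s) γ ≤ Λ * -qform (S.x s) γ := by
  obtain ⟨y, hy, hyG, hyx⟩ := A.exists_base
  obtain ⟨Q₁, hQ₁, hQ₁'⟩ := A.exists_normal_bound hΛ hy hyG hyx
  obtain ⟨Q₂, hQ₂, hQ₂'⟩ := A.flip.exists_normal_bound (S := S.flip) (Λ := Λ)
    (fun s => by rw [S.ell_flip]; exact hΛ s) hy hyG hyx
  have hQ₂'' : ∀ s, -qform (S.n s) y ≤ Q₂ * -qform (S.x s) y := by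
    intro s
    have : qform (-S.n s) y ≤ Q₂ * -qform (S.x s) y := hQ₂' s
    simpa using this
  set C := 1 + Q₁ + Q₂ with hC
  have hC0 : 1 ≤ C := by linarith
  have hCn : ∀ s, qform (S.x s) y ^ 2 + qform (S.n s) y ^ 2 ≤ (C * -qform (S.x s) y) ^ 2 := by
    intro s
    have h0 : 0 < -qform (S.x s) y := neg_pos.2 (hyx s)
    have h1 := hQ₁' s
    have h2 := hQ₂'' s
    have h3 : |qform (S.n s) y| ≤ (Q₁ + Q₂) * -qform (S.x s) y := by
      rw [abs_le]
      constructor <;> nlinarith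
    have h4 : qform (S.n s) y ^ 2 ≤ ((Q₁ + Q₂) * -qform (S.x s) y) ^ 2 := by
      rw [← sq_abs (qform (S.n s) y)]
      exact pow_le_pow_left₀ (abs_nonneg _) h3 2
    have h5 : C ^ 2 = 1 + (Q₁ + Q₂) ^ 2 + 2 * (Q₁ + Q₂) := by rw [hC]; ring
    rw [mul_pow] at h4 ⊢
    rw [h5]
    have h6 : 0 ≤ 2 * (Q₁ + Q₂) * (-qform (S.x s) y) ^ 2 := by positivity
    nlinarith
  by_contra hcon
  push Not at hcon
  have hΛ0 : 0 ≤ Λ := (Real.sqrt_nonneg _).trans (hΛ 0)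
  have hh : ∀ s, 0 < -qform (S.x s) γ := fun s => neg_pos.2 (A.neg_inner s γ hγ)
  set q : (Fin 2 → ℝ) → ℝ := fun s => qform (S.n s) γ / -qform (S.x s) γ with hq
  have hv : ∀ s, qform (S.n s) γ = q s * -qform (S.x s) γ := fun s => by
    simp only [hq]; rw [div_mul_cancel₀ _ (hh s).ne']
  have hqs : Λ < q s := by
    simp only [hq]; rwa [lt_div_iff₀ (hh s)]
  set q₂ := (q s + Λ) / 2 with hq₂
  have hq₂Λ : Λ < q₂ := by linarith
  set κ := (q₂ - Λ) / (1 + q₂) with hκ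
  have hκ0 : 0 < κ := div_pos (by linarith) (by linarith)
  obtain ⟨s₀, hs₀⟩ := A.exists_max hyG
  set m := -qform (S.x s₀) y
  have hm : 0 < m := neg_pos.2 (hyx s₀)
  have hmle : ∀ s, m ≤ -qform (S.x s) y := fun s => neg_le_neg (hs₀ s)
  set ell : (Fin 2 → ℝ) → ℝ := fun s => Real.log (-qform (S.x s) y) with hell
  have hellm : ∀ r, Real.log m ≤ ell r := fun r => Real.log_le_log hm (hmle r)
  have hgap : 0 < Real.arctan (q s) - Real.arctan q₂ :=
    sub_pos.2 (Real.arctan_strictMono (by linarith))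
  obtain ⟨η, hη, hη₁, hη₂⟩ : ∃ η : ℝ, 0 < η ∧ η * C < κ ∧
      η * (ell s - Real.log m) < Real.arctan (q s) - Real.arctan q₂ := by
    set g := Real.arctan (q s) - Real.arctan q₂
    have e0 : 0 ≤ ell s - Real.log m := sub_nonneg.2 (hellm s)
    have hC1 : 0 < C := by linarith
    refine ⟨min (κ / (2 * C)) (g / (ell s - Real.log m + 1)), lt_min (by positivity) (by positivity),
      ?_, ?_⟩
    · calc _ ≤ κ / (2 * C) * C := by gcongr; exact min_le_left _ _
        _ = κ / 2 := by field_simp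
        _ < κ := by linarith
    · calc _ ≤ g / (ell s - Real.log m + 1) * (ell s - Real.log m) := by
            gcongr; exact min_le_right _ _
        _ < g := by
          rw [div_mul_eq_mul_div, div_lt_iff₀ (by linarith)]
          nlinarith
  set Φ : (Fin 2 → ℝ) → ℝ := fun r => Real.arctan (q r) - η * ell r with hΦ
  have cq : Continuous q := by
    have c1 : Continuous fun s => qform (S.x s) γ :=
      continuous_qform S.smooth_x.continuous continuous_const
    have c2 : Continuous fun s => qform (S.n s) γ :=
      continuous_qform S.smooth_n.continuous continuous_const
    exact c2.div c1.neg fun s => (hh s).ne'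
  have cell : Continuous ell := by
    have c1 : Continuous fun s => qform (S.x s) y :=
      continuous_qform S.smooth_x.continuous continuous_const
    exact c1.neg.log fun s => (neg_pos.2 (hyx s)).ne'
  have cΦ : Continuous Φ := (Real.continuous_arctan.comp cq).sub (continuous_const.mul cell)
  have sub : ∀ r, Φ s ≤ Φ r → -qform (S.x r) y ≤ Real.exp ((π - Φ s) / η) := by
    intro r hr
    have h1 := Real.arctan_lt_pi_div_two (q r)
    have h2 : ell r ≤ (π - Φ s) / η := by
      rw [le_div_iff₀ hη]
      have : Φ r = Real.arctan (q r) - η * ell r := rfl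
      linarith [Real.pi_pos]
    rw [← Real.exp_log (neg_pos.2 (hyx r))]
    exact Real.exp_le_exp.2 h2
  obtain ⟨r, -, hr⟩ := (A.isCompact_sublevel hyG (Real.exp ((π - Φ s) / η))).exists_isMaxOn
    ⟨s, sub s le_rfl⟩ cΦ.continuousOn
  have hmax : ∀ r', Φ r' ≤ Φ r := by
    intro r'
    by_cases h : Φ s ≤ Φ r'
    · exact hr (sub r' h)
    · have := isMaxOn_iff.1 hr s (sub s le_rfl)
      linarith
  have hqr : q₂ < q r := by
    apply Real.arctan_strictMono.lt_iff_lt.1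
    have h1 := hmax s
    simp only [hΦ] at h1
    have h2 := mul_le_mul_of_nonneg_left (hellm r) hη.le
    linarith
  obtain ⟨u, D, E, dD, dE, hD, hD0, hE, hDy⟩ := S.hasDerivAt_gradient r γ
  obtain ⟨D', dD', hD'⟩ := hDy y
  have dq := dE.div dD.neg (by simpa using (hh r).ne')
  have dl := (dD'.neg).log (by simpa using (hyx r).ne)
  have dΦ := dq.arctan.sub (dl.const_mul η)
  have hz := IsLocalMax.hasDerivAt_eq_zero (f := fun t : ℝ => Φ (r + t • u))
    (Eventually.of_forall fun t => by simpa only [zero_smul, add_zero] using hmax (r + t • u)) dΦ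
  simp only [zero_smul, add_zero, Pi.div_apply, Pi.neg_apply] at hz
  set h := -qform (S.x r) γ with hh'
  have h0 : 0 < h := hh r
  have hDh : D = (1 + q r ^ 2) * h ^ 2 := by
    rw [hD, A.null γ hγ, hv r]; ring
  have hvr : qform (S.n r) γ = q r * h := hv r
  rw [hvr, mul_div_cancel_right₀ _ h0.ne'] at hz
  set k := -qform (S.x r) y
  have hk : 0 < k := neg_pos.2 (hyx r)
  have hq0 : 0 ≤ q r := by linarith
  have low : (q r - Λ) * h ≤ 1 / (1 + q r ^ 2) * ((E * h - q r * h * -D) / h ^ 2) := by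
    have e1 : (q r - Λ) * D ≤ E + q r * D := by nlinarith [hΛ r]
    rw [hDh] at e1 ⊢
    rw [div_mul_div_comm, le_div_iff₀ (by positivity)]
    have e2 := mul_le_mul_of_nonneg_right e1 h0.le
    linarith
  have up : |D'| ≤ h * (1 + q r) * (C * k) := by
    apply abs_le_of_sq_le_sq _ (by positivity)
    have e1 : qform y y + qform (S.x r) y ^ 2 + qform (S.n r) y ^ 2 ≤ (C * k) ^ 2 := by
      have := hCn r
      linarith
    have e2 : D ≤ (h * (1 + q r)) ^ 2 := by
      rw [hDh]
      nlinarith [mul_nonneg hq0 (sq_nonneg h)]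
    calc D' ^ 2 ≤ _ := hD'
      _ ≤ D * (C * k) ^ 2 := by gcongr
      _ ≤ (h * (1 + q r)) ^ 2 * (C * k) ^ 2 := by gcongr
      _ = _ := by ring
  have up' : -D' / k ≤ h * (1 + q r) * C := by
    rw [div_le_iff₀ hk]
    have := neg_abs_le D'
    linarith
  have e3 : (q r - Λ) * h ≤ η * (h * (1 + q r) * C) := by
    have := mul_le_mul_of_nonneg_left up' hη.le
    linarith
  have e4 : q r - Λ ≤ η * C * (1 + q r) := by
    have : (q r - Λ) * h ≤ (η * C * (1 + q r)) * h := by linarith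
    exact le_of_mul_le_mul_right this h0
  have e5 : κ * (1 + q r) ≤ q r - Λ := by
    rw [hκ, div_mul_eq_mul_div, div_le_iff₀ (by linarith)]
    nlinarith
  have : η * C * (1 + q r) < κ * (1 + q r) := by gcongr
  linarith

lemma abs_normal_le (A : Positive S G) {Λ : ℝ} (hΛ : ∀ s, Real.sqrt (S.ell s) ≤ Λ)
    {Y : Fin 4 → ℝ} (hY : Y ∈ convexHull ℝ G) (s : Fin 2 → ℝ) :
    |qform (S.n s) Y| ≤ Λ * -qform (S.x s) Y := by
  have key : ∀ γ ∈ G, |qform (S.n s) γ| ≤ Λ * -qform (S.x s) γ := by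
    intro γ hγ
    have h1 := A.normal_le_null hΛ hγ s
    have h2 := A.flip.normal_le_null (S := S.flip) (Λ := Λ)
      (fun s => by rw [S.ell_flip]; exact hΛ s) hγ s
    have h3 : qform (-S.n s) γ ≤ Λ * -qform (S.x s) γ := h2
    rw [qform_neg_left] at h3
    rw [abs_le]
    constructor <;> linarith
  refine convexHull_min (t := {Y | |qform (S.n s) Y| ≤ Λ * -qform (S.x s) Y}) key ?_ hY
  intro p hp q hq a b ha hb _
  simp only [mem_ofPred_eq] at hp hq ⊢
  rw [qform_add_right, qform_add_right, qform_smul_right, qform_smul_right, qform_smul_right,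
    qform_smul_right]
  calc _ ≤ a * |qform (S.n s) p| + b * |qform (S.n s) q| := by
        refine (abs_add_le _ _).trans (le_of_eq ?_)
        rw [abs_mul, abs_mul, abs_of_nonneg ha, abs_of_nonneg hb]
    _ ≤ _ := by nlinarith

lemma neg_of_mem_hull (A : Positive S G) {Y : Fin 4 → ℝ} (hY : Y ∈ convexHull ℝ G)
    (hYY : qform Y Y < 0) : ∀ γ ∈ G, qform Y γ < 0 := by
  intro γ hγ
  have h : Y ∈ {Y | qform Y γ < 0 ∨ ∃ c : ℝ, Y = c • γ} := by
    refine convexHull_min ?_ ?_ hY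
    · intro γ' hγ'
      rcases (A.nonpos γ' hγ' γ hγ).lt_or_eq with h | h
      · exact Or.inl h
      · obtain ⟨c, -, hc⟩ := A.proportional γ hγ γ' hγ' (by rwa [qform_comm])
        exact Or.inr ⟨c, hc⟩
    · have hγγ := A.null γ hγ
      intro p hp q hq a b ha hb _
      simp only [mem_ofPred_eq, qform_add_left, qform_smul_left]
      rcases ha.eq_or_lt with rfl | ha
      · rcases hb.eq_or_lt with rfl | hb
        · exact Or.inr ⟨0, by simp⟩
        rcases hq with hq | ⟨d, rfl⟩
        · left; nlinarith
        · exact Or.inr ⟨b * d, by simp [mul_smul]⟩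
      rcases hb.eq_or_lt with rfl | hb
      · rcases hp with hp | ⟨d, rfl⟩
        · left; nlinarith
        · exact Or.inr ⟨a * d, by simp [mul_smul]⟩
      rcases hp with hp | ⟨c, rfl⟩ <;> rcases hq with hq | ⟨d, rfl⟩
      · left; nlinarith
      · left; simp [hγγ]; nlinarith
      · left; simp [hγγ]; nlinarith
      · exact Or.inr ⟨a * c + b * d, by simp [mul_smul, add_smul]⟩
  rcases h with h | ⟨c, rfl⟩
  · exact h
  · simp [A.null γ hγ] at hYY

/-- Two unit timelike vectors in the convex hull are uniformly far from being orthogonal. -/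
lemma inner_hull_le (A : Positive S G) {Λ : ℝ} (hΛ : ∀ s, Real.sqrt (S.ell s) ≤ Λ) (hΛ1 : Λ < 1)
    {Y Y' : Fin 4 → ℝ} (hY : Y ∈ convexHull ℝ G) (hY' : Y' ∈ convexHull ℝ G)
    (hYY : qform Y Y = -1) (hYY' : qform Y' Y' = -1) :
    qform Y Y' ≤ -((1 - Λ ^ 2) / (1 + Λ ^ 2)) := by
  have hΛ0 : 0 ≤ Λ := (Real.sqrt_nonneg _).trans (hΛ 0)
  obtain ⟨s, hs⟩ := A.exists_max (A.neg_of_mem_hull hY (by linarith))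
  have ht := tangent_zero_of_max hs
  obtain ⟨u, w, H⟩ := S.exists_frame s
  have h1 := H.inner Y Y
  have h2 := H.inner Y' Y'
  have h3 := H.inner Y Y'
  have b1 := A.abs_normal_le hΛ hY s
  have b2 := A.abs_normal_le hΛ hY' s
  rw [ht u, ht w] at h1 h3
  rw [hYY] at h1
  rw [hYY'] at h2
  have bp : ∀ Z ∈ convexHull ℝ G, 0 ≤ -qform (S.x s) Z := by
    intro Z hZ
    have h4 : Z ∈ {Z | qform (S.x s) Z ≤ 0} := by
      refine convexHull_min (t := {Z | qform (S.x s) Z ≤ 0})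
        (fun γ hγ => (A.neg_inner s γ hγ).le) ?_ hZ
      intro p hp q hq a b ha hb _
      simp only [mem_ofPred_eq, qform_add_right, qform_smul_right] at hp hq ⊢
      nlinarith [mul_nonneg ha (neg_nonneg.2 hp), mul_nonneg hb (neg_nonneg.2 hq)]
    exact neg_nonneg.2 h4
  set h := -qform (S.x s) Y
  set h' := -qform (S.x s) Y'
  set v := qform (S.n s) Y
  set v' := qform (S.n s) Y'
  have p0 : 0 ≤ h := bp Y hY
  have p0' : 0 ≤ h' := bp Y' hY'
  have q1 : 1 ≤ (1 + Λ ^ 2) * h ^ 2 := by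
    have : v ^ 2 ≤ (Λ * h) ^ 2 := by
      rw [← sq_abs v]; exact pow_le_pow_left₀ (abs_nonneg _) b1 2
    nlinarith
  have q2 : 1 ≤ (1 + Λ ^ 2) * h' ^ 2 := by
    have : v' ^ 2 ≤ (Λ * h') ^ 2 := by
      rw [← sq_abs v']; exact pow_le_pow_left₀ (abs_nonneg _) b2 2
    nlinarith [mul_self_nonneg (qform (S.dx s u) Y'), mul_self_nonneg (qform (S.dx s w) Y')]
  have q3 : 1 ≤ (1 + Λ ^ 2) * (h * h') := by
    have : 1 ^ 2 ≤ ((1 + Λ ^ 2) * (h * h')) ^ 2 := by nlinarith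
    exact le_of_sq_le_sq this (by positivity)
  have q4 : -(v * v') ≤ Λ ^ 2 * (h * h') := by
    have : |v| * |v'| ≤ (Λ * h) * (Λ * h') := mul_le_mul b1 b2 (abs_nonneg _) (by positivity)
    rw [← abs_mul] at this
    have := neg_abs_le (v * v')
    linarith
  have q5 : qform Y Y' ≤ -((1 - Λ ^ 2) * (h * h')) := by
    nlinarith
  refine q5.trans (neg_le_neg ?_)
  rw [div_le_iff₀ (by positivity)]
  have : 0 ≤ 1 - Λ ^ 2 := by nlinarith
  nlinarith

end Positive

set_option maxHeartbeats 1000000 in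
/-- The algebraic core of the differential inequality satisfied by `(A² / (B² + μ)) ^ 16`. -/
lemma laplacian_algebra {A B m l p₁ p₂ α₁ α₂ β₁ β₂ : ℝ} (hA : 0 < A) (hAB : A ≤ B) (hm : 0 ≤ m)
    (hmB : m ≤ B ^ 2) (hl0 : 0 ≤ l) (hl1 : l ≤ 1) (hp : B ^ 2 - 2 * m ≤ 2 * (p₁ ^ 2 + p₂ ^ 2))
    (hα : α₁ + α₂ = (1 + l ^ 2) * A - (1 - l ^ 2) * B)
    (hβ : β₁ + β₂ = (1 + l ^ 2) * B - (1 - l ^ 2) * A)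
    (hsmall : (1 - l ^ 2) * B ≤ A / 32) :
    6 ≤ ((16 * (2 * ((1 + l) * p₁ / A) - 2 * B * ((l - 1) * p₁) / (B ^ 2 + m))) ^ 2 +
        16 * (2 * (α₁ / A - ((1 + l) * p₁ / A) ^ 2) -
          ((2 * B * β₁ + 2 * ((l - 1) * p₁) ^ 2) / (B ^ 2 + m) -
            (2 * B * ((l - 1) * p₁) / (B ^ 2 + m)) ^ 2))) +
      ((16 * (2 * ((1 - l) * p₂ / A) - 2 * B * (-((1 + l) * p₂)) / (B ^ 2 + m))) ^ 2 +
        16 * (2 * (α₂ / A - ((1 - l) * p₂ / A) ^ 2) -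
          ((2 * B * β₂ + 2 * (-((1 + l) * p₂)) ^ 2) / (B ^ 2 + m) -
            (2 * B * (-((1 + l) * p₂)) / (B ^ 2 + m)) ^ 2))) := by
  have hB : 0 < B := by linarith
  have hD : 0 < B ^ 2 + m := by positivity
  set D := B ^ 2 + m with hDdef
  obtain ⟨τ, hτ⟩ : ∃ τ, τ = B ^ 2 / D := ⟨_, rfl⟩
  have hτ1 : τ ≤ 1 := by rw [hτ, div_le_one hD]; linarith
  have hτ2 : 1 / 2 ≤ τ := by rw [hτ, le_div_iff₀ hD]; linarith
  have hBD : ∀ z : ℝ, B * z / D = τ * (z / B) := by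
    intro z; rw [hτ]; field_simp
  have hBD2 : ∀ z : ℝ, z ^ 2 / D = τ * (z / B) ^ 2 := by
    intro z; rw [hτ]; field_simp
  obtain ⟨x₁, hx₁⟩ : ∃ z, z = (1 + l) * p₁ / A := ⟨_, rfl⟩
  obtain ⟨x₂, hx₂⟩ : ∃ z, z = (1 - l) * p₂ / A := ⟨_, rfl⟩
  obtain ⟨y₁, hy₁⟩ : ∃ z, z = (l - 1) * p₁ / B := ⟨_, rfl⟩
  obtain ⟨y₂, hy₂⟩ : ∃ z, z = -((1 + l) * p₂) / B := ⟨_, rfl⟩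
  rw [← hx₁, ← hx₂]
  have hBD1 := hBD ((l - 1) * p₁)
  have hBD2' := hBD (-((1 + l) * p₂))
  have hsq1 := hBD2 ((l - 1) * p₁)
  have hsq2 := hBD2 (-((1 + l) * p₂))
  rw [← hy₁] at hBD1 hsq1
  rw [← hy₂] at hBD2' hsq2
  have r₁ : 2 * B * ((l - 1) * p₁) / D = 2 * (τ * y₁) := by rw [← hBD1]; ring
  have r₂ : 2 * B * (-((1 + l) * p₂)) / D = 2 * (τ * y₂) := by rw [← hBD2']; ring
  have r₃ : (2 * B * β₁ + 2 * ((l - 1) * p₁) ^ 2) / D = 2 * (τ * (β₁ / B)) + 2 * (τ * y₁ ^ 2) := by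
    rw [← hBD, ← hsq1]; ring
  have r₄ : (2 * B * β₂ + 2 * (-((1 + l) * p₂)) ^ 2) / D =
      2 * (τ * (β₂ / B)) + 2 * (τ * y₂ ^ 2) := by
    rw [← hBD, ← hsq2]; ring
  rw [r₁, r₂, r₃, r₄]
  have cross : x₁ * y₁ + x₂ * y₂ ≤ 0 := by
    have : x₁ * y₁ + x₂ * y₂ = -((1 - l ^ 2) * (p₁ ^ 2 + p₂ ^ 2)) / (A * B) := by
      rw [hx₁, hy₁, hx₂, hy₂]; field_simp; ring
    rw [this]
    apply div_nonpos_of_nonpos_of_nonneg _ (by positivity)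
    have : 0 ≤ 1 - l ^ 2 := by nlinarith
    have := mul_nonneg this (add_nonneg (sq_nonneg p₁) (sq_nonneg p₂))
    linarith
  have sA : 2 - 1 / 32 - (1 - l ^ 2) ≤ α₁ / A + α₂ / A := by
    rw [← add_div, hα, le_div_iff₀ hA]
    nlinarith
  have sB : β₁ / B + β₂ / B ≤ 1 + l ^ 2 := by
    rw [← add_div, hβ, div_le_iff₀ hB]
    have : 0 ≤ (1 - l ^ 2) * A := mul_nonneg (by nlinarith) hA.le
    nlinarith
  have hτm : (1 - τ) * B ^ 2 = τ * m := by
    rw [hτ]; field_simp; rw [hDdef]; ring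
  have sxy : 1 - 4 * (1 - τ) ≤ (x₁ ^ 2 + x₂ ^ 2) + (y₁ ^ 2 + y₂ ^ 2) := by
    have e1 : ((1 + l) * p₁) ^ 2 / B ^ 2 ≤ x₁ ^ 2 := by
      rw [hx₁, div_pow]
      gcongr
    have e2 : ((1 - l) * p₂) ^ 2 / B ^ 2 ≤ x₂ ^ 2 := by
      rw [hx₂, div_pow]
      gcongr
    have e3 : 1 - 4 * (1 - τ) ≤ ((1 + l) * p₁) ^ 2 / B ^ 2 + ((1 - l) * p₂) ^ 2 / B ^ 2 +
        (y₁ ^ 2 + y₂ ^ 2) := by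
      rw [hy₁, hy₂, div_pow, div_pow, ← add_div, ← add_div, ← add_div, le_div_iff₀ (by positivity)]
      have : 2 * (p₁ ^ 2 + p₂ ^ 2) * (1 + l ^ 2) = (((1 + l) * p₁) ^ 2 + ((1 - l) * p₂) ^ 2) +
        (((l - 1) * p₁) ^ 2 + (-((1 + l) * p₂)) ^ 2) := by ring
      rw [← this]
      have h1 : 0 ≤ l ^ 2 * (p₁ ^ 2 + p₂ ^ 2) := by positivity
      have h2 := mul_nonneg (sub_nonneg.2 hτ2) hm
      have h3 : (1 - 4 * (1 - τ)) * B ^ 2 = B ^ 2 - 4 * (τ * m) := by rw [← hτm]; ring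
      rw [h3]
      linarith
    linarith
  have hx : 0 ≤ x₁ ^ 2 + x₂ ^ 2 := by positivity
  have hy : 0 ≤ y₁ ^ 2 + y₂ ^ 2 := by positivity
  have hll : 1 - l ^ 2 ≤ 1 / 32 := by
    have h1 : 0 ≤ 1 - l ^ 2 := by nlinarith
    have h2 : (1 - l ^ 2) * B ≤ 1 / 32 * B := by linarith
    exact le_of_mul_le_mul_right h2 hB
  have t1 : τ * (β₁ / B + β₂ / B) ≤ τ * (1 + l ^ 2) := by gcongr
  have t2 : τ * (x₁ * y₁ + x₂ * y₂) ≤ 0 :=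
    mul_nonpos_of_nonneg_of_nonpos (by linarith) cross
  have t3 : (y₁ ^ 2 + y₂ ^ 2) ≤ (68 * τ ^ 2 - 2 * τ) * (y₁ ^ 2 + y₂ ^ 2) := by
    have h := mul_nonneg (sub_nonneg.2 hτ2) (sub_nonneg.2 hτ2)
    exact le_mul_of_one_le_left hy (by linarith)
  have t4 : 2 * (α₁ / A + α₂ / A) - 2 * (τ * (1 + l ^ 2)) ≥ 2 * (1 - τ) * (1 + l ^ 2) - 1 / 16 := by
    linarith
  have t5 : 0 ≤ (1 - τ) * l ^ 2 := mul_nonneg (by linarith) (sq_nonneg l)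
  linarith

lemma pow_eq_exp_log {A D : ℝ} (hA : 0 < A) (hD : 0 < D) :
    (A ^ 2 / D) ^ 16 = Real.exp (16 * (2 * Real.log A - Real.log D)) := by
  rw [← Real.exp_log (show 0 < (A ^ 2 / D) ^ 16 by positivity), Real.log_pow,
    Real.log_div (by positivity) hD.ne', Real.log_pow]
  norm_num

lemma Jet.pow_div {f g : ℝ → ℝ} {a b c a' b' c' m : ℝ} (hf : Jet f a b c) (hg : Jet g a' b' c')
    (ha : 0 < a) (hD : 0 < a' ^ 2 + m) :
    Jet (fun t => Real.exp (16 * (2 * Real.log (f t) - Real.log (g t ^ 2 + m))))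
      (Real.exp (16 * (2 * Real.log a - Real.log (a' ^ 2 + m))))
      (Real.exp (16 * (2 * Real.log a - Real.log (a' ^ 2 + m))) *
        (16 * (2 * (b / a) - 2 * a' * b' / (a' ^ 2 + m))))
      (Real.exp (16 * (2 * Real.log a - Real.log (a' ^ 2 + m))) *
        ((16 * (2 * (b / a) - 2 * a' * b' / (a' ^ 2 + m))) ^ 2 +
        16 * (2 * (c / a - (b / a) ^ 2) - ((2 * a' * c' + 2 * b' ^ 2) / (a' ^ 2 + m) -
          (2 * a' * b' / (a' ^ 2 + m)) ^ 2)))) := by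
  have h1 := ((hg.mul hg).add (Jet.const m)).log (by rw [← sq]; exact hD)
  have h2 := (((hf.log ha).const_mul 2).sub h1).const_mul 16
  have h3 := h2.exp
  simp only [← sq] at h3
  refine h3.congr_coeff rfl ?_ ?_
  · ring
  · ring

namespace MaxSurf
variable (S : MaxSurf)

/-- A function measuring how far the vector `p` is on the far side of the surface along its normal
at the point `s`. -/
def tilt (p : Fin 4 → ℝ) (m : ℝ) (s : Fin 2 → ℝ) : ℝ :=
  (max (qform (S.n s) p + qform (S.x s) p) 0 ^ 2 /
    ((|qform (S.n s) p| + -qform (S.x s) p) ^ 2 + m)) ^ 16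

lemma tilt_eq_exp {p : Fin 4 → ℝ} {m : ℝ} {s : Fin 2 → ℝ} (hm : 0 ≤ m)
    (hA : 0 < qform (S.n s) p + qform (S.x s) p) (hx : qform (S.x s) p ≤ 0) :
    S.tilt p m s = Real.exp (16 * (2 * Real.log (qform (S.n s) p + qform (S.x s) p) -
      Real.log ((qform (S.n s) p - qform (S.x s) p) ^ 2 + m))) := by
  have hv : 0 < qform (S.n s) p := by linarith
  have hB : 0 < qform (S.n s) p - qform (S.x s) p := by linarith
  rw [tilt, max_eq_left hA.le, abs_of_pos hv, ← sub_eq_add_neg, pow_eq_exp_log hA (by positivity)]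

set_option maxHeartbeats 1000000 in
/-- The function `tilt` is subharmonic, in a strong sense, where the surface is strongly curved. -/
lemma exists_jet_tilt {p : Fin 4 → ℝ} {m : ℝ} {s : Fin 2 → ℝ} {e₁ e₂ τ : Fin 4 → ℝ}
    {l d₁ d₂ k₁ k₂ : ℝ} {c₁ c₂ : ℝ → (Fin 2 → ℝ)}
    (F : Frame e₁ e₂ (S.x s) (S.n s)) (J : S.PrincipalJets s e₁ e₂ l c₁ c₂ τ d₁ d₂ k₁ k₂)
    (hl0 : 0 ≤ l) (hl1 : l ≤ 1) (hm : 0 ≤ m) (hpm : -qform p p ≤ m)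
    (hmB : m ≤ (qform (S.n s) p - qform (S.x s) p) ^ 2)
    (hA : 0 < qform (S.n s) p + qform (S.x s) p) (hx : ∀ s, qform (S.x s) p ≤ 0)
    (hsmall : (1 - l ^ 2) * (qform (S.n s) p - qform (S.x s) p) ≤
      (qform (S.n s) p + qform (S.x s) p) / 32) :
    ∃ b₁ b₂ r₁ r₂, Jet (fun t => S.tilt p m (c₁ t)) (S.tilt p m s) b₁ r₁ ∧
      Jet (fun t => S.tilt p m (c₂ t)) (S.tilt p m s) b₂ r₂ ∧ 6 * S.tilt p m s ≤ r₁ + r₂ := by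
  have hpp := F.inner p p
  set p₁ := qform e₁ p
  set p₂ := qform e₂ p
  set v := qform (S.n s) p
  set ξ := qform (S.x s) p
  set t := qform τ p
  have hξ : ξ ≤ 0 := hx s
  have jx₁ : Jet (fun t => qform (S.x (c₁ t)) p) ξ p₁ (ξ + l * v) :=
    (J.x₁.qform (Jet.const p)).congr_coeff rfl (by simp [p₁]) (by simp [ξ, v])
  have jx₂ : Jet (fun t => qform (S.x (c₂ t)) p) ξ p₂ (ξ - l * v) :=
    (J.x₂.qform (Jet.const p)).congr_coeff rfl (by simp [p₂]) (by simp [ξ, v])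
  have jn₁ : Jet (fun t => qform (S.n (c₁ t)) p) v (l * p₁) (l * ξ + l ^ 2 * v + t) :=
    (J.n₁.qform (Jet.const p)).congr_coeff rfl (by simp [p₁]) (by simp [ξ, v, t])
  have jn₂ : Jet (fun t => qform (S.n (c₂ t)) p) v (-(l * p₂)) (-(l * ξ) + l ^ 2 * v - t) :=
    (J.n₂.qform (Jet.const p)).congr_coeff rfl (by simp [p₂]) (by simp [ξ, v, t])
  have hB : 0 < v - ξ := by linarith
  have hD : 0 < (v - ξ) ^ 2 + m := by positivity
  have j₁ := (jn₁.add jx₁).pow_div (jn₁.sub jx₁) hA hD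
  have j₂ := (jn₂.add jx₂).pow_div (jn₂.sub jx₂) hA hD
  have hev : ∀ {c : ℝ → (Fin 2 → ℝ)} {b₁ r₁ b₂ r₂ : ℝ},
      Jet (fun t => qform (S.n (c t)) p) v b₁ r₁ → Jet (fun t => qform (S.x (c t)) p) ξ b₂ r₂ →
      (fun t => S.tilt p m (c t)) =ᶠ[𝓝 0] fun t =>
        Real.exp (16 * (2 * Real.log (qform (S.n (c t)) p + qform (S.x (c t)) p) -
          Real.log ((qform (S.n (c t)) p - qform (S.x (c t)) p) ^ 2 + m))) := by
    intro c b₁ r₁ b₂ r₂ h h'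
    have h1 := (h.add h').continuousAt
    have h2 : qform (S.n (c 0)) p + qform (S.x (c 0)) p = v + ξ := (h.add h').value
    have h3 : ∀ᶠ t in 𝓝 (0 : ℝ), 0 < qform (S.n (c t)) p + qform (S.x (c t)) p :=
      h1.eventually (lt_mem_nhds (by
        change 0 < qform (S.n (c 0)) p + qform (S.x (c 0)) p
        rw [h2]; exact hA))
    filter_upwards [h3] with t ht
    exact S.tilt_eq_exp hm ht (hx _)
  have heq : S.tilt p m s = _ := S.tilt_eq_exp hm hA hξ
  have alg := laplacian_algebra (A := v + ξ) (B := v - ξ) (m := m) (l := l) (p₁ := p₁) (p₂ := p₂)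
    (α₁ := l * ξ + l ^ 2 * v + t + (ξ + l * v)) (α₂ := -(l * ξ) + l ^ 2 * v - t + (ξ - l * v))
    (β₁ := l * ξ + l ^ 2 * v + t - (ξ + l * v)) (β₂ := -(l * ξ) + l ^ 2 * v - t - (ξ - l * v))
    hA (by linarith) hm hmB hl0 hl1 (by nlinarith) (by ring) (by ring) hsmall
  refine ⟨_, _, _, _, (j₁.congr (hev jn₁ jx₁)).congr_coeff heq.symm rfl rfl,
    (j₂.congr (hev jn₂ jx₂)).congr_coeff heq.symm rfl rfl, ?_⟩
  rw [heq, ← mul_add]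
  set E := Real.exp (16 * (2 * Real.log (v + ξ) - Real.log ((v - ξ) ^ 2 + m)))
  have hE : 0 ≤ E := (Real.exp_pos _).le
  rw [mul_comm 6 E]
  refine mul_le_mul_of_nonneg_left (alg.trans (le_of_eq ?_)) hE
  ring

lemma tilt_nonneg (p : Fin 4 → ℝ) {m : ℝ} (hm : 0 ≤ m) (s : Fin 2 → ℝ) : 0 ≤ S.tilt p m s := by
  unfold tilt; positivity

lemma tilt_le (p : Fin 4 → ℝ) {m : ℝ} (hm : 0 ≤ m) {s : Fin 2 → ℝ} (hx : qform (S.x s) p ≤ 0)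
    (hA : 0 < qform (S.n s) p + qform (S.x s) p) :
    S.tilt p m s * (qform (S.n s) p - qform (S.x s) p) ≤ qform (S.n s) p + qform (S.x s) p := by
  have hv : 0 < qform (S.n s) p := by linarith
  have hB : 0 < qform (S.n s) p - qform (S.x s) p := by linarith
  rw [tilt, max_eq_left hA.le, abs_of_pos hv, ← sub_eq_add_neg]
  set A := qform (S.n s) p + qform (S.x s) p
  set B := qform (S.n s) p - qform (S.x s) p
  have hAB : A ≤ B := by simp only [A, B]; linarith
  have h1 : A ^ 2 / (B ^ 2 + m) ≤ A / B := by
    rw [div_le_div_iff₀ (by positivity) hB]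
    nlinarith [mul_nonneg hA.le hm, mul_nonneg (mul_nonneg hA.le hB.le) (sub_nonneg.2 hAB)]
  have h0 : 0 ≤ A ^ 2 / (B ^ 2 + m) := by positivity
  have h2 : A / B ≤ 1 := (div_le_one hB).2 hAB
  have h3 : (A ^ 2 / (B ^ 2 + m)) ^ 16 ≤ A ^ 2 / (B ^ 2 + m) := by
    simpa using pow_le_pow_of_le_one h0 (h1.trans h2) (show 1 ≤ 16 by norm_num)
  calc _ ≤ A / B * B := by gcongr; exact h3.trans h1
    _ = A := by field_simp

lemma le_tilt (p : Fin 4 → ℝ) {m : ℝ} (hm : 0 ≤ m) {s : Fin 2 → ℝ} (hx : qform (S.x s) p ≤ 0)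
    (hA : 0 < qform (S.n s) p + qform (S.x s) p)
    (hmB : m ≤ (qform (S.n s) p - qform (S.x s) p) ^ 2) :
    ((qform (S.n s) p + qform (S.x s) p) / (qform (S.n s) p - qform (S.x s) p)) ^ 32 / 2 ^ 16 ≤
      S.tilt p m s := by
  have hv : 0 < qform (S.n s) p := by linarith
  have hB : 0 < qform (S.n s) p - qform (S.x s) p := by linarith
  rw [tilt, max_eq_left hA.le, abs_of_pos hv, ← sub_eq_add_neg]
  set A := qform (S.n s) p + qform (S.x s) p
  set B := qform (S.n s) p - qform (S.x s) p
  have e : (A / B) ^ 32 / 2 ^ 16 = (A ^ 2 / (2 * B ^ 2)) ^ 16 := by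
    rw [div_pow, div_pow, mul_pow, ← pow_mul, ← pow_mul]
    field_simp
    ring
  rw [e]
  gcongr
  linarith

lemma tilt_le_one (p : Fin 4 → ℝ) {m : ℝ} (hm : 0 ≤ m) {s : Fin 2 → ℝ} (hx : qform (S.x s) p ≤ 0) :
    S.tilt p m s ≤ 1 := by
  rcases le_or_gt (qform (S.n s) p + qform (S.x s) p) 0 with h | h
  · rw [tilt, max_eq_right h]; norm_num
  · have h1 := S.tilt_le p hm hx h
    have hB : 0 < qform (S.n s) p - qform (S.x s) p := by linarith
    have h2 : S.tilt p m s * (qform (S.n s) p - qform (S.x s) p) ≤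
      1 * (qform (S.n s) p - qform (S.x s) p) := by linarith
    exact le_of_mul_le_mul_right h2 hB

lemma continuous_tilt {p : Fin 4 → ℝ} (hp : p ≠ 0) {m : ℝ} (hm : 0 ≤ m)
    (hx : ∀ s, qform (S.x s) p ≤ 0) : Continuous (S.tilt p m) := by
  have c1 : Continuous fun s => qform (S.x s) p :=
    continuous_qform S.smooth_x.continuous continuous_const
  have c2 : Continuous fun s => qform (S.n s) p :=
    continuous_qform S.smooth_n.continuous continuous_const
  refine Continuous.pow (Continuous.div (((c2.add c1).max continuous_const).pow 2)
    (((c2.abs.add c1.neg).pow 2).add continuous_const) fun s => ?_) 16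
  have hpos : 0 < |qform (S.n s) p| + -qform (S.x s) p := by
    have h1 := abs_nonneg (qform (S.n s) p)
    have h2 := hx s
    by_contra hcon
    have h3 : qform (S.x s) p = 0 := by linarith
    have h4 : qform (S.n s) p = 0 := abs_eq_zero.1 (by linarith)
    have ht : ∀ v, qform (S.dx s v) p = 0 :=
      Positive.tangent_zero_of_max (fun s' => by rw [h3]; exact hx s')
    obtain ⟨u, w, H⟩ := S.exists_frame s
    apply hp
    have hexp := H.expand p
    rw [ht, ht, h3, h4] at hexp
    simpa using hexp
  exact (add_pos_of_pos_of_nonneg (pow_pos hpos 2) hm).ne'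

end MaxSurf

namespace Positive
variable {S : MaxSurf} {G : Set (Fin 4 → ℝ)}

set_option maxHeartbeats 2000000 in
/-- A vector of the dual cone can be far on one side of the surface only near points which are not
strongly curved. -/
lemma tilt_le_log_ell (A : Positive S G) (hell : ∀ s, S.ell s ≤ 1) {p : Fin 4 → ℝ}
    (hp : ∀ γ ∈ G, qform p γ ≤ 0) {s : Fin 2 → ℝ} (hs : 0 < S.ell s)
    (hA : 0 < qform (S.n s) p + qform (S.x s) p) :
    ((qform (S.n s) p + qform (S.x s) p) / (qform (S.n s) p - qform (S.x s) p)) ^ 32 / 2 ^ 22 ≤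
      -(1 / 2 * Real.log (S.ell s)) := by
  have hx := A.inner_nonpos hp
  have hp0 : p ≠ 0 := by rintro rfl; simp at hA
  set m := max (-qform p p) 0
  have hm : 0 ≤ m := le_max_right _ _
  have hmB : ∀ r, 0 < qform (S.n r) p + qform (S.x r) p →
      m ≤ (qform (S.n r) p - qform (S.x r) p) ^ 2 := by
    intro r hr
    obtain ⟨u, w, H⟩ := S.exists_frame r
    have h1 := H.inner p p
    have h2 := hx r
    refine max_le ?_ (sq_nonneg _)
    nlinarith [mul_self_nonneg (qform (S.dx r u) p), mul_self_nonneg (qform (S.dx r w) p),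
      mul_nonneg (show 0 ≤ qform (S.n r) p by linarith) (neg_nonneg.2 h2)]
  by_contra hcon
  push Not at hcon
  obtain ⟨d, hd, hd0⟩ : ∃ d, d = S.tilt p m s / 64 + 1 / 2 * Real.log (S.ell s) ∧ 0 < d := by
    refine ⟨_, rfl, ?_⟩
    have := S.le_tilt p hm (hx s) hA (hmB s hA)
    have e : ((qform (S.n s) p + qform (S.x s) p) / (qform (S.n s) p - qform (S.x s) p)) ^ 32 /
        2 ^ 22 = ((qform (S.n s) p + qform (S.x s) p) /
          (qform (S.n s) p - qform (S.x s) p)) ^ 32 / 2 ^ 16 / 64 := by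
      rw [div_div]; norm_num
    rw [e] at hcon
    linarith
  obtain ⟨y, hy, hyG, hyx⟩ := A.exists_base
  obtain ⟨s₀, hs₀⟩ := A.exists_max hyG
  set κ := Real.log (-qform (S.x s₀) y)
  have cρ : Continuous fun r => Real.log (-qform (S.x r) y) - κ := by
    have c1 : Continuous fun s => qform (S.x s) y :=
      continuous_qform S.smooth_x.continuous continuous_const
    exact (c1.neg.log fun s => (neg_pos.2 (hyx s)).ne').sub continuous_const
  obtain ⟨ρ, hρ⟩ : ∃ ρ : (Fin 2 → ℝ) → ℝ, ρ = fun r => Real.log (-qform (S.x r) y) - κ := ⟨_, rfl⟩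
  rw [← hρ] at cρ
  have hρ0 : ∀ r, 0 ≤ ρ r := by
    intro r
    rw [hρ]
    exact sub_nonneg.2 (Real.log_le_log (neg_pos.2 (hyx s₀)) (neg_le_neg (hs₀ r)))
  obtain ⟨η, hη, hη₁, hη₂⟩ : ∃ η : ℝ, 0 < η ∧ η < d / 2 ∧ η * ρ s ≤ d / 2 := by
    have := hρ0 s
    refine ⟨d / (4 * (1 + ρ s)), by positivity, ?_, ?_⟩
    · rw [div_lt_div_iff₀ (by positivity) (by positivity)]
      nlinarith
    · rw [div_mul_eq_mul_div, div_le_div_iff₀ (by positivity) (by positivity)]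
      nlinarith
  obtain ⟨Φ, hΦ⟩ : ∃ Φ : (Fin 2 → ℝ) → ℝ,
      Φ = fun r => S.ell r * Real.exp (S.tilt p m r / 32 - 2 * η * ρ r) := ⟨_, rfl⟩
  have hlog : ∀ r, 0 < S.ell r →
      Real.log (Φ r) = Real.log (S.ell r) + S.tilt p m r / 32 - 2 * η * ρ r := by
    intro r hr
    rw [hΦ]
    simp only
    rw [Real.log_mul hr.ne' (Real.exp_pos _).ne', Real.log_exp]
    ring
  have hΦs : 0 < Φ s := by rw [hΦ]; exact mul_pos hs (Real.exp_pos _)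
  have cΦ : Continuous Φ := by
    rw [hΦ]
    have c1 := S.continuous_tilt hp0 hm hx
    have c2 := S.continuous_ell
    fun_prop
  have sub : ∀ r, Φ s ≤ Φ r →
      -qform (S.x r) y ≤ Real.exp ((1 / 32 - Real.log (Φ s)) / (2 * η) + κ) := by
    intro r hr
    have hΦr : 0 < Φ r := hΦs.trans_le hr
    have hr0 : 0 < S.ell r := by
      rw [hΦ] at hΦr
      exact pos_of_mul_pos_left hΦr (Real.exp_pos _).le
    have h1 := Real.log_le_log hΦs hr
    have h2 := hlog r hr0
    have h3 := S.tilt_le_one p hm (hx r)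
    have h4 := Real.log_nonpos hr0.le (hell r)
    have h5 : ρ r ≤ (1 / 32 - Real.log (Φ s)) / (2 * η) := by
      rw [le_div_iff₀ (by positivity)]
      linarith
    rw [← Real.exp_log (neg_pos.2 (hyx r))]
    apply Real.exp_le_exp.2
    rw [hρ] at h5
    simp only at h5
    linarith
  obtain ⟨r, -, hr⟩ := (A.isCompact_sublevel hyG
    (Real.exp ((1 / 32 - Real.log (Φ s)) / (2 * η) + κ))).exists_isMaxOn
    ⟨s, sub s le_rfl⟩ cΦ.continuousOn
  have hmax : ∀ r', Φ r' ≤ Φ r := by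
    intro r'
    by_cases h : Φ s ≤ Φ r'
    · exact isMaxOn_iff.1 hr _ (sub r' h)
    · have := isMaxOn_iff.1 hr s (sub s le_rfl)
      linarith
  have hΦr : 0 < Φ r := hΦs.trans_le (hmax s)
  have hr0 : 0 < S.ell r := by
    have := hΦr
    rw [hΦ] at this
    exact pos_of_mul_pos_left this (Real.exp_pos _).le
  have hgain : d / 2 - 1 / 2 * Real.log (S.ell r) ≤ S.tilt p m r / 64 := by
    have h1 := Real.log_le_log hΦs (hmax s)
    rw [hlog s hs, hlog r hr0] at h1
    have h2 := mul_nonneg hη.le (hρ0 r)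
    linarith
  have hlogle : 1 - S.ell r ≤ -Real.log (S.ell r) := by
    have := Real.log_le_sub_one_of_pos hr0
    linarith
  have hAr : 0 < qform (S.n r) p + qform (S.x r) p := by
    by_contra hcon'
    have h0 : S.tilt p m r = 0 := by
      rw [MaxSurf.tilt, max_eq_right (not_lt.1 hcon')]; norm_num
    have := hell r
    rw [h0] at hgain
    linarith
  have hBr : 0 < qform (S.n r) p - qform (S.x r) p := by
    have := hx r
    linarith
  obtain ⟨u, w, l, P⟩ := S.exists_principal r
  obtain ⟨c₁, c₂, τ, d₁, d₂, k₁, k₂, J⟩ := S.exists_principalJets P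
  have hl := P.sq
  have hl1 : l ≤ 1 := by
    have := hell r
    rw [← hl] at this
    nlinarith [P.nonneg]
  have hsmall : (1 - l ^ 2) * (qform (S.n r) p - qform (S.x r) p) ≤
      (qform (S.n r) p + qform (S.x r) p) / 32 := by
    have h1 := S.tilt_le p hm (hx r) hAr
    have h2 : 1 - l ^ 2 ≤ S.tilt p m r / 32 := by rw [hl]; linarith
    have h3 := mul_le_mul_of_nonneg_right h2 hBr.le
    linarith
  obtain ⟨b₁, b₂, q₁, q₂, K₁, K₂, hK⟩ := S.exists_jet_tilt P.frame J P.nonneg hl1 hm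
    (le_max_left _ _) (hmB r hAr) hAr hx hsmall
  have second : ∀ {c : ℝ → (Fin 2 → ℝ)} {d b k q e f : ℝ}, c 0 = r → Continuous c →
      Jet (fun t => S.ell (c t)) (S.ell r) d k → Jet (fun t => S.tilt p m (c t)) (S.tilt p m r) b q →
      Jet (fun t => qform (S.x (c t)) y) (qform (S.x r) y) e f →
      (k / S.ell r - (d / S.ell r) ^ 2) + 1 / 32 * q -
        2 * η * (-f / -qform (S.x r) y - (-e / -qform (S.x r) y) ^ 2) ≤ 0 := by
    intro c d b k q e f hc0 hc j1 j2 j3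
    have j := ((j1.log hr0).add (j2.const_mul (1 / 32))).sub
      ((j3.neg.log (neg_pos.2 (hyx r))).const_mul (2 * η))
    refine (j.of_isLocalMax ?_).2
    have hev : ∀ᶠ t in 𝓝 (0 : ℝ), 0 < S.ell (c t) := by
      have h1 := (S.continuous_ell.comp hc).continuousAt (x := 0)
      refine h1.eventually (lt_mem_nhds ?_)
      simp only [Function.comp, hc0]
      exact hr0
    filter_upwards [hev] with t ht
    have h1 := Real.log_le_log (by rw [hΦ]; exact mul_pos ht (Real.exp_pos _)) (hmax (c t))
    rw [hlog _ ht, hlog r hr0, hρ] at h1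
    simp only [hc0] at h1 ⊢
    linarith
  have jy₁ : Jet (fun t => qform (S.x (c₁ t)) y) (qform (S.x r) y) (qform (S.dx r u) y)
      (qform (S.x r) y + l * qform (S.n r) y) :=
    (J.x₁.qform (Jet.const y)).congr_coeff rfl (by simp) (by simp)
  have jy₂ : Jet (fun t => qform (S.x (c₂ t)) y) (qform (S.x r) y) (qform (S.dx r w) y)
      (qform (S.x r) y - l * qform (S.n r) y) :=
    (J.x₂.qform (Jet.const y)).congr_coeff rfl (by simp) (by simp)
  have z₁ := second J.start₁ J.cont₁ J.ell₁ K₁ jy₁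
  have z₂ := second J.start₂ J.cont₂ J.ell₂ K₂ jy₂
  have boch : (k₁ / S.ell r - (d₁ / S.ell r) ^ 2) + (k₂ / S.ell r - (d₂ / S.ell r) ^ 2) =
      -4 * (1 - S.ell r) := by
    have := J.bochner
    field_simp
    linarith
  have two : -(qform (S.x r) y + l * qform (S.n r) y) / -qform (S.x r) y +
      -(qform (S.x r) y - l * qform (S.n r) y) / -qform (S.x r) y = 2 := by
    have := (hyx r).ne
    field_simp
    ring
  have g₁ := mul_nonneg hη.le (sq_nonneg (-qform (S.dx r u) y / -qform (S.x r) y))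
  have g₂ := mul_nonneg hη.le (sq_nonneg (-qform (S.dx r w) y / -qform (S.x r) y))
  generalize -(qform (S.x r) y + l * qform (S.n r) y) / -qform (S.x r) y = f₁ at z₁ two
  generalize -(qform (S.x r) y - l * qform (S.n r) y) / -qform (S.x r) y = f₂ at z₂ two
  generalize (-qform (S.dx r u) y / -qform (S.x r) y) ^ 2 = w₁ at z₁ g₁
  generalize (-qform (S.dx r w) y / -qform (S.x r) y) ^ 2 = w₂ at z₂ g₂
  have g₃ : η * f₁ + η * f₂ = 2 * η := by linear_combination η * two
  linarith only [S.tilt_nonneg p hm r, z₁, z₂, boch, g₁, g₂, g₃, hK, hgain, hlogle, hη₁, hd0]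

end Positive

lemma det2_smul_left (c : ℝ) (v w : Fin 2 → ℝ) : det2 (c • v) w = c * det2 v w := by
  simp [det2]; ring

lemma det2_smul_right (c : ℝ) (v w : Fin 2 → ℝ) : det2 v (c • w) = c * det2 v w := by
  simp [det2]; ring

lemma det2_swap (v w : Fin 2 → ℝ) : det2 w v = -det2 v w := by
  simp [det2]; ring

lemma exists_smul_of_det2_eq_zero {v w : Fin 2 → ℝ} (hv : v ≠ 0) (hw : w ≠ 0) (h : det2 v w = 0) :
    ∃ c : ℝ, c ≠ 0 ∧ w = c • v := by
  have hh : v 0 * w 1 = v 1 * w 0 := sub_eq_zero.1 h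
  obtain ⟨c, hc⟩ : ∃ c : ℝ, w = c • v := by
    by_cases h0 : v 0 = 0
    · have h1 : v 1 ≠ 0 := by
        intro h1
        exact hv (by ext i; fin_cases i <;> simp [h0, h1])
      refine ⟨w 1 / v 1, ?_⟩
      have h2 : w 0 = 0 := by simpa [h0, h1] using hh
      ext i
      fin_cases i
      · simp [h0, h2]
      · simp [h1]
    · refine ⟨w 0 / v 0, ?_⟩
      ext i
      fin_cases i
      · simp [h0]
      · simp; field_simp; linarith
  refine ⟨c, ?_, hc⟩
  rintro rfl
  simp at hc
  exact hw hc

lemma mk_eq_mk_iff_det2 {v w : Fin 2 → ℝ} (hv : v ≠ 0) (hw : w ≠ 0) :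
    Projectivization.mk ℝ v hv = Projectivization.mk ℝ w hw ↔ det2 v w = 0 := by
  rw [Projectivization.mk_eq_mk_iff']
  constructor
  · rintro ⟨c, rfl⟩
    simp [det2]; ring
  · intro h
    obtain ⟨c, -, hc⟩ := exists_smul_of_det2_eq_zero hw hv (by rw [det2_swap, h, neg_zero])
    exact ⟨c, hc.symm⟩

lemma tripleOrient_mk {a b c : Fin 2 → ℝ} (ha : a ≠ 0) (hb : b ≠ 0) (hc : c ≠ 0) :
    ∃ r : ℝ, 0 < r ∧ tripleOrient (Projectivization.mk ℝ a ha) (Projectivization.mk ℝ b hb)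
      (Projectivization.mk ℝ c hc) = r * (det2 a b * det2 b c * det2 c a) := by
  obtain ⟨x, hx⟩ := Projectivization.exists_smul_eq_mk_rep ℝ a ha
  obtain ⟨y, hy⟩ := Projectivization.exists_smul_eq_mk_rep ℝ b hb
  obtain ⟨z, hz⟩ := Projectivization.exists_smul_eq_mk_rep ℝ c hc
  have hx0 := x.ne_zero
  have hy0 := y.ne_zero
  have hz0 := z.ne_zero
  refine ⟨((x : ℝ) * y * z) ^ 2, by positivity, ?_⟩
  rw [tripleOrient, ← hx, ← hy, ← hz]
  simp only [Units.smul_def, det2_smul_left, det2_smul_right]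
  ring

lemma qform_toBoundary (v w v' w' : Fin 2 → ℝ) :
    qform (toBoundary v w) (toBoundary v' w') = -(det2 v v' * det2 w w') / 2 := by
  simp [qform, toBoundary, det2]; ring

lemma toBoundary_smul_left (c : ℝ) (v w : Fin 2 → ℝ) :
    toBoundary (c • v) w = c • toBoundary v w := by
  ext i; fin_cases i <;> simp [toBoundary] <;> ring

lemma toBoundary_smul_right (c : ℝ) (v w : Fin 2 → ℝ) :
    toBoundary v (c • w) = c • toBoundary v w := by
  ext i; fin_cases i <;> simp [toBoundary] <;> ring

lemma toBoundary_ne_zero {v w : Fin 2 → ℝ} (hv : v ≠ 0) (hw : w ≠ 0) : toBoundary v w ≠ 0 := by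
  intro h
  have h0 := congrFun h 0
  have h1 := congrFun h 1
  have h2 := congrFun h 2
  have h3 := congrFun h 3
  simp [toBoundary] at h0 h1 h2 h3
  obtain ⟨i, hi⟩ := Function.ne_iff.1 hv
  obtain ⟨j, hj⟩ := Function.ne_iff.1 hw
  have key : ∀ i j, v i * w j = 0 := by
    rw [Fin.forall_fin_two, Fin.forall_fin_two, Fin.forall_fin_two]
    refine ⟨⟨?_, ?_⟩, ?_, ?_⟩ <;> linarith
  rcases mul_eq_zero.1 (key i j) with h | h
  · exact hi h
  · exact hj h

lemma continuous_toBoundary : Continuous fun z : (Fin 2 → ℝ) × (Fin 2 → ℝ) => toBoundary z.1 z.2 := by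
  refine continuous_pi fun i => ?_
  fin_cases i <;> simp [toBoundary] <;> fun_prop

lemma mem_lifts_grGraph {φ : RP1 → RP1} {z : Fin 4 → ℝ} :
    z ∈ lifts (grGraph φ) ↔ ∃ (v w : Fin 2 → ℝ) (hv : v ≠ 0) (hw : w ≠ 0), z = toBoundary v w ∧
      φ (Projectivization.mk ℝ v hv) = Projectivization.mk ℝ w hw := by
  constructor
  · rintro ⟨hz, v, w, hv, hw, hx, h, hφ⟩
    obtain ⟨c, hc⟩ := (Projectivization.mk_eq_mk_iff' ℝ _ _ hz hx).1 h.symm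
    have hc0 : c ≠ 0 := by
      rintro rfl
      simp at hc
      exact hz hc.symm
    refine ⟨v, c • w, hv, smul_ne_zero hc0 hw, by rw [toBoundary_smul_right, hc], ?_⟩
    rw [hφ, Projectivization.mk_eq_mk_iff']
    exact ⟨c⁻¹, by rw [smul_smul, inv_mul_cancel₀ hc0, one_smul]⟩
  · rintro ⟨v, w, hv, hw, rfl, h⟩
    exact ⟨toBoundary_ne_zero hv hw, v, w, hv, hw, toBoundary_ne_zero hv hw, rfl, h⟩

/-- The algebraic properties of the set of lifts of the graph of an orientation-preserving
bijection of the projective line. -/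
structure NullSystem (Λ : Set (Fin 4 → ℝ)) : Prop where
  null : ∀ γ ∈ Λ, qform γ γ = 0
  smul_mem : ∀ γ ∈ Λ, ∀ c : ℝ, c ≠ 0 → c • γ ∈ Λ
  proportional : ∀ γ ∈ Λ, ∀ γ' ∈ Λ, qform γ γ' = 0 → ∃ c : ℝ, c ≠ 0 ∧ γ' = c • γ
  triple : ∀ γ₁ ∈ Λ, ∀ γ₂ ∈ Λ, ∀ γ₃ ∈ Λ, qform γ₁ γ₂ ≠ 0 → qform γ₂ γ₃ ≠ 0 → qform γ₃ γ₁ ≠ 0 →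
    qform γ₁ γ₂ * qform γ₂ γ₃ * qform γ₃ γ₁ < 0
  exists_pair : ∃ γ ∈ Λ, ∃ γ' ∈ Λ, qform γ γ' < 0

lemma nullSystem_lifts {φ : RP1 → RP1} (hφ : Function.Injective φ) (ho : OrientationPreserving φ) :
    NullSystem (lifts (grGraph φ)) := by
  have hdet : ∀ {v w v' w' : Fin 2 → ℝ} (hv : v ≠ 0) (hw : w ≠ 0) (hv' : v' ≠ 0) (hw' : w' ≠ 0),
      φ (Projectivization.mk ℝ v hv) = Projectivization.mk ℝ w hw →
      φ (Projectivization.mk ℝ v' hv') = Projectivization.mk ℝ w' hw' →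
      (det2 v v' = 0 ↔ det2 w w' = 0) := by
    intro v w v' w' hv hw hv' hw' h h'
    rw [← mk_eq_mk_iff_det2 hv hv', ← mk_eq_mk_iff_det2 hw hw', ← h, ← h', hφ.eq_iff]
  have smul_mem : ∀ γ ∈ lifts (grGraph φ), ∀ c : ℝ, c ≠ 0 → c • γ ∈ lifts (grGraph φ) := by
    rintro γ ⟨hγ, h⟩ c hc
    refine ⟨smul_ne_zero hc hγ, ?_⟩
    convert h using 1
    rw [projPt, projPt, Projectivization.mk_eq_mk_iff']
    exact ⟨c, rfl⟩
  refine ⟨?_, smul_mem, ?_, ?_, ?_⟩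
  · intro γ hγ
    obtain ⟨v, w, -, -, rfl, -⟩ := mem_lifts_grGraph.1 hγ
    rw [qform_toBoundary]
    simp [det2]; left; ring
  · intro γ hγ γ' hγ' h
    obtain ⟨v, w, hv, hw, rfl, e⟩ := mem_lifts_grGraph.1 hγ
    obtain ⟨v', w', hv', hw', rfl, e'⟩ := mem_lifts_grGraph.1 hγ'
    rw [qform_toBoundary] at h
    have h1 : det2 v v' = 0 := by
      have h2 : det2 v v' * det2 w w' = 0 := by linarith
      rcases mul_eq_zero.1 h2 with h3 | h3
      · exact h3
      · exact (hdet hv hw hv' hw' e e').2 h3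
    obtain ⟨a, ha, rfl⟩ := exists_smul_of_det2_eq_zero hv hv' h1
    obtain ⟨b, hb, rfl⟩ := exists_smul_of_det2_eq_zero hw hw' ((hdet hv hw hv' hw' e e').1 h1)
    exact ⟨a * b, mul_ne_zero ha hb,
      by rw [toBoundary_smul_left, toBoundary_smul_right, smul_smul]⟩
  · intro γ₁ h₁ γ₂ h₂ γ₃ h₃ h12 h23 h31
    obtain ⟨a, a', ha, ha', rfl, ea⟩ := mem_lifts_grGraph.1 h₁
    obtain ⟨b, b', hb, hb', rfl, eb⟩ := mem_lifts_grGraph.1 h₂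
    obtain ⟨c, c', hc, hc', rfl, ec⟩ := mem_lifts_grGraph.1 h₃
    rw [qform_toBoundary] at h12 h23 h31 ⊢
    rw [qform_toBoundary, qform_toBoundary]
    have pos : ∀ {a b c a' b' c' : Fin 2 → ℝ} (ha : a ≠ 0) (hb : b ≠ 0) (hc : c ≠ 0)
        (ha' : a' ≠ 0) (hb' : b' ≠ 0) (hc' : c' ≠ 0),
        φ (Projectivization.mk ℝ a ha) = Projectivization.mk ℝ a' ha' →
        φ (Projectivization.mk ℝ b hb) = Projectivization.mk ℝ b' hb' →
        φ (Projectivization.mk ℝ c hc) = Projectivization.mk ℝ c' hc' →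
        0 < det2 a b * det2 b c * det2 c a → 0 < det2 a' b' * det2 b' c' * det2 c' a' := by
      intro a b c a' b' c' ha hb hc ha' hb' hc' ea eb ec h
      obtain ⟨r, hr, e⟩ := tripleOrient_mk ha hb hc
      obtain ⟨r', hr', e'⟩ := tripleOrient_mk ha' hb' hc'
      have h1 := ho _ _ _ (by rw [e]; exact mul_pos hr h)
      rw [ea, eb, ec, e'] at h1
      exact pos_of_mul_pos_right h1 hr'.le
    have e : -(det2 a b * det2 a' b') / 2 * (-(det2 b c * det2 b' c') / 2) *
        (-(det2 c a * det2 c' a') / 2) =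
        -((det2 a b * det2 b c * det2 c a) * (det2 a' b' * det2 b' c' * det2 c' a')) / 8 := by ring
    rw [e]
    have hne : det2 a b * det2 b c * det2 c a ≠ 0 := by
      refine mul_ne_zero (mul_ne_zero ?_ ?_) ?_
      · intro h; simp [h] at h12
      · intro h; simp [h] at h23
      · intro h; simp [h] at h31
    rcases hne.lt_or_gt with h | h
    · have h1 : 0 < det2 a c * det2 c b * det2 b a := by
        rw [det2_swap c a, det2_swap b c, det2_swap a b]; linarith
      have h2 := pos ha hc hb ha' hc' hb' ea ec eb h1
      rw [det2_swap c' a', det2_swap b' c', det2_swap a' b'] at h2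
      have h3 : det2 a' b' * det2 b' c' * det2 c' a' < 0 := by linarith
      linarith [mul_pos_of_neg_of_neg h h3]
    · linarith [mul_pos h (pos ha hb hc ha' hb' hc' ea eb ec h)]
  · have lift : ∀ v : Fin 2 → ℝ, ∀ hv : v ≠ 0, ∃ (w : Fin 2 → ℝ) (hw : w ≠ 0),
        φ (Projectivization.mk ℝ v hv) = Projectivization.mk ℝ w hw := fun v hv =>
      ⟨_, (φ (Projectivization.mk ℝ v hv)).rep_nonzero, (Projectivization.mk_rep _).symm⟩
    have hv : (![1, 0] : Fin 2 → ℝ) ≠ 0 := by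
      intro h; simpa using congrFun h 0
    have hv' : (![0, 1] : Fin 2 → ℝ) ≠ 0 := by
      intro h; simpa using congrFun h 1
    obtain ⟨w, hw, e⟩ := lift _ hv
    obtain ⟨w', hw', e'⟩ := lift _ hv'
    have h1 := mem_lifts_grGraph.2 ⟨_, _, hv, hw, rfl, e⟩
    have h2 := mem_lifts_grGraph.2 ⟨_, _, hv', hw', rfl, e'⟩
    have hd : det2 (![1, 0] : Fin 2 → ℝ) ![0, 1] = 1 := by simp [det2]
    have hne : qform (toBoundary ![1, 0] w) (toBoundary ![0, 1] w') ≠ 0 := by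
      rw [qform_toBoundary, hd, one_mul]
      intro h
      have := (hdet hv hw hv' hw' e e').2 (by linarith)
      rw [hd] at this
      norm_num at this
    rcases hne.lt_or_gt with h | h
    · exact ⟨_, h1, _, h2, h⟩
    · refine ⟨_, h1, _, smul_mem _ h2 (-1) (by norm_num), ?_⟩
      rw [qform_smul_right]; linarith

namespace NullSystem
variable {Λ : Set (Fin 4 → ℝ)}

lemma inner_ne_zero (H : NullSystem Λ) {γ₁ γ₂ γ : Fin 4 → ℝ} (h₁ : γ₁ ∈ Λ) (h₂ : γ₂ ∈ Λ)
    (h : γ ∈ Λ) (hneg : qform γ₁ γ₂ < 0) : qform γ (γ₁ + γ₂) ≠ 0 := by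
  rw [qform_add_right]
  by_cases a₁ : qform γ γ₁ = 0
  · obtain ⟨c, hc, rfl⟩ := H.proportional γ₁ h₁ γ h (by rwa [qform_comm])
    rw [a₁, zero_add, qform_smul_left]
    exact mul_ne_zero hc hneg.ne
  by_cases a₂ : qform γ γ₂ = 0
  · rwa [a₂, add_zero]
  have h3 := H.triple γ h γ₁ h₁ γ₂ h₂ a₁ hneg.ne (by rwa [qform_comm])
  rw [qform_comm γ₂ γ] at h3
  have h4 : 0 < qform γ γ₁ * qform γ γ₂ := by
    by_contra hcon
    push Not at hcon
    nlinarith [mul_nonneg_of_nonpos_of_nonpos hcon hneg.le]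
  rcases pos_and_pos_or_neg_and_neg_of_mul_pos h4 with ⟨h5, h6⟩ | ⟨h5, h6⟩
  · linarith
  · intro h; linarith

lemma inner_nonpos (H : NullSystem Λ) {γ₁ γ₂ γ : Fin 4 → ℝ} (h₁ : γ₁ ∈ Λ) (h₂ : γ₂ ∈ Λ)
    (h : γ ∈ Λ) (hneg : qform γ₁ γ₂ < 0) (hy : qform γ (γ₁ + γ₂) < 0) :
    qform γ γ₁ ≤ 0 ∧ qform γ γ₂ ≤ 0 := by
  rw [qform_add_right] at hy
  by_cases a₁ : qform γ γ₁ = 0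
  · exact ⟨a₁.le, by linarith⟩
  by_cases a₂ : qform γ γ₂ = 0
  · exact ⟨by linarith, a₂.le⟩
  have h3 := H.triple γ h γ₁ h₁ γ₂ h₂ a₁ hneg.ne (by rwa [qform_comm])
  rw [qform_comm γ₂ γ] at h3
  have h4 : 0 < qform γ γ₁ * qform γ γ₂ := by
    by_contra hcon
    push Not at hcon
    nlinarith [mul_nonneg_of_nonpos_of_nonpos hcon hneg.le]
  rcases pos_and_pos_or_neg_and_neg_of_mul_pos h4 with ⟨h5, h6⟩ | ⟨h5, h6⟩
  · linarith
  · exact ⟨h5.le, h6.le⟩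

lemma nonpos (H : NullSystem Λ) {γ₁ γ₂ γ γ' : Fin 4 → ℝ} (h₁ : γ₁ ∈ Λ) (h₂ : γ₂ ∈ Λ)
    (hneg : qform γ₁ γ₂ < 0) (h : γ ∈ Λ) (hy : qform γ (γ₁ + γ₂) < 0)
    (h' : γ' ∈ Λ) (hy' : qform γ' (γ₁ + γ₂) < 0) : qform γ γ' ≤ 0 := by
  obtain ⟨a, -⟩ := H.inner_nonpos h₁ h₂ h hneg hy
  obtain ⟨a', -⟩ := H.inner_nonpos h₁ h₂ h' hneg hy'
  have prop : ∀ {β β' : Fin 4 → ℝ}, β ∈ Λ → qform β (γ₁ + γ₂) < 0 → qform β' γ₁ ≤ 0 →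
      qform β γ₁ = 0 → qform β β' ≤ 0 := by
    intro β β' hβ hβy hβ' h0
    obtain ⟨c, -, rfl⟩ := H.proportional γ₁ h₁ β hβ (by rwa [qform_comm])
    rw [qform_add_right, h0, zero_add, qform_smul_left] at hβy
    have hc : 0 < c := by
      by_contra hcon
      push Not at hcon
      linarith [mul_nonneg_of_nonpos_of_nonpos hcon hneg.le]
    rw [qform_smul_left, qform_comm]
    exact mul_nonpos_of_nonneg_of_nonpos hc.le hβ'
  rcases a.lt_or_eq with b | b
  swap
  · exact prop h hy a' b
  rcases a'.lt_or_eq with b' | b'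
  swap
  · rw [qform_comm]; exact prop h' hy' a b'
  by_contra hcon
  push Not at hcon
  have h3 := H.triple γ h γ' h' γ₁ h₁ hcon.ne' b'.ne (by rw [qform_comm]; exact b.ne)
  rw [qform_comm γ₁ γ] at h3
  have h4 := mul_pos_of_neg_of_neg b' b
  nlinarith [mul_pos hcon h4]

end NullSystem

/-- The data of a maximal surface, without the time orientation. -/
def SpacelikeSurface.toMaxSurf (S : SpacelikeSurface) (h : S.IsMaximal) : MaxSurf where
  x := S.emb
  n := S.normal
  B := S.shape
  smooth_x := S.smooth_emb
  smooth_n := S.smooth_normal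
  inj := S.inj
  quad := S.on_quadric
  spacelike := S.spacelike
  unit := S.normal_unit
  orth_base := S.normal_orth_base
  orth := S.normal_orth
  shape_spec := S.shape_spec
  trace_zero := h

lemma continuous_projPt : Continuous fun v : {v : Fin 4 → ℝ // v ≠ 0} => projPt v.1 v.2 :=
  continuous_quotient_mk'

lemma projPt_mem_closure {A : Set RP3} {ν : Fin 4 → ℝ} (hν : ν ≠ 0) (h : ν ∈ closure (lifts A)) :
    projPt ν hν ∈ closure A := by
  refine mem_closure_iff.2 fun U hU hνU => ?_
  have h1 : IsOpen (Subtype.val '' ((fun v : {v : Fin 4 → ℝ // v ≠ 0} => projPt v.1 v.2) ⁻¹' U)) :=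
    (isOpen_compl_singleton (x := (0 : Fin 4 → ℝ))).isOpenMap_subtype_val _
      (hU.preimage continuous_projPt)
  obtain ⟨z, ⟨⟨z', hz'⟩, hz'U, rfl⟩, hz, hzA⟩ := mem_closure_iff.1 h _ h1 ⟨⟨ν, hν⟩, hνU, rfl⟩
  exact ⟨_, hz'U, hzA⟩

lemma projPt_eq_iff {x y : Fin 4 → ℝ} (hx : x ≠ 0) (hy : y ≠ 0) :
    projPt x hx = projPt y hy ↔ ∃ c : ℝ, c ≠ 0 ∧ x = c • y := by
  rw [projPt, projPt, Projectivization.mk_eq_mk_iff']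
  constructor
  · rintro ⟨c, hc⟩
    refine ⟨c, ?_, hc.symm⟩
    rintro rfl
    rw [zero_smul] at hc
    exact hx hc.symm
  · rintro ⟨c, -, hc⟩
    exact ⟨c, hc.symm⟩

lemma exists_asymptotic (S : SpacelikeSurface) (hS : S.IsMaximal) {φ : RP1 → RP1}
    (hφ : Function.Injective φ) (ho : OrientationPreserving φ)
    (hb : S.bdryAtInfinity = grGraph φ) :
    ∃ y, (∀ γ ∈ lifts (grGraph φ), qform γ y ≠ 0) ∧
      Asymptotic (S.toMaxSurf hS) {γ | γ ∈ lifts (grGraph φ) ∧ qform γ y < 0} := by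
  have H := nullSystem_lifts hφ ho
  obtain ⟨γ₁, h₁, γ₂, h₂, hneg⟩ := H.exists_pair
  have hne : ∀ γ ∈ lifts (grGraph φ), qform γ (γ₁ + γ₂) ≠ 0 :=
    fun γ h => H.inner_ne_zero h₁ h₂ h hneg
  have hx0 : ∀ s, S.emb s ≠ 0 := by
    intro s h
    have := S.on_quadric s
    rw [h] at this
    simp at this
  have lim : ∀ (ν : Fin 4 → ℝ) (hν : ν ≠ 0), projPt ν hν ∈ closure S.proj →
      ν ∈ lifts (grGraph φ) ∨ ∃ (s : Fin 2 → ℝ) (r : ℝ), ν = r • S.emb s := by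
    intro ν hν h
    by_cases hp : projPt ν hν ∈ S.proj
    · obtain ⟨s, hs, e⟩ := hp
      obtain ⟨c, -, hc⟩ := (projPt_eq_iff hν hs).1 e.symm
      exact Or.inr ⟨s, c, hc⟩
    · refine Or.inl ⟨hν, ?_⟩
      rw [← hb]
      exact ⟨h, hp⟩
  refine ⟨γ₁ + γ₂, hne, ?_, ?_, ?_, ?_, ?_, ?_, ?_⟩
  · exact fun γ h => H.null γ h.1
  · intro γ h c hc
    refine ⟨H.smul_mem γ h.1 c hc.ne', ?_⟩
    rw [qform_smul_left]
    exact mul_neg_of_pos_of_neg hc h.2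
  · exact fun γ h γ' h' => H.nonpos h₁ h₂ hneg h.1 h.2 h'.1 h'.2
  · intro γ h γ' h' e
    obtain ⟨c, -, rfl⟩ := H.proportional γ h.1 γ' h'.1 e
    refine ⟨c, ?_, rfl⟩
    have h3 := h'.2
    have h4 := h.2
    rw [qform_smul_left] at h3
    by_contra hcon
    push Not at hcon
    linarith [mul_nonneg_of_nonpos_of_nonpos hcon h4.le]
  · refine ⟨γ₁, ⟨h₁, ?_⟩, γ₂, ⟨h₂, ?_⟩, hneg⟩
    · rw [qform_add_right, H.null γ₁ h₁]; linarith
    · rw [qform_add_right, H.null γ₂ h₂, qform_comm]; linarith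
  · intro c s ν hν ht
    have hcl : projPt ν hν ∈ closure S.proj := by
      refine projPt_mem_closure hν (mem_closure_of_tendsto ht ?_)
      filter_upwards [ht.eventually_ne hν] with k hk
      have hc : c k ≠ 0 := by
        intro h
        rw [h, zero_smul] at hk
        exact hk rfl
      exact ⟨hk, s k, hx0 _, ((projPt_eq_iff _ _).2 ⟨c k, hc, rfl⟩).symm⟩
    rcases lim ν hν hcl with h | h
    · rcases (hne ν h).lt_or_gt with h3 | h3
      · exact Or.inl ⟨h, h3⟩
      · refine Or.inr (Or.inl ⟨?_, ?_⟩)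
        · rw [← neg_one_smul ℝ]
          exact H.smul_mem ν h _ (by norm_num)
        · rw [qform_neg_left]; linarith
    · exact Or.inr (Or.inr h)
  · intro γ ν hγ hν ht
    have hn : qform ν ν = 0 := by
      have c1 : Continuous fun z : Fin 4 → ℝ => qform z z := continuous_qform continuous_id continuous_id
      have h3 := (c1.tendsto ν).comp ht
      refine tendsto_nhds_unique h3 (tendsto_const_nhds.congr fun k => ?_)
      exact (H.null _ (hγ k).1).symm
    have hle : qform ν (γ₁ + γ₂) ≤ 0 := by
      have c1 : Continuous fun z : Fin 4 → ℝ => qform z (γ₁ + γ₂) :=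
        continuous_qform continuous_id continuous_const
      exact le_of_tendsto ((c1.tendsto ν).comp ht) (Eventually.of_forall fun k => (hγ k).2.le)
    have hcl : projPt ν hν ∈ closure S.proj := by
      have h3 := projPt_mem_closure hν
        (mem_closure_of_tendsto ht (Eventually.of_forall fun k => (hγ k).1))
      rw [← hb] at h3
      exact isClosed_closure.closure_subset_iff.2 sdiff_subset h3
    rcases lim ν hν hcl with h | ⟨s, r, rfl⟩
    · exact ⟨h, hle.lt_of_ne (hne ν h)⟩
    · exfalso
      rw [qform_smul_left, qform_smul_right, S.on_quadric] at hn
      have : r = 0 := by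
        by_contra hr
        apply mul_ne_zero hr hr
        linarith
      rw [this, zero_smul] at hν
      exact hν rfl

lemma tendsto_toBoundary {v w : ℕ → Fin 2 → ℝ} {v₀ w₀ : Fin 2 → ℝ} (hv : Tendsto v atTop (𝓝 v₀))
    (hw : Tendsto w atTop (𝓝 w₀)) :
    Tendsto (fun k => toBoundary (v k) (w k)) atTop (𝓝 (toBoundary v₀ w₀)) := by
  have h := hv.prodMk_nhds hw
  have h' := continuous_toBoundary.continuousAt.tendsto.comp h
  simpa only [Function.comp_def] using h'

namespace Asymptotic
variable {S : MaxSurf} {G : Set (Fin 4 → ℝ)}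

lemma isClosed_nonneg (A : Asymptotic S G) (L : (Fin 4 → ℝ) →ₗ[ℝ] ℝ) :
    IsClosed {v : {v : Fin 2 → ℝ // v ≠ 0} | ∃ w, toBoundary v w ∈ G ∧ 0 ≤ L (toBoundary v w)} := by
  refine IsSeqClosed.isClosed fun v v₀ hv hlim => ?_
  have hv' : ∀ k, ∃ w, ‖w‖ = 1 ∧ toBoundary (v k) w ∈ G ∧ 0 ≤ L (toBoundary (v k) w) := by
    intro k
    obtain ⟨w, hw, hwL⟩ := hv k
    have hw0 : w ≠ 0 := by
      rintro rfl
      refine A.ne_zero hw ?_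
      ext i; fin_cases i <;> simp [toBoundary]
    have hn : 0 < ‖w‖⁻¹ := inv_pos.2 (norm_pos_iff.2 hw0)
    refine ⟨‖w‖⁻¹ • w, ?_, ?_, ?_⟩
    · rw [norm_smul, norm_inv, norm_norm, inv_mul_cancel₀ (norm_ne_zero_iff.2 hw0)]
    · rw [toBoundary_smul_right]
      exact A.smul_mem _ hw _ hn
    · rw [toBoundary_smul_right, map_smul]
      exact mul_nonneg hn.le hwL
  choose w hw1 hwG hwL using hv'
  obtain ⟨w₀, hw₀, θ, hθ, hθl⟩ := (isCompact_sphere (0 : Fin 2 → ℝ) 1).tendsto_subseq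
    (x := w) fun k => by simpa using hw1 k
  have hw₀0 : w₀ ≠ 0 := by
    rintro rfl
    simp at hw₀
  have h1 : Tendsto (fun k => (v (θ k) : Fin 2 → ℝ)) atTop (𝓝 (v₀ : Fin 2 → ℝ)) :=
    (continuous_subtype_val.tendsto v₀).comp (hlim.comp hθ.tendsto_atTop)
  have h2 : Tendsto (fun k => toBoundary (v (θ k)) (w (θ k))) atTop (𝓝 (toBoundary v₀ w₀)) :=
    tendsto_toBoundary h1 hθl
  refine ⟨w₀, A.closed _ _ (fun k => hwG (θ k)) (toBoundary_ne_zero v₀.2 hw₀0) h2, ?_⟩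
  have hL : Continuous L := L.continuous_of_finiteDimensional
  have h3 : Tendsto (fun k => L (toBoundary (v (θ k)) (w (θ k)))) atTop
      (𝓝 (L (toBoundary v₀ w₀))) := (hL.tendsto _).comp h2
  exact ge_of_tendsto' h3 fun k => hwL (θ k)

lemma sign_const (A : Asymptotic S G) (hG : ∀ γ ∈ G, ∃ v w, v ≠ 0 ∧ γ = toBoundary v w)
    (hv : ∀ v, v ≠ 0 → ∃ w, toBoundary v w ∈ G) (L : (Fin 4 → ℝ) →ₗ[ℝ] ℝ)
    (hL : ∀ γ ∈ G, L γ ≠ 0) : (∀ γ ∈ G, 0 < L γ) ∨ ∀ γ ∈ G, L γ < 0 := by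
  have uniq : ∀ {v w w' : Fin 2 → ℝ}, toBoundary v w ∈ G → toBoundary v w' ∈ G →
      ∃ c : ℝ, 0 < c ∧ toBoundary v w' = c • toBoundary v w := by
    intro v w w' h h'
    refine A.proportional _ h _ h' ?_
    rw [qform_toBoundary]
    simp [det2]; left; ring
  have hconn : PreconnectedSpace {v : Fin 2 → ℝ // v ≠ 0} := by
    refine Subtype.preconnectedSpace (s := {v : Fin 2 → ℝ | v ≠ 0}) ?_
    exact (isConnected_compl_singleton_of_one_lt_rank (by simp) (0 : Fin 2 → ℝ)).isPreconnected
  have c1 := A.isClosed_nonneg L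
  have c2 := A.isClosed_nonneg (-L)
  have hcompl : {v : {v : Fin 2 → ℝ // v ≠ 0} | ∃ w, toBoundary v w ∈ G ∧ 0 ≤ L (toBoundary v w)}ᶜ =
      {v : {v : Fin 2 → ℝ // v ≠ 0} | ∃ w, toBoundary v w ∈ G ∧ 0 ≤ (-L) (toBoundary v w)} := by
    ext v
    constructor
    · intro h
      obtain ⟨w, hw⟩ := hv v v.2
      refine ⟨w, hw, ?_⟩
      by_contra hcon
      refine h ⟨w, hw, ?_⟩
      simp at hcon
      exact hcon.le
    · rintro ⟨w, hw, hwL⟩ ⟨w', hw', hwL'⟩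
      obtain ⟨c, hc, e⟩ := uniq hw hw'
      rw [e, map_smul, smul_eq_mul] at hwL'
      have h3 := hL _ hw
      simp at hwL
      have h4 := mul_neg_of_pos_of_neg hc (hwL.lt_of_ne h3)
      linarith
  have clopen : IsClopen {v : {v : Fin 2 → ℝ // v ≠ 0} |
      ∃ w, toBoundary v w ∈ G ∧ 0 ≤ L (toBoundary v w)} :=
    ⟨c1, by rw [← isClosed_compl_iff, hcompl]; exact c2⟩
  rcases isClopen_iff.1 clopen with h | h
  · right
    intro γ hγ
    obtain ⟨v, w, hv0, rfl⟩ := hG γ hγ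
    refine lt_of_not_ge fun hcon => ?_
    have : (⟨v, hv0⟩ : {v : Fin 2 → ℝ // v ≠ 0}) ∈ (∅ : Set {v : Fin 2 → ℝ // v ≠ 0}) := by
      rw [← h]; exact ⟨w, hγ, hcon⟩
    exact this
  · left
    intro γ hγ
    obtain ⟨v, w, hv0, rfl⟩ := hG γ hγ
    have : (⟨v, hv0⟩ : {v : Fin 2 → ℝ // v ≠ 0}) ∈ (univ : Set {v : Fin 2 → ℝ // v ≠ 0}) := mem_univ _
    rw [← h] at this
    obtain ⟨w', hw', hL'⟩ := this
    obtain ⟨c, hc, e⟩ := uniq hw' hγ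
    rw [e, map_smul, smul_eq_mul]
    exact mul_pos hc (hL'.lt_of_ne (hL _ hw').symm)

end Asymptotic

/-- The linear functional associated with a vector by the bilinear form. -/
def qformLin (y : Fin 4 → ℝ) : (Fin 4 → ℝ) →ₗ[ℝ] ℝ where
  toFun z := qform z y
  map_add' a b := qform_add_left a b y
  map_smul' c a := qform_smul_left c a y

lemma hull_iff {M : MaxSurf} {φ : RP1 → RP1} {y : Fin 4 → ℝ} (H : NullSystem (lifts (grGraph φ)))
    (hy : ∀ γ ∈ lifts (grGraph φ), qform γ y ≠ 0)
    (A : Asymptotic M {γ | γ ∈ lifts (grGraph φ) ∧ qform γ y < 0}) {z : Fin 4 → ℝ} (hz : z ≠ 0) :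
    projPt z hz ∈ projConvexHull (grGraph φ) ↔
      ∃ r : ℝ, r ≠ 0 ∧ r • z ∈ convexHull ℝ {γ | γ ∈ lifts (grGraph φ) ∧ qform γ y < 0} := by
  set G := {γ | γ ∈ lifts (grGraph φ) ∧ qform γ y < 0}
  have hneg : ∀ γ ∈ lifts (grGraph φ), γ ∈ G ∨ -γ ∈ G := by
    intro γ h
    rcases (hy γ h).lt_or_gt with h1 | h1
    · exact Or.inl ⟨h, h1⟩
    · refine Or.inr ⟨?_, ?_⟩
      · rw [← neg_one_smul ℝ]
        exact H.smul_mem γ h _ (by norm_num)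
      · rw [qform_neg_left]; linarith
  have hneg' : ∀ γ ∈ G, -γ ∈ lifts (grGraph φ) := by
    intro γ h
    rw [← neg_one_smul ℝ]
    exact H.smul_mem γ h.1 _ (by norm_num)
  constructor
  · rintro ⟨L, hL, z', hz', e, hmem⟩
    obtain ⟨c, hc, rfl⟩ := (projPt_eq_iff hz' hz).1 e
    have hs := A.sign_const (fun γ h => by
        obtain ⟨v, w, hv, -, e, -⟩ := mem_lifts_grGraph.1 h.1
        exact ⟨v, w, hv, e⟩)
      (fun v hv => by
        have h := mem_lifts_grGraph.2 ⟨v, _, hv, (φ (Projectivization.mk ℝ v hv)).rep_nonzero, rfl,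
          (Projectivization.mk_rep _).symm⟩
        rcases hneg _ h with h1 | h1
        · exact ⟨_, h1⟩
        · refine ⟨-(φ (Projectivization.mk ℝ v hv)).rep, ?_⟩
          rw [← neg_one_smul ℝ, toBoundary_smul_right, neg_one_smul]
          exact h1)
      L (fun γ h => hL γ h.1)
    rcases hs with hs | hs
    · refine ⟨c, hc, convexHull_mono ?_ hmem⟩
      rintro γ ⟨h1, h2⟩
      rcases hneg γ h1 with h3 | h3
      · exact h3
      · have := hs _ h3
        rw [map_neg] at this
        linarith
    · refine ⟨-c, neg_ne_zero.2 hc, ?_⟩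
      have hsub : {x | x ∈ lifts (grGraph φ) ∧ 0 < L x} ⊆ -convexHull ℝ G := by
        rintro γ ⟨h1, h2⟩
        rcases hneg γ h1 with h3 | h3
        · have := hs _ h3
          linarith
        · exact subset_convexHull ℝ G h3
      have := convexHull_min hsub (convex_convexHull ℝ G).neg hmem
      rw [neg_smul]
      exact this
  · rintro ⟨r, hr, h⟩
    refine ⟨-qformLin y, fun x hx => ?_, r • z, smul_ne_zero hr hz,
      (projPt_eq_iff _ _).2 ⟨r, hr, rfl⟩, convexHull_mono ?_ h⟩
    · have := hy x hx
      simpa [qformLin] using this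
    · rintro γ ⟨h1, h2⟩
      exact ⟨h1, by simpa [qformLin] using h2⟩

/-- The lifts of the asymptotic boundary of an entire maximal surface, chosen coherently and on the
side determined by the surface. -/
lemma exists_positive (S : SpacelikeSurface) (hS : S.IsMaximal) {φ : RP1 → RP1}
    (hφ : Function.Injective φ) (ho : OrientationPreserving φ)
    (hb : S.bdryAtInfinity = grGraph φ) :
    ∃ G, Positive (S.toMaxSurf hS) G ∧ ∀ (z : Fin 4 → ℝ) (hz : z ≠ 0),
      projPt z hz ∈ projConvexHull (grGraph φ) ↔ ∃ r : ℝ, r ≠ 0 ∧ r • z ∈ convexHull ℝ G := by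
  have H := nullSystem_lifts hφ ho
  obtain ⟨y, hy, A⟩ := exists_asymptotic S hS hφ ho hb
  rcases A.positive_or with P | P
  · exact ⟨_, P, fun z hz => hull_iff H hy A hz⟩
  · have e : {γ | -γ ∈ {γ | γ ∈ lifts (grGraph φ) ∧ qform γ y < 0}} =
        {γ | γ ∈ lifts (grGraph φ) ∧ qform γ (-y) < 0} := by
      ext γ
      have h : -γ ∈ lifts (grGraph φ) ↔ γ ∈ lifts (grGraph φ) := by
        constructor
        · intro h
          have := H.smul_mem _ h (-1) (by norm_num)
          simpa using this
        · intro h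
          have := H.smul_mem _ h (-1) (by norm_num)
          simpa using this
      simp only [mem_ofPred_eq, h, qform_neg_left, qform_neg_right]
    rw [e] at P
    refine ⟨_, P, fun z hz => hull_iff H (fun γ h => ?_) P.toAsymptotic hz⟩
    rw [qform_neg_right]
    exact neg_ne_zero.2 (hy γ h)

lemma exists_qform_eq (f : (Fin 4 → ℝ) →ₗ[ℝ] ℝ) : ∃ p, ∀ z, f z = qform z p := by
  refine ⟨![f (Pi.single 0 1), f (Pi.single 1 1), -f (Pi.single 2 1), -f (Pi.single 3 1)],
    fun z => ?_⟩
  rw [LinearMap.pi_apply_eq_sum_univ f z, Fin.sum_univ_four]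
  have e : ∀ i : Fin 4, (fun j => if i = j then (1 : ℝ) else 0) = Pi.single i 1 := by
    intro i; ext j; simp [Pi.single_apply, eq_comm]
  simp [qform, e]

lemma isCompact_convexHull_of_isCompact {K : Set (Fin 4 → ℝ)} (hK : IsCompact K) :
    IsCompact (convexHull ℝ K) := by
  have h1 : IsCompact (stdSimplex ℝ (Fin 5) ×ˢ Set.univ.pi fun _ : Fin 5 => K) :=
    (isCompact_stdSimplex ℝ (Fin 5)).prod (isCompact_univ_pi fun _ => hK)
  have h2 : Continuous fun z : (Fin 5 → ℝ) × (Fin 5 → Fin 4 → ℝ) => ∑ i, z.1 i • z.2 i := by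
    fun_prop
  convert h1.image h2 using 1
  ext x
  constructor
  · intro hx
    obtain ⟨ι, _, z, w, hz, hind, hw, hw1, rfl⟩ := eq_pos_convex_span_of_mem_convexHull hx
    have hcard : Fintype.card ι ≤ Fintype.card (Fin 5) := by
      have := hind.card_le_finrank_succ
      have h3 := Submodule.finrank_le (vectorSpan ℝ (range z))
      simp at h3 ⊢
      omega
    obtain ⟨e⟩ := Function.Embedding.nonempty_of_card_le hcard
    have hne : Nonempty ι := by
      by_contra hcon
      rw [not_nonempty_iff] at hcon
      simp at hw1
    obtain ⟨i₀⟩ := hne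
    refine ⟨(Function.extend e w 0, Function.extend e z fun _ => z i₀), ⟨⟨?_, ?_⟩, ?_⟩, ?_⟩
    · intro j
      by_cases h : ∃ i, e i = j
      · obtain ⟨i, rfl⟩ := h
        simp only [e.injective.extend_apply]
        exact (hw i).le
      · simp [Function.extend_apply' _ _ _ h]
    · rw [← hw1]
      refine (Fintype.sum_of_injective e e.injective _ _ (fun j hj => ?_) fun i => ?_).symm
      · exact Function.extend_apply' _ _ _ hj
      · exact (e.injective.extend_apply _ _ _).symm
    · intro j _
      by_cases h : ∃ i, e i = j
      · obtain ⟨i, rfl⟩ := h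
        simp only [e.injective.extend_apply]
        exact hz (mem_range_self i)
      · simp only [Function.extend_apply' _ _ _ h]
        exact hz (mem_range_self i₀)
    · refine (Fintype.sum_of_injective e e.injective _ _ (fun j hj => ?_) fun i => ?_).symm
      · simp only [Function.extend_apply' _ _ _ hj, Pi.zero_apply, zero_smul]
      · simp only [e.injective.extend_apply]
  · rintro ⟨⟨w, z⟩, ⟨⟨hw, hw1⟩, hz⟩, rfl⟩
    exact (convex_convexHull ℝ K).sum_mem (fun i _ => hw i) hw1
      fun i _ => subset_convexHull ℝ K (hz i (mem_univ i))

namespace Positive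
variable {S : MaxSurf} {G : Set (Fin 4 → ℝ)}

lemma smul_mem_hull (A : Positive S G) {z : Fin 4 → ℝ} (hz : z ∈ convexHull ℝ G) {c : ℝ}
    (hc : 0 < c) : c • z ∈ convexHull ℝ G := by
  have hsub : G ⊆ (fun z : Fin 4 → ℝ => c • z) ⁻¹' convexHull ℝ G :=
    fun γ hγ => subset_convexHull ℝ G (A.smul_mem γ hγ c hc)
  exact convexHull_min hsub ((convex_convexHull ℝ G).linear_preimage (LinearMap.lsmul ℝ _ c)) hz

lemma comb_mem_hull (A : Positive S G) {z z' : Fin 4 → ℝ} (hz : z ∈ convexHull ℝ G)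
    (hz' : z' ∈ convexHull ℝ G) {a b : ℝ} (ha : 0 ≤ a) (hb : 0 ≤ b) (hab : 0 < a + b) :
    a • z + b • z' ∈ convexHull ℝ G := by
  have h := A.smul_mem_hull (convex_convexHull ℝ G hz hz' (div_nonneg ha hab.le)
    (div_nonneg hb hab.le) (by rw [← add_div, div_self hab.ne'])) hab
  rw [smul_add, smul_smul, smul_smul, mul_div_cancel₀ _ hab.ne', mul_div_cancel₀ _ hab.ne'] at h
  exact h

lemma isCompact_unit (A : Positive S G) : IsCompact {γ | γ ∈ G ∧ ‖γ‖ = 1} := by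
  refine (isCompact_sphere (0 : Fin 4 → ℝ) 1).of_isClosed_subset ?_ fun γ h => by simpa using h.2
  refine IsSeqClosed.isClosed fun γ ν hγ hlim => ?_
  have h1 : ‖ν‖ = 1 :=
    tendsto_nhds_unique hlim.norm (tendsto_const_nhds.congr fun k => (hγ k).2.symm)
  refine ⟨A.closed γ ν (fun k => (hγ k).1) ?_ hlim, h1⟩
  rintro rfl
  simp at h1

/-- The bipolar theorem for the cone over the asymptotic boundary. -/
lemma mem_hull_of_dual (A : Positive S G) {Y y : Fin 4 → ℝ} (hy : ∀ γ ∈ G, qform y γ < 0)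
    (hYy : qform Y y < 0) (hY : ∀ p, (∀ γ ∈ G, qform p γ ≤ 0) → qform Y p ≤ 0) :
    Y ∈ convexHull ℝ G := by
  set K := (fun γ : Fin 4 → ℝ => (-qform γ y)⁻¹ • γ) '' {γ | γ ∈ G ∧ ‖γ‖ = 1}
  have hK : IsCompact K := by
    refine A.isCompact_unit.image_of_continuousOn ?_
    have c1 : Continuous fun γ : Fin 4 → ℝ => -qform γ y :=
      (continuous_qform continuous_id continuous_const).neg
    refine ContinuousOn.smul (c1.continuousOn.inv₀ fun γ hγ => ?_) continuousOn_id
    have := hy γ hγ.1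
    rw [qform_comm] at this
    exact (neg_pos.2 this).ne'
  have hKG : K ⊆ G := by
    rintro - ⟨γ, hγ, rfl⟩
    have := hy γ hγ.1
    rw [qform_comm] at this
    exact A.smul_mem γ hγ.1 _ (inv_pos.2 (neg_pos.2 this))
  have hGK : ∀ γ ∈ G, (-qform γ y)⁻¹ • γ ∈ K := by
    intro γ hγ
    have h1 := hy γ hγ
    rw [qform_comm] at h1
    have h0 := norm_pos_iff.2 (A.ne_zero hγ)
    refine ⟨‖γ‖⁻¹ • γ, ⟨A.smul_mem γ hγ _ (inv_pos.2 h0), ?_⟩, ?_⟩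
    · rw [norm_smul, norm_inv, norm_norm, inv_mul_cancel₀ h0.ne']
    · simp only [qform_smul_left, smul_smul]
      congr 1
      field_simp
  obtain ⟨k, hk, rfl⟩ : ∃ k : ℝ, 0 < k ∧ k = (-qform Y y)⁻¹ := ⟨_, inv_pos.2 (neg_pos.2 hYy), rfl⟩
  suffices h : (-qform Y y)⁻¹ • Y ∈ convexHull ℝ K by
    have h1 := A.smul_mem_hull (convexHull_mono hKG h) (neg_pos.2 hYy)
    rwa [smul_smul, mul_inv_cancel₀ (neg_pos.2 hYy).ne', one_smul] at h1
  by_contra hcon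
  obtain ⟨f, u, hf, hu⟩ := geometric_hahn_banach_closed_point (convex_convexHull ℝ K)
    (isCompact_convexHull_of_isCompact hK).isClosed hcon
  obtain ⟨p, hp⟩ := exists_qform_eq (f : (Fin 4 → ℝ) →ₗ[ℝ] ℝ)
  simp only [ContinuousLinearMap.coe_coe] at hp
  have h1 := hY (p + u • y) fun γ hγ => by
    have h2 := hf _ (subset_convexHull ℝ K (hGK γ hγ))
    have h3 := hy γ hγ
    rw [qform_comm] at h3
    rw [hp, qform_smul_left, inv_mul_lt_iff₀ (neg_pos.2 h3)] at h2
    rw [qform_comm, qform_add_right, qform_smul_right]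
    linarith
  rw [hp, qform_smul_left, lt_inv_mul_iff₀ (neg_pos.2 hYy)] at hu
  rw [qform_add_right, qform_smul_right] at h1
  linarith

/-- The convex hull contains timelike segments of length close to `π / 2` around points where the
principal curvatures are close to one. -/
lemma mem_hull_of_ell (A : Positive S G) (hell : ∀ s, S.ell s ≤ 1) {s : Fin 2 → ℝ}
    (hs : 0 < S.ell s) {σ : ℝ} (hσ : 0 < σ) (hσ1 : σ ≤ 1 / 2)
    (hsmall : -(1 / 2 * Real.log (S.ell s)) ≤ σ ^ 32 / 2 ^ 22) :
    (1 + 5 * σ) • S.x s + S.n s ∈ convexHull ℝ G := by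
  have key : ∀ p, (∀ γ ∈ G, qform p γ ≤ 0) →
      qform (S.n s) p ≤ (1 + 4 * σ) * -qform (S.x s) p := by
    intro p hp
    have hx := A.inner_nonpos hp s
    rcases le_or_gt (qform (S.n s) p + qform (S.x s) p) 0 with h | h
    · nlinarith
    have hB : 0 < qform (S.n s) p - qform (S.x s) p := by linarith
    have h1 := (A.tilt_le_log_ell hell hp hs h).trans hsmall
    have h2 := (div_le_div_iff_of_pos_right (by norm_num)).1 h1
    have h3 := (pow_le_pow_iff_left₀ (div_pos h hB).le hσ.le (by norm_num)).1 h2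
    rw [div_le_iff₀ hB] at h3
    nlinarith [mul_nonneg hσ.le (neg_nonneg.2 hx),
      mul_nonneg (mul_nonneg hσ.le (neg_nonneg.2 hx)) (sub_nonneg.2 hσ1)]
  obtain ⟨y, -, hyG, hyx⟩ := A.exists_base
  refine A.mem_hull_of_dual hyG ?_ fun p hp => ?_
  · rw [qform_add_left, qform_smul_left]
    have h1 := key y fun γ h => (hyG γ h).le
    nlinarith [mul_pos hσ (neg_pos.2 (hyx s))]
  · rw [qform_add_left, qform_smul_left]
    have h1 := key p hp
    have hx := A.inner_nonpos hp s
    nlinarith [mul_nonneg hσ.le (neg_nonneg.2 hx)]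

lemma segment_mem_hull (A : Positive S G) (hell : ∀ s, S.ell s ≤ 1) {s : Fin 2 → ℝ}
    (hs : 0 < S.ell s) {σ : ℝ} (hσ : 0 < σ) (hσ1 : σ ≤ 1 / 2)
    (hsmall : -(1 / 2 * Real.log (S.ell s)) ≤ σ ^ 32 / 2 ^ 22) {β : ℝ}
    (hβ : |β| ≤ Real.arctan (1 / (1 + 5 * σ))) :
    Real.cos β • S.x s + Real.sin β • S.n s ∈ convexHull ℝ G := by
  have h₁ := A.mem_hull_of_ell hell hs hσ hσ1 hsmall
  have h₂ := A.flip.mem_hull_of_ell (S := S.flip) (s := s) (fun s => by rw [S.ell_flip]; exact hell s)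
    (by rw [S.ell_flip]; exact hs) hσ hσ1 (by rw [S.ell_flip]; exact hsmall)
  have h₂' : (1 + 5 * σ) • S.x s + -S.n s ∈ convexHull ℝ G := h₂
  set α := Real.arctan (1 / (1 + 5 * σ))
  have hα : Real.sin α = Real.cos α / (1 + 5 * σ) := by
    have := Real.tan_mul_cos (Real.cos_arctan_pos (1 / (1 + 5 * σ))).ne'
    rw [Real.tan_arctan] at this
    rw [← this]; ring
  have hα0 : 0 < Real.cos α := Real.cos_arctan_pos _
  have hα1 : α < π / 2 := Real.arctan_lt_pi_div_two _
  rw [abs_le] at hβ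
  have hn : ∀ β, -α ≤ β → β ≤ α → 0 ≤ Real.cos β / (1 + 5 * σ) + Real.sin β := by
    intro β h h'
    have h1 : 0 ≤ Real.sin (α + β) :=
      Real.sin_nonneg_of_nonneg_of_le_pi (by linarith) (by linarith)
    rw [Real.sin_add, hα] at h1
    have h2 : Real.cos α / (1 + 5 * σ) * Real.cos β + Real.cos α * Real.sin β =
        Real.cos α * (Real.cos β / (1 + 5 * σ) + Real.sin β) := by ring
    rw [h2] at h1
    exact nonneg_of_mul_nonneg_right h1 hα0
  have a₁ := hn β hβ.1 hβ.2
  have a₂ := hn (-β) (by linarith) (by linarith)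
  rw [Real.cos_neg, Real.sin_neg] at a₂
  have hc : 0 < Real.cos β := Real.cos_pos_of_mem_Ioo ⟨by linarith, by linarith⟩
  have hsig : 0 < 1 + 5 * σ := by linarith
  have hsum : 0 < Real.cos β / (1 + 5 * σ) := by positivity
  have := A.comb_mem_hull h₁ h₂' (div_nonneg a₁ zero_le_two) (div_nonneg a₂ zero_le_two)
    (by linarith)
  convert this using 1
  simp only [smul_add, smul_smul, smul_neg]
  ext i
  simp
  field_simp
  ring

end Positive

namespace Positive
variable {S : MaxSurf} {G : Set (Fin 4 → ℝ)} {Γ : Set RP3}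

/-- The convex hull of the asymptotic boundary of a maximal surface with principal curvatures
bounded away from one has width less than `π / 2`. -/
lemma length_le (A : Positive S G) {Λ : ℝ} (hΛ : ∀ s, Real.sqrt (S.ell s) ≤ Λ) (hΛ1 : Λ < 1)
    (hull : ∀ (z : Fin 4 → ℝ) (hz : z ≠ 0),
      projPt z hz ∈ projConvexHull Γ ↔ ∃ r : ℝ, r ≠ 0 ∧ r • z ∈ convexHull ℝ G)
    {T : ℝ} (hT0 : 0 ≤ T) {a b : Fin 4 → ℝ} (ha : qform a a = -1) (hb : qform b b = -1)
    (hab : qform a b = 0)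
    (h : ∀ t ∈ Icc (0 : ℝ) T, ∃ h : (Real.cos t • a + Real.sin t • b) ≠ 0,
        projPt (Real.cos t • a + Real.sin t • b) h ∈ projConvexHull Γ) :
    T < π / 2 ∧ T ≤ Real.arccos ((1 - Λ ^ 2) / (1 + Λ ^ 2)) := by
  have hΛ0 : 0 ≤ Λ := (Real.sqrt_nonneg _).trans (hΛ 0)
  have hc0 : 0 < (1 - Λ ^ 2) / (1 + Λ ^ 2) := div_pos (by nlinarith) (by positivity)
  have hba : qform b a = 0 := by rwa [qform_comm]
  have unit : ∀ t : ℝ, qform (Real.cos t • a + Real.sin t • b) (Real.cos t • a + Real.sin t • b) = -1 := by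
    intro t
    simp only [qform_add_left, qform_add_right, qform_smul_left, qform_smul_right, ha, hb, hab, hba]
    nlinarith [Real.sin_sq_add_cos_sq t]
  have mem : ∀ t ∈ Icc (0 : ℝ) T, ∃ e : ℝ, e ^ 2 = 1 ∧
      e • (Real.cos t • a + Real.sin t • b) ∈ convexHull ℝ G := by
    intro t ht
    obtain ⟨h0, h1⟩ := h t ht
    obtain ⟨r, hr, h2⟩ := (hull _ h0).1 h1
    refine ⟨|r|⁻¹ * r, ?_, ?_⟩
    · rw [mul_pow, inv_pow, sq_abs, inv_mul_cancel₀ (pow_ne_zero 2 hr)]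
    · rw [← smul_smul]
      exact A.smul_mem_hull h2 (inv_pos.2 (abs_pos.2 hr))
  have key : ∀ t ∈ Icc (0 : ℝ) T, (1 - Λ ^ 2) / (1 + Λ ^ 2) ≤ |Real.cos t| := by
    intro t ht
    obtain ⟨e₀, he₀, h₀⟩ := mem 0 ⟨le_rfl, hT0⟩
    obtain ⟨e, he, h₁⟩ := mem t ht
    have h2 := A.inner_hull_le hΛ hΛ1 h₀ h₁
      (by rw [qform_smul_left, qform_smul_right, unit]; linarith)
      (by rw [qform_smul_left, qform_smul_right, unit]; linarith)
    simp only [Real.cos_zero, Real.sin_zero, one_smul, zero_smul, add_zero, qform_add_right,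
      qform_smul_left, qform_smul_right, ha, hab] at h2
    have h3 : |e₀ * e| = 1 := by
      rw [← sq_eq_sq₀ (abs_nonneg _) zero_le_one, sq_abs, mul_pow, he₀, he]; norm_num
    have h4 : |Real.cos t| = |e₀ * e * Real.cos t| := by rw [abs_mul, h3, one_mul]
    rw [h4]
    refine le_trans ?_ (le_abs_self _)
    linarith
  have hlt : T < π / 2 := by
    by_contra hcon
    have := key (π / 2) ⟨by positivity, not_lt.1 hcon⟩
    rw [Real.cos_pi_div_two, abs_zero] at this
    linarith
  refine ⟨hlt, ?_⟩
  have h5 := key T ⟨hT0, le_rfl⟩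
  rw [abs_of_pos (Real.cos_pos_of_mem_Ioo ⟨by linarith [Real.pi_pos], hlt⟩)] at h5
  rw [← Real.arccos_cos hT0 (by linarith [Real.pi_pos])]
  exact Real.arccos_le_arccos h5

lemma le_tan_width (A : Positive S G) {Λ : ℝ} (hΛ : ∀ s, Real.sqrt (S.ell s) ≤ Λ) (hΛ1 : Λ < 1)
    (hull : ∀ (z : Fin 4 → ℝ) (hz : z ≠ 0),
      projPt z hz ∈ projConvexHull Γ ↔ ∃ r : ℝ, r ≠ 0 ∧ r • z ∈ convexHull ℝ G)
    {s : Fin 2 → ℝ} (hs : 0 < S.ell s) {σ : ℝ} (hσ : 0 < σ) (hσ1 : σ ≤ 1 / 2)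
    (hsmall : -(1 / 2 * Real.log (S.ell s)) ≤ σ ^ 32 / 2 ^ 22) :
    1 / (5 * σ) ≤ Real.tan (width Γ) := by
  have hΛ0 : 0 ≤ Λ := (Real.sqrt_nonneg _).trans (hΛ 0)
  have hc0 : 0 < (1 - Λ ^ 2) / (1 + Λ ^ 2) := div_pos (by nlinarith) (by positivity)
  have hell : ∀ s, S.ell s ≤ 1 := fun s => by
    have h := (hΛ s).trans hΛ1.le
    rwa [Real.sqrt_le_one] at h
  set α := Real.arctan (1 / (1 + 5 * σ))
  have hx : 1 / (1 + 5 * σ) < 1 := by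
    rw [div_lt_one (by linarith)]; linarith
  have hα0 : 0 < α := Real.arctan_pos.2 (by positivity)
  have hα1 : α < π / 4 := by
    rw [← Real.arctan_one]
    exact Real.arctan_strictMono hx
  set W := {T : ℝ | 0 ≤ T ∧ T < π ∧ ∃ a b : Fin 4 → ℝ,
      qform a a = -1 ∧ qform b b = -1 ∧ qform a b = 0 ∧
      ∀ t ∈ Icc (0 : ℝ) T, ∃ h : (Real.cos t • a + Real.sin t • b) ≠ 0,
        projPt (Real.cos t • a + Real.sin t • b) h ∈ projConvexHull Γ} with hW
  have hWle : ∀ T ∈ W, T ≤ Real.arccos ((1 - Λ ^ 2) / (1 + Λ ^ 2)) := by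
    rintro T ⟨h0, -, a, b, ha, hb, hab, h⟩
    exact (A.length_le hΛ hΛ1 hull h0 ha hb hab h).2
  have hmem : 2 * α ∈ W := by
    have hxx := S.quad s
    have hnn := S.unit s
    have hnx := S.orth_base s
    have hxn : qform (S.x s) (S.n s) = 0 := by rwa [qform_comm]
    refine ⟨by linarith, by linarith [Real.pi_pos], Real.cos α • S.x s + Real.sin α • S.n s,
      Real.sin α • S.x s - Real.cos α • S.n s, ?_, ?_, ?_, fun t ht => ?_⟩
    · simp only [qform_add_left, qform_add_right, qform_smul_left, qform_smul_right, hxx, hnn, hnx, hxn]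
      nlinarith [Real.sin_sq_add_cos_sq α]
    · simp only [qform_sub_left, qform_sub_right, qform_smul_left, qform_smul_right, hxx, hnn, hnx, hxn]
      nlinarith [Real.sin_sq_add_cos_sq α]
    · simp only [qform_add_left, qform_sub_right, qform_smul_left, qform_smul_right, hxx, hnn, hnx, hxn]
      ring
    · have e : Real.cos t • (Real.cos α • S.x s + Real.sin α • S.n s) +
          Real.sin t • (Real.sin α • S.x s - Real.cos α • S.n s) =
          Real.cos (α - t) • S.x s + Real.sin (α - t) • S.n s := by
        rw [Real.cos_sub, Real.sin_sub]
        module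
      rw [e]
      have hne : Real.cos (α - t) • S.x s + Real.sin (α - t) • S.n s ≠ 0 := by
        intro h0
        have h1 : qform (Real.cos (α - t) • S.x s + Real.sin (α - t) • S.n s)
            (Real.cos (α - t) • S.x s + Real.sin (α - t) • S.n s) = -1 := by
          simp only [qform_add_left, qform_add_right, qform_smul_left, qform_smul_right,
            hxx, hnn, hnx, hxn]
          nlinarith [Real.sin_sq_add_cos_sq (α - t)]
        rw [h0] at h1
        simp at h1
      refine ⟨hne, (hull _ hne).2 ⟨1, one_ne_zero, ?_⟩⟩
      rw [one_smul]
      exact A.segment_mem_hull hell hs hσ hσ1 hsmall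
        (abs_le.2 ⟨by linarith [ht.2], by linarith [ht.1]⟩)
  have hw1 : 2 * α ≤ width Γ := le_csSup ⟨_, hWle⟩ hmem
  have hw2 : width Γ < π / 2 :=
    (csSup_le ⟨_, hmem⟩ hWle).trans_lt (Real.arccos_lt_pi_div_two.2 hc0)
  have hmono : Real.tan (2 * α) ≤ Real.tan (width Γ) := by
    rcases hw1.eq_or_lt with h | h
    · rw [h]
    · exact (Real.tan_lt_tan_of_lt_of_lt_pi_div_two (by linarith [Real.pi_pos]) hw2 h).le
  refine le_trans ?_ hmono
  rw [Real.tan_two_mul, Real.tan_arctan]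
  have h1 : 1 - (1 / (1 + 5 * σ)) ^ 2 = (10 * σ + 25 * σ ^ 2) / (1 + 5 * σ) ^ 2 := by
    field_simp; ring
  rw [h1]
  have h2 : 2 * (1 / (1 + 5 * σ)) / ((10 * σ + 25 * σ ^ 2) / (1 + 5 * σ) ^ 2) =
      2 * (1 + 5 * σ) / (10 * σ + 25 * σ ^ 2) := by
    field_simp
  rw [h2, div_le_div_iff₀ (by positivity) (by positivity)]
  nlinarith [sq_nonneg σ]

end Positive

/-- **Theorem B.** There exist universal constants `M > 0` and `δ ∈ (0,1)` such that if `S`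
is an entire maximal surface in AdS³ with `δ ≤ ‖λ‖∞ < 1`, whose asymptotic boundary is the
graph of an orientation-preserving homeomorphism with convex hull of width `w`, then
`tan w ≥ (1/(1−‖λ‖∞))^(1/M)`. -/
theorem tan_width_ge_of_large_principal_curvatures :
    ∃ M δ : ℝ, 0 < M ∧ 0 < δ ∧ δ < 1 ∧
      ∀ (S : SpacelikeSurface) (φ : RP1 ≃ₜ RP1),
        S.IsMaximal → S.IsEntire →
        OrientationPreserving ⇑φ →
        S.bdryAtInfinity = grGraph ⇑φ →
        δ ≤ S.lambdaSup → S.lambdaSup < 1 →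
        (1 / (1 - S.lambdaSup)) ^ (1 / M : ℝ) ≤ Real.tan (width S.bdryAtInfinity) := by
  refine ⟨64, 1 - (1 / 16) ^ 64, by norm_num, by norm_num, by norm_num, ?_⟩
  intro S φ hS _ ho hb hδ h1
  have hδ0 : (0 : ℝ) < 1 - (1 / 16) ^ 64 := by norm_num
  have hδ1 : (3 / 4 : ℝ) ≤ 1 - (1 / 16) ^ 64 := by norm_num
  have hbdd : BddAbove (range S.lambdaAt) := by
    by_contra hcon
    have h0 : S.lambdaSup = 0 := Real.iSup_of_not_bddAbove hcon
    linarith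
  have hΛ : ∀ s, Real.sqrt ((S.toMaxSurf hS).ell s) ≤ S.lambdaSup := fun s => le_ciSup hbdd s
  obtain ⟨G, A, hull⟩ := exists_positive S hS φ.injective ho hb
  rw [hb]
  obtain ⟨ε, hε⟩ : ∃ ε, ε = 1 - S.lambdaSup := ⟨_, rfl⟩
  have hε0 : 0 < ε := by linarith
  have hε1 : ε ≤ (1 / 16) ^ 64 := by linarith
  have hε2 : ε ≤ 1 / 4 := by linarith
  obtain ⟨s, hs⟩ : ∃ s, 1 - 2 * ε < S.lambdaAt s :=
    exists_lt_of_lt_ciSup (show 1 - 2 * ε < ⨆ y, S.lambdaAt y by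
      change 1 - 2 * ε < S.lambdaSup; linarith)
  have hl : 1 - 2 * ε < Real.sqrt ((S.toMaxSurf hS).ell s) := hs
  have hell : 0 < (S.toMaxSurf hS).ell s := Real.sqrt_pos.1 (by linarith)
  have hlog : -(1 / 2 * Real.log ((S.toMaxSurf hS).ell s)) ≤ 4 * ε := by
    have h2 := Real.log_sqrt hell.le
    have h3 := Real.one_sub_inv_le_log_of_pos (Real.sqrt_pos.2 hell)
    have h4 : (Real.sqrt ((S.toMaxSurf hS).ell s))⁻¹ ≤ 1 + 4 * ε := by
      rw [inv_le_comm₀ (by linarith) (by linarith)]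
      refine le_trans ?_ hl.le
      rw [inv_le_iff_one_le_mul₀ (by linarith)]
      nlinarith
    linarith
  obtain ⟨e, he⟩ : ∃ e, e = ε ^ (1 / 64 : ℝ) := ⟨_, rfl⟩
  have he0 : 0 < e := by rw [he]; positivity
  have he64 : e ^ 64 = ε := by
    rw [he, ← Real.rpow_natCast, ← Real.rpow_mul hε0.le]
    norm_num
  have he1 : e ≤ 1 / 16 := by
    rw [← he64] at hε1
    exact (pow_le_pow_iff_left₀ he0.le (by norm_num) (by norm_num)).1 hε1
  have hmain := A.le_tan_width hΛ h1 hull hell (σ := 2 * e ^ 2) (by positivity) (by nlinarith) (by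
    have h5 : (2 * e ^ 2) ^ 32 / 2 ^ 22 = 2 ^ 10 * ε := by
      rw [mul_pow, ← pow_mul, he64]; ring
    rw [h5]
    linarith)
  refine le_trans ?_ hmain
  rw [← hε, Real.div_rpow zero_le_one hε0.le, Real.one_rpow, ← he]
  exact one_div_le_one_div_of_le (by positivity) (by nlinarith)

end AdSPaper
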